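/- arXiv:2209.03675 — 2 statements merged into one kernel-verified Lean document; each statement's English description precedes it below -/
import Mathlib

section
/- For every odd positive integer k there is a constant C_k > 0 such that the following holds. Let f be a positive integer and let H be a graph on n vertices equipped with a linear order on its edges that admits a 2k double-blocking set of size at most f·|E(H)|. Then |E(H)| ≤ C_k·(n^{1+1/k} + n^{1+1/(k+2)}·f^{k/(k+2)} + n^{1+1/(k+1)}·f^{1/2} + f·n). -/
open SimpleGraph
open scoped ENNReal

noncomputable section

/-- Weighted distance in a graph: the infimum, over all walks from `u` to `v`,
of the total weight of the walk's edges (`⊤` if there is no walk). -/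
def wdist {V : Type} (G : SimpleGraph V) (w : Sym2 V → ℝ≥0∞) (u v : V) : ℝ≥0∞ :=
  ⨅ p : G.Walk u v, (p.edges.map w).sum

/-- Distance in a graph `H` whose edge `(x, y)` is (re)weighted to `δ x y`. -/
def emulDist {V : Type} (H : SimpleGraph V) (δ : V → V → ℝ≥0∞) (u v : V) : ℝ≥0∞ :=
  ⨅ p : H.Walk u v, (p.darts.map (fun d => δ d.toProd.1 d.toProd.2)).sum

/-- `H` is an `f`-edge-fault-tolerant `t`-emulator of the weighted graph `(G, w)`:
for every fault set `F ⊆ E(G)` with `|F| ≤ f`, the graph `H` with every edge `(x,y)`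
reweighted to `dist_{G∖F}(x,y)` approximates all distances of `G ∖ F` within factor `t`. -/
def IsEFTEmulator {V : Type} (G : SimpleGraph V) (w : Sym2 V → ℝ≥0∞)
    (H : SimpleGraph V) (f : ℕ) (t : ℝ≥0∞) : Prop :=
  ∀ F : Finset (Sym2 V), ↑F ⊆ G.edgeSet → F.card ≤ f →
    ∀ u v : V,
      wdist (G.deleteEdges ↑F) w u v ≤ emulDist H (wdist (G.deleteEdges ↑F) w) u v ∧
      emulDist H (wdist (G.deleteEdges ↑F) w) u v ≤ t * wdist (G.deleteEdges ↑F) w u v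

/-- `e` is the last edge of the list `l` in the order given by the ranking `π`. -/
def IsLastEdge {V : Type} (π : Sym2 V → ℕ) (l : List (Sym2 V)) (e : Sym2 V) : Prop :=
  e ∈ l ∧ ∀ e' ∈ l, π e' ≤ π e

/-- The cycle `p` is blocked by the unordered pair `b` of edges: both members of `b`
lie on `p` and one of them is the last edge of `p` in the order `π`. -/
def CycleBlockedBy {V : Type} {H : SimpleGraph V} (π : Sym2 V → ℕ) {u : V}
    (p : H.Walk u u) (b : Sym2 (Sym2 V)) : Prop :=
  ∃ e1 e2 : Sym2 V, b = s(e1, e2) ∧ e1 ∈ p.edges ∧ e2 ∈ p.edges ∧ IsLastEdge π p.edges e1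

/-- `B` is a `2k` double-blocking set for `H` with edge order `π`: it consists of
unordered pairs of distinct edges of `H`, every cycle with at most `2k` edges is blocked
by a member of `B`, and every cycle with at most `k+1` edges is blocked by two
distinct members of `B`. -/
def IsDoubleBlockingSet {V : Type} (H : SimpleGraph V) (π : Sym2 V → ℕ) (k : ℕ)
    (B : Finset (Sym2 (Sym2 V))) : Prop :=
  (∀ b ∈ B, ¬ b.IsDiag ∧ ∀ e ∈ b, e ∈ H.edgeSet) ∧
  (∀ (u : V) (p : H.Walk u u), p.IsCycle → p.length ≤ 2 * k →
      ∃ b ∈ B, CycleBlockedBy π p b) ∧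
  (∀ (u : V) (p : H.Walk u u), p.IsCycle → p.length ≤ k + 1 →
      ∃ b1 ∈ B, ∃ b2 ∈ B, b1 ≠ b2 ∧ CycleBlockedBy π p b1 ∧ CycleBlockedBy π p b2)

/-- The number of pairs of `B` containing the edge `e`. -/
def edgeBlockCount {V : Type} (B : Finset (Sym2 (Sym2 V))) (e : Sym2 V) : ℕ :=
  {b ∈ (B : Set (Sym2 (Sym2 V))) | e ∈ b}.ncard

/-- The `i`-th edge of the vertex sequence `v`. -/
def edgeOf {V : Type} {k : ℕ} (v : Fin (k + 1) → V) (i : Fin k) : Sym2 V :=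
  s(v i.castSucc, v i.succ)

/-- The average degree `2|E(H)|/n` of a graph on `n` vertices. -/
def avgDeg {V : Type} [Fintype V] (H : SimpleGraph V) : ℝ :=
  2 * (H.edgeSet.ncard : ℝ) / (Fintype.card V : ℝ)

end
noncomputable section

/-- `v` is a SCUM `k`-path (for odd `k`), viewed as an oriented sequence of `k+1`
distinct pairwise-adjacent vertices: it is simple, its middle edge (the edge with
0-indexed position `(k-1)/2`, i.e. the index `j` with `2j+1 = k`) is the last edge
of the path in the order `π`, and the two oriented subpaths starting from the middle
edge and going towards either endpoint are chain-unblocked with respect to `B`. -/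
def IsSCUM {V : Type} (H : SimpleGraph V) (π : Sym2 V → ℕ) (B : Finset (Sym2 (Sym2 V)))
    (k : ℕ) (v : Fin (k + 1) → V) : Prop :=
  Function.Injective v ∧
  (∀ i : Fin k, H.Adj (v i.castSucc) (v i.succ)) ∧
  (∀ i j : Fin k, 2 * (j : ℕ) + 1 = k → π (edgeOf v i) ≤ π (edgeOf v j)) ∧
  (∀ (i : Fin k) (j : Fin (k + 1)), 2 * (i : ℕ) + 1 ≤ k → (j : ℕ) + 1 ≤ (i : ℕ) →
      ∀ e' : Sym2 V, s(edgeOf v i, e') ∈ B → v j ∉ e') ∧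
  (∀ (i : Fin k) (j : Fin (k + 1)), k ≤ 2 * (i : ℕ) + 1 → (i : ℕ) + 2 ≤ (j : ℕ) →
      ∀ e' : Sym2 V, s(edgeOf v i, e') ∈ B → v j ∉ e')

/-- The number of (oriented) SCUM `k`-paths of `H`. -/
def scumCount {V : Type} (H : SimpleGraph V) (π : Sym2 V → ℕ)
    (B : Finset (Sym2 (Sym2 V))) (k : ℕ) : ℕ :=
  {v : Fin (k + 1) → V | IsSCUM H π B k v}.ncard

/-- The number of (oriented, aligned) SCUM `k`-path meets of `H`: pairs of distinct
SCUM `k`-paths sharing both endpoints. -/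
def scumMeetCount {V : Type} (H : SimpleGraph V) (π : Sym2 V → ℕ)
    (B : Finset (Sym2 (Sym2 V))) (k : ℕ) : ℕ :=
  {vv : (Fin (k + 1) → V) × (Fin (k + 1) → V) |
    IsSCUM H π B k vv.1 ∧ IsSCUM H π B k vv.2 ∧ vv.1 ≠ vv.2 ∧
    vv.1 0 = vv.2 0 ∧ vv.1 (Fin.last k) = vv.2 (Fin.last k)}.ncard

/-- The oriented path given by the vertex sequence `a` is chain-unblocked with
respect to `B`: for any edge `e` of the path and any vertex `x` strictly following
`e` along the path, no pair `{e, e'} ∈ B` has `e'` incident on `x`. -/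
def ChainUnblockedSeq {V : Type} (B : Finset (Sym2 (Sym2 V))) {L : ℕ}
    (a : Fin (L + 1) → V) : Prop :=
  ∀ (i : Fin L) (j : Fin (L + 1)), (i : ℕ) + 2 ≤ (j : ℕ) →
    ∀ e' : Sym2 V, s(edgeOf a i, e') ∈ B → a j ∉ e'

/-- The walk `p` is blocked: some pair of `B` has both its edges on `p`. -/
def PathBlocked {V : Type} {H : SimpleGraph V} (B : Finset (Sym2 (Sym2 V)))
    {u v : V} (p : H.Walk u v) : Prop :=
  ∃ b ∈ B, ∀ e ∈ b, e ∈ p.edges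

/-- The walk `p` is double-blocked: two distinct pairs of `B` have both their edges on `p`. -/
def PathDoubleBlocked {V : Type} {H : SimpleGraph V} (B : Finset (Sym2 (Sym2 V)))
    {u v : V} (p : H.Walk u v) : Prop :=
  ∃ b1 ∈ B, ∃ b2 ∈ B, b1 ≠ b2 ∧ (∀ e ∈ b1, e ∈ p.edges) ∧ (∀ e ∈ b2, e ∈ p.edges)

/-- The subgraph of `H` consisting of the edge `e` together with all edges
preceding it in the order `π`. -/
def subEdges {V : Type} (H : SimpleGraph V) (π : Sym2 V → ℕ) (e : Sym2 V) : SimpleGraph V :=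
  SimpleGraph.fromEdgeSet {e' ∈ H.edgeSet | π e' ≤ π e}

/-- `e` is a core edge of `H` (with respect to edge order `π` and degree threshold `d/4`):
`e` survives in the graph obtained from the subgraph of edges up to `e` by iteratively
deleting vertices of degree at most `d/4`; equivalently, there is a set `S` of vertices
containing both endpoints of `e` on which the subgraph of edges up to `e` induces
a graph of minimum degree greater than `d/4`. -/
def IsCoreEdge {V : Type} (H : SimpleGraph V) (π : Sym2 V → ℕ) (d : ℝ) (e : Sym2 V) : Prop :=
  e ∈ H.edgeSet ∧
  ∃ S : Set V, (∀ x ∈ e, x ∈ S) ∧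
    ∀ v ∈ S, d / 4 < ({u ∈ S | (subEdges H π e).Adj v u}.ncard : ℝ)

end


namespace DoubleBlocking

/-- A symmetric relation on the edges of `G` of degree at most `f` such that in every closed trail
with at most `2k` edges the last edge is related to some edge of the trail, and to two of them if
the trail has at most `k+1` edges. -/
structure BlockingSystem {V : Type} (G : SimpleGraph V) (π : Sym2 V → ℕ)
    (R : Sym2 V → Sym2 V → Prop) (k f : ℕ) : Prop where
  symm : ∀ e e', R e e' → R e' e
  irrefl : ∀ e, ¬ R e e
  ncard_le : ∀ e, {e' | R e e'}.ncard ≤ f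
  single : ∀ (u : V) (w : G.Walk u u), w.IsTrail → w.length ≤ 2 * k → ∀ e ∈ w.edges,
    (∀ e' ∈ w.edges, π e' ≤ π e) → ∃ e' ∈ w.edges, R e e'
  double : ∀ (u : V) (w : G.Walk u u), w.IsTrail → w.length ≤ k + 1 → ∀ e ∈ w.edges,
    (∀ e' ∈ w.edges, π e' ≤ π e) → ∃ e₁ ∈ w.edges, ∃ e₂ ∈ w.edges, e₁ ≠ e₂ ∧ R e e₁ ∧ R e e₂

section SparseTrails

variable {V : Type} {G : SimpleGraph V} {π : Sym2 V → ℕ} {R : Sym2 V → Sym2 V → Prop} {k f : ℕ}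

/-- A trail each of whose edges is related to at most one other edge of the trail. -/
def IsSparseTrail (R : Sym2 V → Sym2 V → Prop) {x y : V} (w : G.Walk x y) : Prop :=
  w.IsTrail ∧ ∀ e ∈ w.edges, ∀ e₁ ∈ w.edges, ∀ e₂ ∈ w.edges, R e e₁ → R e e₂ → e₁ = e₂

/-- The sparse trails of length `l` from `x` to `y`. -/
noncomputable def sparseTrails [Fintype V] (G : SimpleGraph V) (R : Sym2 V → Sym2 V → Prop)
    (l : ℕ) (x y : V) : Finset (G.Walk x y) :=
  open Classical in (G.finsetWalkLength l x y).filter (fun w => IsSparseTrail R w)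

lemma mem_sparseTrails [Fintype V] {l : ℕ} {x y : V} {w : G.Walk x y} :
    w ∈ sparseTrails G R l x y ↔ w.length = l ∧ IsSparseTrail R w := by
  classical
  simp [sparseTrails, SimpleGraph.mem_finsetWalkLength_iff]

lemma IsSparseTrail.of_append {x y z : V} {p : G.Walk x y} {q : G.Walk y z}
    (h : IsSparseTrail R (p.append q)) : IsSparseTrail R p ∧ IsSparseTrail R q := by
  obtain ⟨h1, h2⟩ := h
  simp only [SimpleGraph.Walk.edges_append, List.mem_append] at h2
  exact ⟨⟨h1.of_append_left, fun e he e₁ h₁ e₂ h₂ => h2 e (.inl he) e₁ (.inl h₁) e₂ (.inl h₂)⟩,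
    ⟨h1.of_append_right, fun e he e₁ h₁ e₂ h₂ => h2 e (.inr he) e₁ (.inr h₁) e₂ (.inr h₂)⟩⟩

lemma exists_append_cons_of_mem_edges {x y : V} (w : G.Walk x y) {e : Sym2 V}
    (he : e ∈ w.edges) : ∃ (u v : V) (p : G.Walk x u) (h : G.Adj u v) (q : G.Walk v y),
      s(u, v) = e ∧ w = p.append (SimpleGraph.Walk.cons h q) := by
  induction w with
  | nil => simp at he
  | @cons a b c h w ih =>
    rw [SimpleGraph.Walk.edges_cons, List.mem_cons] at he
    rcases he with rfl | he
    · exact ⟨a, b, .nil, h, w, rfl, rfl⟩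
    · obtain ⟨u, v, p, h', q, h1, rfl⟩ := ih he
      exact ⟨u, v, .cons h p, h', q, h1, rfl⟩

/-- Two edge-disjoint sparse trails of length at most `(k+1)/2` with the same ends contain a pair
of related edges, one on each. -/
lemma BlockingSystem.exists_rel_of_disjoint (hB : BlockingSystem G π R k f) {x y : V}
    {p q : G.Walk x y} (hp : IsSparseTrail R p) (hq : IsSparseTrail R q)
    (hd : p.edges.Disjoint q.edges) (h0 : 0 < p.length) (hl : p.length + q.length ≤ k + 1) :
    ∃ e ∈ p.edges, ∃ e' ∈ q.edges, R e e' := by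
  classical
  set w := p.append q.reverse with hw
  have hmem : ∀ e, e ∈ w.edges ↔ e ∈ p.edges ∨ e ∈ q.edges := by
    intro e; simp [hw]
  have htr : w.IsTrail := by
    rw [SimpleGraph.Walk.isTrail_def, hw, SimpleGraph.Walk.edges_append, List.nodup_append']
    refine ⟨hp.1.edges_nodup, hq.1.reverse.edges_nodup, ?_⟩
    simpa using hd
  have hne : w.edges.toFinset.Nonempty := by
    have : 0 < p.edges.length := by simpa using h0
    obtain ⟨e, he⟩ := List.exists_mem_of_length_pos this
    exact ⟨e, by simp [hmem, he]⟩
  obtain ⟨e, he, hmax⟩ := Finset.exists_max_image w.edges.toFinset π hne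
  simp only [List.mem_toFinset] at he hmax
  obtain ⟨e₁, h₁, e₂, h₂, hne, r₁, r₂⟩ := hB.double x w htr (by simpa [hw] using hl) e he hmax
  rw [hmem] at he h₁ h₂
  have hp2 := hp.2
  have hq2 := hq.2
  have := hB.symm
  grind

lemma BlockingSystem.card_related_le [Fintype V] (hB : BlockingSystem G π R k f)
    {x y : V} (p : G.Walk x y) (U : Finset (Sym2 V)) (hU : ∀ e' ∈ U, ∃ e ∈ p.edges, R e e') :
    U.card ≤ p.length * f := by
  classical
  have h1 : U ⊆ p.edges.toFinset.biUnion (fun e => Finset.univ.filter (fun e' => R e e')) := by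
    intro e' he'
    obtain ⟨e, he, hr⟩ := hU e' he'
    simp only [Finset.mem_biUnion, List.mem_toFinset, Finset.mem_filter, Finset.mem_univ, true_and]
    exact ⟨e, he, hr⟩
  refine (Finset.card_le_card h1).trans ((Finset.card_biUnion_le_card_mul _ _ f ?_).trans ?_)
  · intro e _
    have := hB.ncard_le e
    rwa [Set.ncard_eq_toFinset_card', Set.toFinset_ofPred] at this
  · gcongr
    exact (List.toFinset_card_le _).trans (by simp)

/-- A family of pairwise edge-disjoint sparse trails with common ends is small. -/
lemma BlockingSystem.card_disjoint_family_le [Fintype V] (hB : BlockingSystem G π R k f)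
    {l : ℕ} (hl0 : 0 < l) (hl : 2 * l ≤ k + 1) {x y : V} (T : Finset (G.Walk x y))
    (hT : T ⊆ sparseTrails G R l x y)
    (hd : ∀ p ∈ T, ∀ q ∈ T, p ≠ q → p.edges.Disjoint q.edges) : T.card ≤ 1 + l * f := by
  classical
  rcases T.eq_empty_or_nonempty with rfl | ⟨p, hp⟩
  · simp
  have hp' := mem_sparseTrails.1 (hT hp)
  have key : ∀ q ∈ T.erase p, ∃ e', e' ∈ q.edges ∧ ∃ e ∈ p.edges, R e e' := by
    intro q hq
    have hqT := Finset.mem_of_mem_erase hq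
    have hq' := mem_sparseTrails.1 (hT hqT)
    obtain ⟨e, he, e', he', hr⟩ := hB.exists_rel_of_disjoint hp'.2 hq'.2
      (hd p hp q hqT (Finset.ne_of_mem_erase hq).symm) (by omega) (by omega)
    exact ⟨e', he', e, he, hr⟩
  have : Nonempty (Sym2 V) := ⟨s(x, x)⟩
  choose! g hg1 hg2 using key
  have hinj : Set.InjOn g (↑(T.erase p) : Set (G.Walk x y)) := by
    intro q hq q' hq' h
    by_contra hne
    have h1 := hg1 q hq
    rw [h] at h1
    exact hd q (Finset.mem_of_mem_erase hq) q' (Finset.mem_of_mem_erase hq') hne h1 (hg1 q' hq')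
  have h2 : ((T.erase p).image g).card ≤ p.length * f := by
    apply hB.card_related_le
    intro e' he'
    obtain ⟨q, hq, rfl⟩ := Finset.mem_image.1 he'
    exact hg2 q hq
  rw [Finset.card_image_of_injOn hinj, Finset.card_erase_of_mem hp, hp'.1] at h2
  omega

lemma card_sparseTrails_zero_le [Fintype V] (x y : V) : (sparseTrails G R 0 x y).card ≤ 1 := by
  rw [Finset.card_le_one]
  intro p hp q hq
  rw [mem_sparseTrails] at hp hq
  cases p with
  | nil =>
    cases q with
    | nil => rfl
    | cons _ _ => simp at hq
  | cons _ _ => simp at hp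

lemma card_sparseTrails_one_le [Fintype V] (x y : V) : (sparseTrails G R 1 x y).card ≤ 1 := by
  rw [Finset.card_le_one]
  intro p hp q hq
  rw [mem_sparseTrails] at hp hq
  apply SimpleGraph.Walk.ext_support
  have h1 : ∀ r : G.Walk x y, r.length = 1 → r.support = [x, y] := by
    intro r hr
    cases r with
    | nil => simp at hr
    | cons h r =>
      cases r with
      | nil => simp
      | cons h r => simp at hr
  rw [h1 p hp.1, h1 q hq.1]

/-- The number of sparse trails of length `l ≥ 2` in terms of shorter ones. -/
lemma BlockingSystem.card_sparseTrails_step [Fintype V] (hB : BlockingSystem G π R k f)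
    (hf : 1 ≤ f) {l C : ℕ} (hl0 : 2 ≤ l) (hl : 2 * l ≤ k + 1)
    (ih : ∀ j < l, ∀ x y : V, (sparseTrails G R j x y).card ≤ C * f ^ (j - 1)) (x y : V) :
    (sparseTrails G R l x y).card ≤ ((1 + l) * (2 * l) * (l * (C * C))) * f ^ (l - 1) := by
  classical
  let fam := (sparseTrails G R l x y).powerset.filter
    (fun T => ∀ p ∈ T, ∀ q ∈ T, p ≠ q → p.edges.Disjoint q.edges)
  obtain ⟨T, hT, hmax⟩ := Finset.exists_max_image fam Finset.card ⟨∅, by simp [fam]⟩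
  simp only [fam, Finset.mem_filter, Finset.mem_powerset] at hT hmax
  have hTc := hB.card_disjoint_family_le (by omega) hl T hT.1 hT.2
  let Dh : Finset (V × V) := T.biUnion (fun q =>
    (q.darts.map (fun d => d.toProd)).toFinset ∪ (q.darts.map (fun d => d.toProd.swap)).toFinset)
  have hDh : Dh.card ≤ (1 + l * f) * (2 * l) := by
    refine (Finset.card_biUnion_le_card_mul _ _ (2 * l) ?_).trans (by gcongr)
    intro q hq
    have hq' := (mem_sparseTrails.1 (hT.1 hq)).1
    refine (Finset.card_union_le _ _).trans ?_
    have h1 := List.toFinset_card_le (q.darts.map (fun d => d.toProd))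
    have h2 := List.toFinset_card_le (q.darts.map (fun d => d.toProd.swap))
    simp only [List.length_map, SimpleGraph.Walk.length_darts, hq'] at h1 h2
    omega
  let A : V × V → ℕ → Finset (G.Walk x y) := fun d i => (sparseTrails G R l x y).filter
    (fun w => ∃ (p : G.Walk x d.1) (h : G.Adj d.1 d.2) (q : G.Walk d.2 y),
      p.length = i ∧ w = p.append (SimpleGraph.Walk.cons h q))
  have hcover : sparseTrails G R l x y ⊆
      Dh.biUnion (fun d => (Finset.range l).biUnion (fun i => A d i)) := by
    intro w hw
    have hwl := mem_sparseTrails.1 hw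
    have hsh : ∃ q ∈ T, ∃ e ∈ w.edges, e ∈ q.edges := by
      by_contra! hcon
      have hnot : w ∉ T := by
        intro hwT
        have : 0 < w.edges.length := by simp; omega
        obtain ⟨e, he⟩ := List.exists_mem_of_length_pos this
        exact hcon w hwT e he he
      have := hmax (insert w T) ⟨Finset.insert_subset hw hT.1, ?_⟩
      · rw [Finset.card_insert_of_notMem hnot] at this
        omega
      · intro p hp q hq hpq
        rw [Finset.mem_insert] at hp hq
        rcases hp with rfl | hp <;> rcases hq with rfl | hq
        · exact absurd rfl hpq
        · exact fun e h1 h2 => hcon q hq e h1 h2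
        · exact fun e h1 h2 => hcon p hp e h2 h1
        · exact hT.2 p hp q hq hpq
    obtain ⟨q, hq, e, hew, heq⟩ := hsh
    obtain ⟨u, v, p, h, p', huv, rfl⟩ := exists_append_cons_of_mem_edges w hew
    simp only [Finset.mem_biUnion, Finset.mem_range]
    refine ⟨(u, v), ?_, p.length, ?_, ?_⟩
    · simp only [Dh, Finset.mem_biUnion]
      refine ⟨q, hq, ?_⟩
      rw [SimpleGraph.Walk.edges, List.mem_map] at heq
      obtain ⟨d, hd, hde⟩ := heq
      rw [← huv] at hde
      simp only [Finset.mem_union, List.mem_toFinset, List.mem_map]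
      have h3 : d.toProd = (u, v) ∨ d.toProd = (u, v).swap :=
        SimpleGraph.dart_edge_eq_mk'_iff.1 hde
      rcases h3 with h3 | h3
      · exact .inl ⟨d, hd, h3⟩
      · exact .inr ⟨d, hd, by rw [h3]; rfl⟩
    · have := hwl.1
      simp at this
      omega
    · simp only [A, Finset.mem_filter]
      exact ⟨hw, p, h, p', rfl, rfl⟩
  have hA : ∀ d i, i < l → (A d i).card ≤ C * C * f ^ (l - 2) := by
    rintro ⟨u, v⟩ i hi
    by_cases h : G.Adj u v
    · have h1 : A (u, v) i ⊆ (sparseTrails G R i x u ×ˢ sparseTrails G R (l - 1 - i) v y).image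
          (fun pq => pq.1.append (SimpleGraph.Walk.cons h pq.2)) := by
        intro w hw
        simp only [A, Finset.mem_filter] at hw
        obtain ⟨hw, p, _, q, hpi, rfl⟩ := hw
        rw [mem_sparseTrails] at hw
        have h2 := hw.2.of_append
        have h3 : IsSparseTrail R q := by
          have : (SimpleGraph.Walk.cons h q) = (SimpleGraph.Walk.cons h .nil).append q := rfl
          rw [this] at h2
          exact h2.2.of_append.2
        simp only [Finset.mem_image, Finset.mem_product, mem_sparseTrails]
        refine ⟨(p, q), ⟨⟨hpi, h2.1⟩, ?_, h3⟩, rfl⟩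
        have := hw.1
        simp at this
        simp only
        omega
      refine (Finset.card_le_card h1).trans (Finset.card_image_le.trans ?_)
      rw [Finset.card_product]
      calc _ ≤ (C * f ^ (i - 1)) * (C * f ^ (l - 1 - i - 1)) := by
            gcongr
            · exact ih i hi _ _
            · exact ih _ (by omega) _ _
        _ = C * C * f ^ ((i - 1) + (l - 1 - i - 1)) := by ring
        _ ≤ _ := by gcongr; omega
    · have : A (u, v) i = ∅ := by
        simp only [A, Finset.filter_eq_empty_iff]
        rintro w _ ⟨p, h', _⟩
        exact h h'
      simp [this]
  calc _ ≤ _ := Finset.card_le_card hcover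
    _ ≤ Dh.card * (l * (C * C * f ^ (l - 2))) := by
        apply Finset.card_biUnion_le_card_mul
        intro d _
        refine (Finset.card_biUnion_le_card_mul _ _ _ (fun i hi => hA d i ?_)).trans ?_
        · simpa using hi
        · simp
    _ ≤ ((1 + l * f) * (2 * l)) * (l * (C * C * f ^ (l - 2))) := by gcongr
    _ ≤ (((1 + l) * f) * (2 * l)) * (l * (C * C * f ^ (l - 2))) := by
        gcongr; nlinarith
    _ = ((1 + l) * (2 * l) * (l * (C * C))) * (f * f ^ (l - 2)) := by ring
    _ = _ := by
        rw [← pow_succ']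
        congr 2
        omega

end SparseTrails

/-- There are `O(f^(l-1))` sparse trails of length `l ≤ (k+1)/2` between two given vertices. -/
theorem exists_card_sparseTrails_le (k : ℕ) : ∃ C : ℕ, 1 ≤ C ∧ ∀ (V : Type) [Fintype V]
    (G : SimpleGraph V) (π : Sym2 V → ℕ) (R : Sym2 V → Sym2 V → Prop) (f : ℕ), 1 ≤ f →
    BlockingSystem G π R k f → ∀ l, 2 * l ≤ k + 1 → ∀ x y : V,
      (sparseTrails G R l x y).card ≤ C * f ^ (l - 1) := by
  suffices H : ∀ L : ℕ, ∃ C : ℕ, 1 ≤ C ∧ ∀ (V : Type) [Fintype V]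
    (G : SimpleGraph V) (π : Sym2 V → ℕ) (R : Sym2 V → Sym2 V → Prop) (f : ℕ), 1 ≤ f →
    BlockingSystem G π R k f → ∀ l, l ≤ L → 2 * l ≤ k + 1 → ∀ x y : V,
      (sparseTrails G R l x y).card ≤ C * f ^ (l - 1) by
    obtain ⟨C, hC, h⟩ := H (k + 1)
    exact ⟨C, hC, fun V _ G π R f hf hB l hl => h V G π R f hf hB l (by omega) hl⟩
  intro L
  induction L with
  | zero =>
    refine ⟨1, le_rfl, fun V _ G π R f hf hB l hl _ x y => ?_⟩
    obtain rfl : l = 0 := by omega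
    simpa using card_sparseTrails_zero_le x y
  | succ L ih =>
    obtain ⟨C, hC, h⟩ := ih
    refine ⟨C + (1 + (L + 1)) * (2 * (L + 1)) * ((L + 1) * (C * C)), by omega,
      fun V _ G π R f hf hB l hl hlk x y => ?_⟩
    rcases Nat.lt_or_ge l (L + 1) with h1 | h1
    · refine (h V G π R f hf hB l (by omega) hlk x y).trans ?_
      gcongr
      omega
    · obtain rfl : l = L + 1 := by omega
      rcases Nat.eq_zero_or_pos L with rfl | hL
      · refine (card_sparseTrails_one_le x y).trans ?_
        simp
        omega
      · refine (hB.card_sparseTrails_step hf (by omega) hlk (C := C) ?_ x y).trans ?_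
        · intro j hj x y
          exact h V G π R f hf hB j (by omega) (by omega) x y
        · gcongr
          omega

section Counting

variable {Ω ι V : Type} {S : Finset Ω} {X : Ω → ι → V} {A A' : Set ι}

/-- The values of `x` at the coordinates in `A`. -/
noncomputable def reveal (A : Set ι) (x : ι → V) : ι → Option V :=
  open Classical in fun p => if p ∈ A then some (x p) else none

lemma reveal_eq_iff {x y : ι → V} : reveal A x = reveal A y ↔ ∀ p ∈ A, x p = y p := by
  classical
  constructor
  · intro h p hp
    have := congrFun h p
    simpa [reveal, hp] using this
  · intro h
    ext1 p
    by_cases hp : p ∈ A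
    · simp [reveal, hp, h p hp]
    · simp [reveal, hp]

/-- The number of ways in which the coordinates in `A` are filled by the points of `S`. -/
noncomputable def cnt (S : Finset Ω) (X : Ω → ι → V) (A : Set ι) : ℕ :=
  open Classical in (S.image (fun ω => reveal A (X ω))).card

/-- A function on `S` determined by the coordinates in `A` takes at most `cnt S X A` values. -/
lemma card_image_le_cnt {β : Type} [DecidableEq β] (g : Ω → β)
    (h : ∀ ω ∈ S, ∀ ω' ∈ S, (∀ p ∈ A, X ω p = X ω' p) → g ω = g ω') :
    (S.image g).card ≤ cnt S X A := by
  classical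
  have key : ∀ b ∈ S.image g, ∃ c, c ∈ S.image (fun ω => reveal A (X ω)) ∧
      ∃ ω ∈ S, g ω = b ∧ reveal A (X ω) = c := by
    intro b hb
    obtain ⟨ω, hω, rfl⟩ := Finset.mem_image.1 hb
    exact ⟨_, Finset.mem_image_of_mem _ hω, ω, hω, rfl, rfl⟩
  choose! r hr1 hr2 using key
  refine Finset.card_le_card_of_injOn r hr1 ?_
  intro b hb c hc hbc
  obtain ⟨ω, hω, h1, h2⟩ := hr2 b hb
  obtain ⟨ω', hω', h3, h4⟩ := hr2 c hc
  rw [← h1, ← h3]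
  exact h ω hω ω' hω' (reveal_eq_iff.1 (h2.trans (hbc.trans h4.symm)))

lemma cnt_le_of_determined
    (h : ∀ q ∈ A', ∃ q' ∈ A, ∀ ω ∈ S, X ω q = X ω q') : cnt S X A' ≤ cnt S X A := by
  classical
  refine card_image_le_cnt _ fun ω hω ω' hω' hp => reveal_eq_iff.2 fun q hq => ?_
  obtain ⟨q', hq', he⟩ := h q hq
  rw [he ω hω, he ω' hω', hp q' hq']

lemma cnt_mono (h : A' ⊆ A) : cnt S X A' ≤ cnt S X A :=
  cnt_le_of_determined fun q hq => ⟨q, h hq, fun _ _ => rfl⟩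

lemma cnt_empty_le : cnt S X ∅ ≤ 1 := by
  classical
  rw [cnt, Finset.card_le_one]
  intro a ha b hb
  obtain ⟨ω, _, rfl⟩ := Finset.mem_image.1 ha
  obtain ⟨ω', _, rfl⟩ := Finset.mem_image.1 hb
  exact reveal_eq_iff.2 (by simp)

lemma cnt_le_mul {J : Set ι} (N : ℕ) (hA : ∀ q ∈ A', q ∈ A ∨ q ∈ J)
    (h : ∀ ω₀ ∈ S, ∃ T : Finset (ι → V), T.card ≤ N ∧
      ∀ ω ∈ S, (∀ p ∈ A, X ω p = X ω₀ p) → ∃ t ∈ T, ∀ p ∈ J, X ω p = t p) :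
    cnt S X A' ≤ cnt S X A * N := by
  classical
  refine (cnt_mono (A := A ∪ J) hA).trans ?_
  let res : (ι → Option V) → (ι → Option V) := fun g p => if p ∈ A then g p else none
  have hres : ∀ x : ι → V, res (reveal (A ∪ J) x) = reveal A x := by
    intro x
    ext1 p
    by_cases hp : p ∈ A <;> simp [res, reveal, hp]
  have him : (S.image (fun ω => reveal (A ∪ J) (X ω))).image res
      = S.image (fun ω => reveal A (X ω)) := by
    rw [Finset.image_image]
    congr 1
    ext1 ω
    exact hres _
  unfold cnt
  rw [← him, mul_comm]
  apply Finset.card_le_mul_card_image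
  intro c hc
  rw [him] at hc
  obtain ⟨ω₀, hω₀, rfl⟩ := Finset.mem_image.1 hc
  obtain ⟨T, hT, hTS⟩ := h ω₀ hω₀
  refine le_trans (Finset.card_le_card ?_) ((Finset.card_image_le (s := T)
    (f := fun t => reveal (A ∪ J) (fun p => if p ∈ A then X ω₀ p else t p))).trans hT)
  intro g hg
  rw [Finset.mem_filter] at hg
  obtain ⟨hg, hg2⟩ := hg
  obtain ⟨ω, hω, rfl⟩ := Finset.mem_image.1 hg
  rw [hres, reveal_eq_iff] at hg2
  obtain ⟨t, ht, htJ⟩ := hTS ω hω hg2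
  refine Finset.mem_image.2 ⟨t, ht, reveal_eq_iff.2 fun p hp => ?_⟩
  by_cases hpA : p ∈ A
  · simp [hpA, hg2 p hpA]
  · simp [hpA, htJ p (hp.resolve_left hpA)]

/-- Revealing one coordinate. -/
lemma cnt_le_mul_one (N : ℕ) (q : ι) (hA : ∀ p ∈ A', p ∈ A ∨ p = q)
    (h : ∀ ω₀ ∈ S, ∃ T : Finset V, T.card ≤ N ∧
      ∀ ω ∈ S, (∀ p ∈ A, X ω p = X ω₀ p) → X ω q ∈ T) :
    cnt S X A' ≤ cnt S X A * N := by
  classical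
  refine cnt_le_mul (J := {q}) N hA fun ω₀ hω₀ => ?_
  obtain ⟨T, hT, h⟩ := h ω₀ hω₀
  refine ⟨T.image (fun v _ => v), Finset.card_image_le.trans hT, fun ω hω hp => ?_⟩
  exact ⟨fun _ => X ω q, Finset.mem_image_of_mem _ (h ω hω hp), by simp⟩

lemma cnt_start [Fintype V] (q : ι) (hA : ∀ p ∈ A', p ∈ A ∨ p = q) :
    cnt S X A' ≤ cnt S X A * Fintype.card V :=
  cnt_le_mul_one _ q hA fun _ _ => ⟨Finset.univ, le_rfl, by simp⟩

variable {G : SimpleGraph V} {π : Sym2 V → ℕ} {R : Sym2 V → Sym2 V → Prop} {k f D : ℕ}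

lemma cnt_neighbor [Fintype V] (hD : ∀ v, {u | G.Adj v u}.ncard ≤ D) (p q : ι) (hp : p ∈ A)
    (hadj : ∀ ω ∈ S, G.Adj (X ω p) (X ω q)) (hA : ∀ r ∈ A', r ∈ A ∨ r = q) :
    cnt S X A' ≤ cnt S X A * D := by
  classical
  refine cnt_le_mul_one _ q hA fun ω₀ _ => ⟨Finset.univ.filter (fun u => G.Adj (X ω₀ p) u), ?_, ?_⟩
  · have := hD (X ω₀ p)
    rwa [Set.ncard_eq_toFinset_card', Set.toFinset_ofPred] at this
  · intro ω hω h
    simpa [h p hp] using hadj ω hω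

/-- Revealing the vertices of a walk one after another. -/
lemma cnt_chain [Fintype V] (hD : ∀ v, {u | G.Adj v u}.ncard ≤ D) (p : ℕ → ι) (n : ℕ)
    (hp : p 0 ∈ A) (hadj : ∀ ω ∈ S, ∀ t < n, G.Adj (X ω (p t)) (X ω (p (t + 1))))
    (hA : ∀ r ∈ A', r ∈ A ∨ ∃ t, 1 ≤ t ∧ t ≤ n ∧ r = p t) :
    cnt S X A' ≤ cnt S X A * D ^ n := by
  induction n generalizing A' with
  | zero =>
    rw [pow_zero, mul_one]
    refine cnt_mono fun r hr => (hA r hr).resolve_right ?_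
    rintro ⟨t, h1, h2, _⟩
    omega
  | succ n ih =>
    have h1 := ih (A' := A ∪ {r | ∃ t, 1 ≤ t ∧ t ≤ n ∧ r = p t})
      (fun ω hω t ht => hadj ω hω t (by omega)) (fun r hr => hr)
    have h2 : cnt S X A' ≤ cnt S X (A ∪ {r | ∃ t, 1 ≤ t ∧ t ≤ n ∧ r = p t}) * D := by
      refine cnt_neighbor hD (p n) (p (n + 1)) ?_ (fun ω hω => hadj ω hω n (by omega)) ?_
      · rcases Nat.eq_zero_or_pos n with rfl | hn
        · exact .inl hp
        · exact .inr ⟨n, hn, le_rfl, rfl⟩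
      · intro r hr
        rcases hA r hr with h | ⟨t, ht1, ht2, rfl⟩
        · exact .inl (.inl h)
        · rcases Nat.lt_or_ge n t with h | h
          · obtain rfl : t = n + 1 := by omega
            exact .inr rfl
          · exact .inl (.inr ⟨t, ht1, h, rfl⟩)
    calc _ ≤ _ := h2
      _ ≤ _ := Nat.mul_le_mul_right D h1
      _ = _ := by ring

lemma BlockingSystem.card_filter_rel_le [Fintype V] (hB : BlockingSystem G π R k f) (e : Sym2 V)
    [DecidablePred (R e)] : (Finset.univ.filter (R e)).card ≤ f := by
  classical
  have := hB.ncard_le e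
  rwa [Set.ncard_eq_toFinset_card', Set.toFinset_ofPred, Finset.filter_congr_decidable] at this

/-- Revealing a vertex of an edge related to a revealed one. -/
lemma cnt_vertex_of_rel [Fintype V] (hB : BlockingSystem G π R k f) (p p' q : ι)
    (hp : p ∈ A) (hp' : p' ∈ A)
    (hR : ∀ ω ∈ S, ∃ e', R s(X ω p, X ω p') e' ∧ X ω q ∈ e')
    (hA : ∀ r ∈ A', r ∈ A ∨ r = q) : cnt S X A' ≤ cnt S X A * (2 * f) := by
  classical
  refine cnt_le_mul_one _ q hA fun ω₀ _ =>
    ⟨(Finset.univ.filter (R s(X ω₀ p, X ω₀ p'))).biUnion (fun e => Finset.univ.filter (· ∈ e)),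
      ?_, ?_⟩
  · refine (Finset.card_biUnion_le_card_mul _ _ 2 fun e _ => ?_).trans ?_
    · induction e with
      | _ x y =>
        have : (Finset.univ.filter (· ∈ s(x, y))) ⊆ {x, y} := by
          intro v; simp
        exact (Finset.card_le_card this).trans Finset.card_le_two
    · rw [mul_comm]
      gcongr
      exact hB.card_filter_rel_le _
  · intro ω hω h
    obtain ⟨e', h1, h2⟩ := hR ω hω
    rw [h p hp, h p' hp'] at h1
    simp only [Finset.mem_biUnion, Finset.mem_filter, Finset.mem_univ, true_and]
    exact ⟨e', h1, h2⟩

/-- Revealing both ends of an edge related to a revealed one. -/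
lemma cnt_edge_of_rel [Fintype V] (hB : BlockingSystem G π R k f) (p p' q q' : ι)
    (hp : p ∈ A) (hp' : p' ∈ A)
    (hR : ∀ ω ∈ S, R s(X ω p, X ω p') s(X ω q, X ω q'))
    (hA : ∀ r ∈ A', r ∈ A ∨ r = q ∨ r = q') : cnt S X A' ≤ cnt S X A * (2 * f) := by
  classical
  refine cnt_le_mul (J := {q, q'}) _ hA fun ω₀ _ =>
    ⟨(Finset.univ.filter (R s(X ω₀ p, X ω₀ p'))).biUnion (fun e =>
      (Finset.univ.filter (fun z : V × V => s(z.1, z.2) = e)).image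
        (fun z r => if r = q then z.1 else z.2)), ?_, ?_⟩
  · refine (Finset.card_biUnion_le_card_mul _ _ 2 fun e _ => ?_).trans ?_
    · refine Finset.card_image_le.trans ?_
      induction e with
      | _ x y =>
        have : (Finset.univ.filter (fun z : V × V => s(z.1, z.2) = s(x, y))) ⊆
            {(x, y), (y, x)} := by
          rintro ⟨v, w⟩; simp
        exact (Finset.card_le_card this).trans Finset.card_le_two
    · rw [mul_comm]
      gcongr
      exact hB.card_filter_rel_le _
  · intro ω hω h
    have h1 := hR ω hω
    rw [h p hp, h p' hp'] at h1
    refine ⟨fun r => if r = q then X ω q else X ω q', ?_, ?_⟩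
    · simp only [Finset.mem_biUnion, Finset.mem_filter, Finset.mem_univ, true_and,
        Finset.mem_image]
      exact ⟨_, h1, (X ω q, X ω q'), rfl, rfl⟩
    · rintro r (rfl | rfl)
      · simp
      · by_cases h : r = q
        · simp [h]
        · simp [h]

end Counting

section Sequences

variable {V : Type} {G : SimpleGraph V} {π : Sym2 V → ℕ} {R : Sym2 V → Sym2 V → Prop} {k f : ℕ}

/-- The `t`-th edge of a sequence of vertices. -/
def stepEdge (c : ℕ → V) (t : ℕ) : Sym2 V := s(c t, c (t + 1))

lemma exists_walk_of_seq (c : ℕ → V) (l : ℕ) (hadj : ∀ t < l, G.Adj (c t) (c (t + 1))) :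
    ∃ w : G.Walk (c 0) (c l), w.length = l ∧ w.edges = (List.range l).map (stepEdge c) ∧
      ∀ t ≤ l, w.getVert t = c t := by
  induction l with
  | zero => exact ⟨.nil, rfl, rfl, fun t ht => by obtain rfl : t = 0 := by omega
                                                  simp⟩
  | succ l ih =>
    obtain ⟨w, h1, h2, h3⟩ := ih fun t ht => hadj t (by omega)
    refine ⟨w.concat (hadj l (by omega)), by simp [h1], ?_, ?_⟩
    · rw [SimpleGraph.Walk.edges_concat, h2, List.range_succ, List.map_append]
      simp [stepEdge]
    · intro t ht
      rw [SimpleGraph.Walk.concat_eq_append, SimpleGraph.Walk.getVert_append, h1]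
      split_ifs with h
      · exact h3 t h.le
      · rcases Nat.lt_or_ge l t with h' | h'
        · obtain rfl : t = l + 1 := by omega
          simp
        · obtain rfl : t = l := by omega
          simp

/-- The sequence `c 0, …, c l` is a sparse trail. -/
structure IsSparseSeq (G : SimpleGraph V) (R : Sym2 V → Sym2 V → Prop) (c : ℕ → V) (l : ℕ) :
    Prop where
  adj : ∀ t < l, G.Adj (c t) (c (t + 1))
  distinct : ∀ t < l, ∀ t' < l, stepEdge c t = stepEdge c t' → t = t'
  sparse : ∀ t < l, ∀ t₁ < l, ∀ t₂ < l, R (stepEdge c t) (stepEdge c t₁) →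
    R (stepEdge c t) (stepEdge c t₂) → t₁ = t₂

lemma IsSparseSeq.exists_walk [Fintype V] {c : ℕ → V} {l : ℕ} (h : IsSparseSeq G R c l) :
    ∃ w ∈ sparseTrails G R l (c 0) (c l), ∀ t ≤ l, w.getVert t = c t := by
  obtain ⟨w, h1, h2, h3⟩ := exists_walk_of_seq c l h.adj
  refine ⟨w, mem_sparseTrails.2 ⟨h1, ?_, ?_⟩, h3⟩
  · rw [SimpleGraph.Walk.isTrail_def, h2]
    refine List.Nodup.map_on ?_ List.nodup_range
    intro t ht t' ht' he
    exact h.distinct t (by simpa using ht) t' (by simpa using ht') he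
  · rw [h2]
    simp only [List.mem_map, List.mem_range]
    rintro _ ⟨t, ht, rfl⟩ _ ⟨t₁, ht₁, rfl⟩ _ ⟨t₂, ht₂, rfl⟩ r₁ r₂
    rw [h.sparse t ht t₁ ht₁ t₂ ht₂ r₁ r₂]

/-- Revealing a sparse trail both of whose ends are revealed. -/
lemma cnt_block [Fintype V] {Ω ι : Type} {S : Finset Ω} {X : Ω → ι → V} {A A' : Set ι} {C l : ℕ}
    (hC : ∀ x y : V, (sparseTrails G R l x y).card ≤ C * f ^ (l - 1)) (p : ℕ → ι)
    (h0 : p 0 ∈ A) (hl : p l ∈ A) (hS : ∀ ω ∈ S, IsSparseSeq G R (fun t => X ω (p t)) l)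
    (hA : ∀ r ∈ A', r ∈ A ∨ ∃ t ≤ l, r = p t) :
    cnt S X A' ≤ cnt S X A * (C * f ^ (l - 1)) := by
  classical
  refine cnt_le_mul (J := {r | ∃ t ≤ l, r = p t}) _ hA fun ω₀ _ =>
    ⟨(sparseTrails G R l (X ω₀ (p 0)) (X ω₀ (p l))).image
      (fun w r => if h : ∃ t ≤ l, r = p t then w.getVert h.choose else X ω₀ r),
      Finset.card_image_le.trans (hC _ _), fun ω hω h => ?_⟩
  obtain ⟨w, hw, hw2⟩ := (hS ω hω).exists_walk
  rw [← h _ h0, ← h _ hl]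
  refine ⟨_, Finset.mem_image_of_mem _ hw, ?_⟩
  rintro r hr
  have hr' : ∃ t ≤ l, r = p t := hr
  have h1 := hr'.choose_spec
  rw [dif_pos hr', hw2 _ h1.1, ← h1.2]

lemma exists_walk_of_seq' {x y : V} (c : ℕ → V) (l : ℕ)
    (hadj : ∀ t < l, G.Adj (c t) (c (t + 1))) (hx : c 0 = x) (hy : c l = y) :
    ∃ w : G.Walk x y, w.length = l ∧ w.edges = (List.range l).map (stepEdge c) := by
  subst hx hy
  obtain ⟨w, h1, h2, -⟩ := exists_walk_of_seq c l hadj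
  exact ⟨w, h1, h2⟩

/-- The closed trail formed by two sequences with common ends. -/
lemma exists_closed_trail {x y : V} (a b : ℕ → V) (l : ℕ)
    (ha : ∀ t < l, G.Adj (a t) (a (t + 1))) (hb : ∀ t < l, G.Adj (b t) (b (t + 1)))
    (ha0 : a 0 = x) (hb0 : b 0 = x) (hal : a l = y) (hbl : b l = y)
    (hda : ∀ t < l, ∀ t' < l, stepEdge a t = stepEdge a t' → t = t')
    (hdb : ∀ t < l, ∀ t' < l, stepEdge b t = stepEdge b t' → t = t')
    (hdab : ∀ t < l, ∀ t' < l, stepEdge a t ≠ stepEdge b t') :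
    ∃ w : G.Walk x x, w.IsTrail ∧ w.length = 2 * l ∧
      ∀ e, e ∈ w.edges ↔ (∃ t < l, stepEdge a t = e) ∨ ∃ t < l, stepEdge b t = e := by
  obtain ⟨p, hp1, hp2⟩ := exists_walk_of_seq' a l ha ha0 hal
  obtain ⟨q, hq1, hq2⟩ := exists_walk_of_seq' b l hb hb0 hbl
  refine ⟨p.append q.reverse, ?_, by simp [hp1, hq1, two_mul], ?_⟩
  · rw [SimpleGraph.Walk.isTrail_def, SimpleGraph.Walk.edges_append, List.nodup_append',
      SimpleGraph.Walk.edges_reverse, List.nodup_reverse, hp2, hq2]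
    refine ⟨List.Nodup.map_on (fun t ht t' ht' he => hda t (by simpa using ht) t'
        (by simpa using ht') he) List.nodup_range,
      List.Nodup.map_on (fun t ht t' ht' he => hdb t (by simpa using ht) t'
        (by simpa using ht') he) List.nodup_range, ?_⟩
    intro e he he'
    simp only [List.mem_reverse, List.mem_map, List.mem_range] at he he'
    obtain ⟨t, ht, rfl⟩ := he
    obtain ⟨t', ht', he⟩ := he'
    exact hdab t ht t' ht' he.symm
  · intro e
    simp [hp2, hq2]

end Sequences

section GoodPaths

variable {V : Type} {G : SimpleGraph V} {π : Sym2 V → ℕ} {R : Sym2 V → Sym2 V → Prop}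
  {χ : V → ℕ} {M k f : ℕ} {a b : ℕ → V}

/-- A properly coloured path `a 0, …, a k` whose `M`-th edge is the last one and which is strongly
unblocked: no vertex of the path outside an edge of it lies on a partner of that edge. -/
structure IsGoodPath (G : SimpleGraph V) (π : Sym2 V → ℕ) (R : Sym2 V → Sym2 V → Prop)
    (χ : V → ℕ) (M k : ℕ) (a : ℕ → V) : Prop where
  adj : ∀ t < k, G.Adj (a t) (a (t + 1))
  mid : ∀ t < k, π (stepEdge a t) ≤ π (stepEdge a M)
  unblocked : ∀ t < k, ∀ j ≤ k, j ≠ t → j ≠ t + 1 → ∀ e', R (stepEdge a t) e' → a j ∉ e'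
  color : ∀ t ≤ k, χ (a t) = t

lemma IsGoodPath.eq_of_eq (ha : IsGoodPath G π R χ M k a) (hb : IsGoodPath G π R χ M k b)
    {t s : ℕ} (ht : t ≤ k) (hs : s ≤ k) (h : a t = b s) : t = s := by
  rw [← ha.color t ht, ← hb.color s hs, h]

lemma IsGoodPath.eq_of_stepEdge_eq (ha : IsGoodPath G π R χ M k a)
    (hb : IsGoodPath G π R χ M k b) {t s : ℕ} (ht : t < k) (hs : s < k)
    (h : stepEdge a t = stepEdge b s) : t = s ∧ a t = b t ∧ a (t + 1) = b (t + 1) := by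
  rw [stepEdge, stepEdge, Sym2.eq_iff] at h
  rcases h with ⟨h1, h2⟩ | ⟨h1, h2⟩
  · obtain rfl := ha.eq_of_eq hb (by omega) (by omega) h1
    exact ⟨rfl, h1, h2⟩
  · have := ha.eq_of_eq hb (by omega) (by omega) h1
    have := ha.eq_of_eq hb (by omega) (by omega) h2
    omega

lemma IsGoodPath.not_rel (ha : IsGoodPath G π R χ M k a) (hB : BlockingSystem G π R k f)
    {t s : ℕ} (ht : t < k) (hs : s < k) : ¬ R (stepEdge a t) (stepEdge a s) := by
  intro h
  by_cases hts : t = s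
  · subst hts
    exact hB.irrefl _ h
  · by_cases h1 : s = t + 1
    · exact ha.unblocked t ht (s + 1) (by omega) (by omega) (by omega) _ h (by simp [stepEdge])
    · exact ha.unblocked t ht s (by omega) (by omega) (by omega) _ h (by simp [stepEdge])

/-- If an edge of `a` is related to an edge of `b`, then any common vertex on the latter edge is on
the former. -/
lemma IsGoodPath.of_rel (ha : IsGoodPath G π R χ M k a) {t s i : ℕ} (ht : t < k) (hi : i ≤ k)
    (h : R (stepEdge a t) (stepEdge b s)) (hab : a i = b i) (his : i = s ∨ i = s + 1) :
    i = t ∨ i = t + 1 := by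
  by_contra hcon
  refine ha.unblocked t ht i hi (by tauto) (by tauto) _ h ?_
  rw [hab]
  rcases his with rfl | rfl <;> simp [stepEdge]

lemma IsGoodPath.isSparseSeq_up (ha : IsGoodPath G π R χ M k a) (hB : BlockingSystem G π R k f)
    {m l : ℕ} (h : m + l ≤ k) : IsSparseSeq G R (fun t => a (m + t)) l where
  adj t ht := ha.adj (m + t) (by omega)
  distinct t ht t' ht' he := by
    have := (ha.eq_of_stepEdge_eq ha (t := m + t) (s := m + t') (by omega) (by omega) he).1
    omega
  sparse t ht t₁ ht₁ t₂ _ h _ :=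
    absurd h (ha.not_rel hB (t := m + t) (s := m + t₁) (by omega) (by omega))

/-- From `a m` down to a common vertex `a i = b i` and one step up along `b`. -/
lemma IsGoodPath.isSparseSeq_down (ha : IsGoodPath G π R χ M k a)
    (hb : IsGoodPath G π R χ M k b) (hB : BlockingSystem G π R k f)
    {i m : ℕ} (him : i ≤ m) (hm : m ≤ k) (hik : i < k) (hi : a i = b i)
    (hi' : a (i + 1) ≠ b (i + 1)) :
    IsSparseSeq G R (fun t => if t ≤ m - i then a (m - t) else b (i + 1)) (m - i + 1) := by
  set c : ℕ → V := fun t => if t ≤ m - i then a (m - t) else b (i + 1) with hc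
  have h1 : ∀ t < m - i, stepEdge c t = stepEdge a (m - t - 1) := by
    intro t ht
    have e1 : m - t - 1 + 1 = m - t := by omega
    have e2 : m - (t + 1) = m - t - 1 := by omega
    rw [stepEdge, stepEdge, hc]
    simp only
    rw [if_pos (by omega), if_pos (by omega), e1, e2, Sym2.eq_swap]
  have h2 : stepEdge c (m - i) = stepEdge b i := by
    rw [stepEdge, stepEdge, hc]
    simp only
    rw [if_pos (by omega), if_neg (by omega), ← hi]
    congr 3
    omega
  have hrel : ∀ t < m - i, R (stepEdge a (m - t - 1)) (stepEdge b i) → t + 1 = m - i := by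
    intro t ht hr
    have := ha.of_rel (i := i) (by omega) (by omega) hr hi (.inl rfl)
    omega
  refine ⟨?_, ?_, ?_⟩
  · intro t ht
    rw [← SimpleGraph.mem_edgeSet]
    change stepEdge c t ∈ _
    rcases Nat.lt_or_ge t (m - i) with h | h
    · rw [h1 t h]
      exact ha.adj _ (by omega)
    · obtain rfl : t = m - i := by omega
      rw [h2]
      exact hb.adj _ (by omega)
  · intro t ht t' ht' he
    rcases Nat.lt_or_ge t (m - i) with h | h <;> rcases Nat.lt_or_ge t' (m - i) with h' | h'
    · rw [h1 t h, h1 t' h'] at he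
      have := (ha.eq_of_stepEdge_eq ha (by omega) (by omega) he).1
      omega
    · obtain rfl : t' = m - i := by omega
      rw [h1 t h, h2] at he
      have := ha.eq_of_stepEdge_eq hb (by omega) (by omega) he
      rw [this.1] at this
      exact absurd this.2.2 hi'
    · obtain rfl : t = m - i := by omega
      rw [h1 t' h', h2] at he
      have := ha.eq_of_stepEdge_eq hb (by omega) (by omega) he.symm
      rw [this.1] at this
      exact absurd this.2.2 hi'
    · omega
  · have key : ∀ t < m - i + 1, ∀ t' < m - i + 1, R (stepEdge c t) (stepEdge c t') →
        (t = m - i ∧ t' + 1 = m - i) ∨ (t' = m - i ∧ t + 1 = m - i) := by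
      intro t ht t' ht' hr
      rcases Nat.lt_or_ge t (m - i) with h | h <;> rcases Nat.lt_or_ge t' (m - i) with h' | h'
      · rw [h1 t h, h1 t' h'] at hr
        exact absurd hr (ha.not_rel hB (by omega) (by omega))
      · obtain rfl : t' = m - i := by omega
        rw [h1 t h, h2] at hr
        exact .inr ⟨rfl, hrel t h hr⟩
      · obtain rfl : t = m - i := by omega
        rw [h1 t' h', h2] at hr
        exact .inl ⟨rfl, hrel t' h' (hB.symm _ _ hr)⟩
      · obtain rfl : t = m - i := by omega
        obtain rfl : t' = m - i := by omega
        exact absurd hr (hB.irrefl _)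
    intro t ht t₁ ht₁ t₂ ht₂ r₁ r₂
    have := key t ht t₁ ht₁ r₁
    have := key t ht t₂ ht₂ r₂
    omega

/-- From `a m` up to a common vertex `a h = b h` and one step down along `b`. -/
lemma IsGoodPath.isSparseSeq_up_down (ha : IsGoodPath G π R χ M k a)
    (hb : IsGoodPath G π R χ M k b) (hB : BlockingSystem G π R k f)
    {h m : ℕ} (hmh : m ≤ h) (hk : h ≤ k) (h0 : 0 < h) (hh : a h = b h)
    (hh' : a (h - 1) ≠ b (h - 1)) :
    IsSparseSeq G R (fun t => if t ≤ h - m then a (m + t) else b (h - 1)) (h - m + 1) := by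
  set c : ℕ → V := fun t => if t ≤ h - m then a (m + t) else b (h - 1) with hc
  have h1 : ∀ t < h - m, stepEdge c t = stepEdge a (m + t) := by
    intro t ht
    rw [stepEdge, stepEdge, hc]
    simp only
    rw [if_pos (by omega), if_pos (by omega), add_assoc]
  have h2 : stepEdge c (h - m) = stepEdge b (h - 1) := by
    have e1 : m + (h - m) = h := by omega
    have e2 : h - 1 + 1 = h := by omega
    rw [stepEdge, stepEdge, hc]
    simp only
    rw [if_pos (by omega), if_neg (by omega), e1, e2, hh, Sym2.eq_swap]
  have hrel : ∀ t < h - m, R (stepEdge a (m + t)) (stepEdge b (h - 1)) → t + 1 = h - m := by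
    intro t ht hr
    have := ha.of_rel (i := h) (by omega) (by omega) hr hh (.inr (by omega))
    omega
  have hne : ∀ t < h - m, stepEdge a (m + t) ≠ stepEdge b (h - 1) := by
    intro t ht he
    have := ha.eq_of_stepEdge_eq hb (by omega) (by omega) he
    rw [this.1] at this
    exact hh' this.2.1
  refine ⟨?_, ?_, ?_⟩
  · intro t ht
    rw [← SimpleGraph.mem_edgeSet]
    change stepEdge c t ∈ _
    rcases Nat.lt_or_ge t (h - m) with h | h
    · rw [h1 t h]
      exact ha.adj _ (by omega)
    · obtain rfl : t = _ := le_antisymm (Nat.lt_succ_iff.1 ht) h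
      rw [h2]
      exact hb.adj _ (by omega)
  · intro t ht t' ht' he
    rcases Nat.lt_or_ge t (h - m) with h3 | h3 <;> rcases Nat.lt_or_ge t' (h - m) with h3' | h3'
    · rw [h1 t h3, h1 t' h3'] at he
      have := (ha.eq_of_stepEdge_eq ha (by omega) (by omega) he).1
      omega
    · obtain rfl : t' = h - m := by omega
      rw [h1 t h3, h2] at he
      exact absurd he (hne t h3)
    · obtain rfl : t = h - m := by omega
      rw [h1 t' h3', h2] at he
      exact absurd he.symm (hne t' h3')
    · omega
  · have key : ∀ t < h - m + 1, ∀ t' < h - m + 1, R (stepEdge c t) (stepEdge c t') →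
        (t = h - m ∧ t' + 1 = h - m) ∨ (t' = h - m ∧ t + 1 = h - m) := by
      intro t ht t' ht' hr
      rcases Nat.lt_or_ge t (h - m) with h3 | h3 <;>
        rcases Nat.lt_or_ge t' (h - m) with h3' | h3'
      · rw [h1 t h3, h1 t' h3'] at hr
        exact absurd hr (ha.not_rel hB (by omega) (by omega))
      · obtain rfl : t' = h - m := by omega
        rw [h1 t h3, h2] at hr
        exact .inr ⟨rfl, hrel t h3 hr⟩
      · obtain rfl : t = h - m := by omega
        rw [h1 t' h3', h2] at hr
        exact .inl ⟨rfl, hrel t' h3' (hB.symm _ _ hr)⟩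
      · obtain rfl : t = h - m := by omega
        obtain rfl : t' = h - m := by omega
        exact absurd hr (hB.irrefl _)
    intro t ht t₁ ht₁ t₂ ht₂ r₁ r₂
    have := key t ht t₁ ht₁ r₁
    have := key t ht t₂ ht₂ r₂
    omega

/-- The sequences `a` and `b` meet at `i` and `h` but not in between. -/
structure IsGap (a b : ℕ → V) (i h : ℕ) : Prop where
  add_two_le : i + 2 ≤ h
  left : a i = b i
  right : a h = b h
  ne : ∀ t, i < t → t < h → a t ≠ b t

lemma IsGap.symm {i h : ℕ} (hg : IsGap a b i h) : IsGap b a i h :=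
  ⟨hg.add_two_le, hg.left.symm, hg.right.symm, fun t h1 h2 => (hg.ne t h1 h2).symm⟩

/-- The closed trail around a gap. -/
lemma IsGap.exists_closed_trail {i h : ℕ} (hg : IsGap a b i h)
    (ha : IsGoodPath G π R χ M k a) (hb : IsGoodPath G π R χ M k b) (hk : h ≤ k) :
    ∃ w : G.Walk (a i) (a i), w.IsTrail ∧ w.length = 2 * (h - i) ∧
      ∀ e, e ∈ w.edges ↔ (∃ t, i ≤ t ∧ t < h ∧ stepEdge a t = e) ∨
        ∃ t, i ≤ t ∧ t < h ∧ stepEdge b t = e := by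
  have := hg.add_two_le
  have hlast : i + (h - i) = h := by omega
  obtain ⟨w, h1, h2, h3⟩ := DoubleBlocking.exists_closed_trail (G := G) (x := a i) (y := a h)
    (fun t => a (i + t)) (fun t => b (i + t)) (h - i)
    (fun t ht => ha.adj (i + t) (by omega)) (fun t ht => hb.adj (i + t) (by omega)) rfl
    hg.left.symm (by simp only [hlast]) (by simp only [hlast, hg.right])
    (fun t ht t' ht' he => by
      have := (ha.eq_of_stepEdge_eq ha (t := i + t) (s := i + t') (by omega) (by omega) he).1
      omega)
    (fun t ht t' ht' he => by
      have := (hb.eq_of_stepEdge_eq hb (t := i + t) (s := i + t') (by omega) (by omega) he).1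
      omega)
    (fun t ht t' ht' he => by
      have := ha.eq_of_stepEdge_eq hb (t := i + t) (s := i + t') (by omega) (by omega) he
      rcases Nat.eq_zero_or_pos t with h0 | h0
      · exact hg.ne (i + t + 1) (by omega) (by omega) this.2.2
      · exact hg.ne (i + t) (by omega) (by omega) this.2.1)
  have hsh : ∀ (c : ℕ → V) e, (∃ t < h - i, stepEdge (fun t => c (i + t)) t = e) ↔
      ∃ t, i ≤ t ∧ t < h ∧ stepEdge c t = e := by
    intro c e
    constructor
    · rintro ⟨t, ht, rfl⟩
      exact ⟨i + t, by omega, by omega, rfl⟩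
    · rintro ⟨t, ht, ht', rfl⟩
      refine ⟨t - i, by omega, ?_⟩
      have e1 : i + (t - i) = t := by omega
      have e2 : i + (t - i + 1) = t + 1 := by omega
      simp only [stepEdge, e1, e2]
  exact ⟨w, h1, h2, fun e => by rw [h3, hsh, hsh]⟩

lemma IsGap.exists_rel {i h t : ℕ} (hg : IsGap a b i h) (hB : BlockingSystem G π R k f)
    (ha : IsGoodPath G π R χ M k a) (hb : IsGoodPath G π R χ M k b) (hk : h ≤ k)
    (hit : i ≤ t) (hth : t < h)
    (hamax : ∀ t', i ≤ t' → t' < h → π (stepEdge a t') ≤ π (stepEdge a t))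
    (hbmax : ∀ t', i ≤ t' → t' < h → π (stepEdge b t') ≤ π (stepEdge a t)) :
    ∃ s, i ≤ s ∧ s < h ∧ R (stepEdge a t) (stepEdge b s) := by
  obtain ⟨w, h1, h2, h3⟩ := hg.exists_closed_trail ha hb hk
  obtain ⟨e', he', hr⟩ := hB.single _ w h1 (by omega) (stepEdge a t)
    ((h3 _).2 (.inl ⟨t, hit, hth, rfl⟩)) (fun e' he' => by
      rcases (h3 _).1 he' with ⟨s, hs1, hs2, rfl⟩ | ⟨s, hs1, hs2, rfl⟩
      · exact hamax s hs1 hs2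
      · exact hbmax s hs1 hs2)
  rcases (h3 _).1 he' with ⟨s, hs1, hs2, rfl⟩ | ⟨s, hs1, hs2, rfl⟩
  · exact absurd hr (ha.not_rel hB (by omega) (by omega))
  · exact ⟨s, hs1, hs2, hr⟩

lemma IsGap.exists_two_rel {i h t : ℕ} (hg : IsGap a b i h) (hB : BlockingSystem G π R k f)
    (ha : IsGoodPath G π R χ M k a) (hb : IsGoodPath G π R χ M k b) (hk : h ≤ k)
    (hle : 2 * (h - i) ≤ k + 1) (hit : i ≤ t) (hth : t < h)
    (hamax : ∀ t', i ≤ t' → t' < h → π (stepEdge a t') ≤ π (stepEdge a t))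
    (hbmax : ∀ t', i ≤ t' → t' < h → π (stepEdge b t') ≤ π (stepEdge a t)) :
    ∃ s r, i ≤ s ∧ s < r ∧ r < h ∧ R (stepEdge a t) (stepEdge b s) ∧
      R (stepEdge a t) (stepEdge b r) := by
  obtain ⟨w, h1, h2, h3⟩ := hg.exists_closed_trail ha hb hk
  obtain ⟨e₁, he₁, e₂, he₂, hne, hr₁, hr₂⟩ := hB.double _ w h1 (by omega) (stepEdge a t)
    ((h3 _).2 (.inl ⟨t, hit, hth, rfl⟩)) (fun e' he' => by
      rcases (h3 _).1 he' with ⟨s, hs1, hs2, rfl⟩ | ⟨s, hs1, hs2, rfl⟩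
      · exact hamax s hs1 hs2
      · exact hbmax s hs1 hs2)
  have key : ∀ e' ∈ w.edges, R (stepEdge a t) e' → ∃ s, i ≤ s ∧ s < h ∧ stepEdge b s = e' := by
    intro e' he' hr
    rcases (h3 _).1 he' with ⟨s, hs1, hs2, rfl⟩ | h
    · exact absurd hr (ha.not_rel hB (by omega) (by omega))
    · exact h
  obtain ⟨s, hs1, hs2, rfl⟩ := key e₁ he₁ hr₁
  obtain ⟨r, hs3, hs4, rfl⟩ := key e₂ he₂ hr₂
  rcases lt_trichotomy s r with h | rfl | h
  · exact ⟨s, r, hs1, h, hs4, hr₁, hr₂⟩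
  · exact absurd rfl hne
  · exact ⟨r, s, hs3, h, hs2, hr₂, hr₁⟩

end GoodPaths

section PairCounting

variable {Ω V : Type} {S : Finset Ω} {a b : Ω → ℕ → V} {P P' Q Q' : ℕ → Prop}

/-- The number of ways in which the coordinates in `P` of the first sequence and those in `Q` of the
second one are filled by the points of `S`. -/
noncomputable def pairCnt (S : Finset Ω) (a b : Ω → ℕ → V) (P Q : ℕ → Prop) : ℕ :=
  cnt S (fun ω => Sum.elim (a ω) (b ω)) {p : ℕ ⊕ ℕ | Sum.elim P Q p}

lemma pairCnt_comm : pairCnt S a b P Q = pairCnt S b a Q P := by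
  have key : ∀ (a b : Ω → ℕ → V) (P Q : ℕ → Prop), pairCnt S a b P Q ≤ pairCnt S b a Q P := by
    intro a b P Q
    classical
    refine card_image_le_cnt _ fun ω hω ω' hω' h => reveal_eq_iff.2 ?_
    rintro (t | t) ht
    · exact h (.inr t) ht
    · exact h (.inl t) ht
  exact le_antisymm (key _ _ _ _) (key _ _ _ _)

lemma card_image_le_pairCnt {β : Type} [DecidableEq β] (g : Ω → β)
    (h : ∀ ω ∈ S, ∀ ω' ∈ S, (∀ t, P t → a ω t = a ω' t) → (∀ t, Q t → b ω t = b ω' t) →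
      g ω = g ω') : (S.image g).card ≤ pairCnt S a b P Q :=
  card_image_le_cnt g fun ω hω ω' hω' hp =>
    h ω hω ω' hω' (fun t ht => hp (.inl t) ht) (fun t ht => hp (.inr t) ht)

lemma pairCnt_copy (hP : ∀ t, P' t → P t ∨ (Q t ∧ ∀ ω ∈ S, a ω t = b ω t))
    (hQ : ∀ t, Q' t → Q t ∨ (P t ∧ ∀ ω ∈ S, a ω t = b ω t)) :
    pairCnt S a b P' Q' ≤ pairCnt S a b P Q := by
  refine cnt_le_of_determined ?_
  rintro (t | t) ht
  · rcases hP t ht with h | ⟨h1, h2⟩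
    · exact ⟨.inl t, h, fun _ _ => rfl⟩
    · exact ⟨.inr t, h1, h2⟩
  · rcases hQ t ht with h | ⟨h1, h2⟩
    · exact ⟨.inr t, h, fun _ _ => rfl⟩
    · exact ⟨.inl t, h1, fun ω hω => (h2 ω hω).symm⟩

lemma pairCnt_start [Fintype V] (m : ℕ) :
    pairCnt S a b (fun t => t = m) (fun _ => False) ≤ Fintype.card V := by
  refine (cnt_start (A := ∅) (.inl m) ?_).trans ?_
  · rintro (t | t) ht
    · exact .inr (congrArg Sum.inl ht)
    · exact ht.elim
  · exact (Nat.mul_le_mul_right _ cnt_empty_le).trans (one_mul _).le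

variable [Fintype V] {G : SimpleGraph V} {π : Sym2 V → ℕ} {R : Sym2 V → Sym2 V → Prop}
  {χ : V → ℕ} {M k f D C : ℕ}

lemma pairCnt_chain_up (hD : ∀ v, {u | G.Adj v u}.ncard ≤ D)
    (ha : ∀ ω ∈ S, IsGoodPath G π R χ M k (a ω)) (m n : ℕ) (hmn : m + n ≤ k) (hm : P m)
    (hP : ∀ t, P' t → P t ∨ (m ≤ t ∧ t ≤ m + n)) (hQ : ∀ t, Q' t → Q t) :
    pairCnt S a b P' Q' ≤ pairCnt S a b P Q * D ^ n := by
  refine cnt_chain hD (fun t => .inl (m + t)) n hm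
    (fun ω hω t ht => (ha ω hω).adj (m + t) (by omega)) ?_
  rintro (t | t) ht
  · rcases hP t ht with h | h
    · exact .inl h
    · rcases Nat.eq_or_lt_of_le h.1 with rfl | h'
      · exact .inl hm
      · refine .inr ⟨t - m, by omega, by omega, ?_⟩
        congr 1
        omega
  · exact .inl (hQ t ht)

lemma pairCnt_chain_down (hD : ∀ v, {u | G.Adj v u}.ncard ≤ D)
    (ha : ∀ ω ∈ S, IsGoodPath G π R χ M k (a ω)) (m n : ℕ) (hmk : m ≤ k) (hnm : n ≤ m) (hm : P m)
    (hP : ∀ t, P' t → P t ∨ (m ≤ t + n ∧ t ≤ m)) (hQ : ∀ t, Q' t → Q t) :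
    pairCnt S a b P' Q' ≤ pairCnt S a b P Q * D ^ n := by
  refine cnt_chain hD (fun t => .inl (m - t)) n hm (fun ω hω t ht => ?_) ?_
  · have := (ha ω hω).adj (m - (t + 1)) (by omega)
    rw [show m - (t + 1) + 1 = m - t by omega] at this
    exact this.symm
  rintro (t | t) ht
  · rcases hP t ht with h | h
    · exact .inl h
    · rcases Nat.eq_or_lt_of_le h.2 with rfl | h'
      · exact .inl hm
      · refine .inr ⟨m - t, by omega, by omega, ?_⟩
        congr 1
        omega
  · exact .inl (hQ t ht)

lemma pairCnt_segment (hB : BlockingSystem G π R k f)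
    (ha : ∀ ω ∈ S, IsGoodPath G π R χ M k (a ω)) (m l : ℕ) (hml : m + l ≤ k)
    (hC : ∀ x y : V, (sparseTrails G R l x y).card ≤ C * f ^ (l - 1)) (hm : P m) (hl : P (m + l))
    (hP : ∀ t, P' t → P t ∨ (m ≤ t ∧ t ≤ m + l)) (hQ : ∀ t, Q' t → Q t) :
    pairCnt S a b P' Q' ≤ pairCnt S a b P Q * (C * f ^ (l - 1)) := by
  refine cnt_block hC (fun t => .inl (m + t)) hm hl
    (fun ω hω => (ha ω hω).isSparseSeq_up hB hml) ?_
  rintro (t | t) ht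
  · rcases hP t ht with h | h
    · exact .inl h
    · refine .inr ⟨t - m, by omega, ?_⟩
      congr 1
      omega
  · exact .inl (hQ t ht)

lemma pairCnt_arc_down (hB : BlockingSystem G π R k f)
    (ha : ∀ ω ∈ S, IsGoodPath G π R χ M k (a ω)) (hb : ∀ ω ∈ S, IsGoodPath G π R χ M k (b ω))
    (m i l : ℕ) (him : i ≤ m) (hm : m ≤ k) (hik : i < k) (hl : l = m - i)
    (hi : ∀ ω ∈ S, a ω i = b ω i) (hi' : ∀ ω ∈ S, a ω (i + 1) ≠ b ω (i + 1))
    (hC : ∀ x y : V, (sparseTrails G R (l + 1) x y).card ≤ C * f ^ (l + 1 - 1))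
    (hPm : P m) (hQi : Q (i + 1))
    (hP : ∀ t, P' t → P t ∨ (i ≤ t ∧ t ≤ m)) (hQ : ∀ t, Q' t → Q t) :
    pairCnt S a b P' Q' ≤ pairCnt S a b P Q * (C * f ^ l) := by
  subst hl
  refine cnt_block hC (fun t => if t ≤ m - i then .inl (m - t) else .inr (i + 1)) ?_ ?_
    (fun ω hω => ?_) ?_
  · rw [if_pos (by omega)]
    exact hPm
  · rw [if_neg (by omega)]
    exact hQi
  · convert (ha ω hω).isSparseSeq_down (hb ω hω) hB him hm hik (hi ω hω) (hi' ω hω) using 2 with t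
    split_ifs <;> rfl
  rintro (t | t) ht
  · rcases hP t ht with h | h
    · exact .inl h
    · refine .inr ⟨m - t, by omega, ?_⟩
      rw [if_pos (by omega)]
      congr 1
      omega
  · exact .inl (hQ t ht)

lemma pairCnt_arc_up (hB : BlockingSystem G π R k f)
    (ha : ∀ ω ∈ S, IsGoodPath G π R χ M k (a ω)) (hb : ∀ ω ∈ S, IsGoodPath G π R χ M k (b ω))
    (m h l : ℕ) (hmh : m ≤ h) (hk : h ≤ k) (h0 : 0 < h) (hl : l = h - m)
    (hh : ∀ ω ∈ S, a ω h = b ω h) (hh' : ∀ ω ∈ S, a ω (h - 1) ≠ b ω (h - 1))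
    (hC : ∀ x y : V, (sparseTrails G R (l + 1) x y).card ≤ C * f ^ (l + 1 - 1))
    (hPm : P m) (hQi : Q (h - 1))
    (hP : ∀ t, P' t → P t ∨ (m ≤ t ∧ t ≤ h)) (hQ : ∀ t, Q' t → Q t) :
    pairCnt S a b P' Q' ≤ pairCnt S a b P Q * (C * f ^ l) := by
  subst hl
  refine cnt_block hC (fun t => if t ≤ h - m then .inl (m + t) else .inr (h - 1)) ?_ ?_
    (fun ω hω => ?_) ?_
  · rw [if_pos (by omega)]
    exact hPm
  · rw [if_neg (by omega)]
    exact hQi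
  · convert (ha ω hω).isSparseSeq_up_down (hb ω hω) hB hmh hk h0 (hh ω hω) (hh' ω hω) using 2
      with t
    split_ifs <;> rfl
  rintro (t | t) ht
  · rcases hP t ht with h | h
    · exact .inl h
    · refine .inr ⟨t - m, by omega, ?_⟩
      rw [if_pos (by omega)]
      congr 1
      omega
  · exact .inl (hQ t ht)

lemma pairCnt_edge_of_rel (hB : BlockingSystem G π R k f) (t s : ℕ) (ht : P t) (ht' : P (t + 1))
    (hR : ∀ ω ∈ S, R (stepEdge (a ω) t) (stepEdge (b ω) s))
    (hP : ∀ u, P' u → P u) (hQ : ∀ u, Q' u → Q u ∨ u = s ∨ u = s + 1) :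
    pairCnt S a b P' Q' ≤ pairCnt S a b P Q * (2 * f) := by
  refine cnt_edge_of_rel hB (.inl t) (.inl (t + 1)) (.inr s) (.inr (s + 1)) ht ht' hR ?_
  rintro (u | u) hu
  · exact .inl (hP u hu)
  · rcases hQ u hu with h | rfl | rfl
    · exact .inl h
    · exact .inr (.inl rfl)
    · exact .inr (.inr rfl)

end PairCounting

section Meets

variable {Ω V : Type} [Fintype V] {S : Finset Ω} {a b : Ω → ℕ → V} {G : SimpleGraph V}
  {π : Sym2 V → ℕ} {R : Sym2 V → Sym2 V → Prop} {χ : V → ℕ} {M k f D C : ℕ}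

/-- The number of meets with a gap around the middle edge. -/
lemma pairCnt_long_le (hk : k = 2 * M + 1) (hf : 1 ≤ f) (hB : BlockingSystem G π R k f)
    (hD : ∀ v, {u | G.Adj v u}.ncard ≤ D)
    (hC : ∀ l, 2 * l ≤ k + 1 → ∀ x y : V, (sparseTrails G R l x y).card ≤ C * f ^ (l - 1))
    (ha : ∀ ω ∈ S, IsGoodPath G π R χ M k (a ω)) (hb : ∀ ω ∈ S, IsGoodPath G π R χ M k (b ω))
    {i h s : ℕ} (hi : i < M) (hh : M + 1 < h) (hhk : h ≤ k) (his : i < s) (hsh : s + 1 < h)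
    (hg : ∀ ω ∈ S, IsGap (a ω) (b ω) i h) (h0 : ∀ ω ∈ S, a ω 0 = b ω 0)
    (hlast : ∀ ω ∈ S, a ω k = b ω k)
    (hR : ∀ ω ∈ S, R (stepEdge (a ω) M) (stepEdge (b ω) s)) :
    D ^ 2 * pairCnt S a b (· ≤ k) (· ≤ k) ≤ 2 * C ^ 4 * Fintype.card V * f ^ k * D ^ k := by
  have hgl : ∀ ω ∈ S, a ω i = b ω i := fun ω hω => (hg ω hω).left
  have hgr : ∀ ω ∈ S, a ω h = b ω h := fun ω hω => (hg ω hω).right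
  have s1 : pairCnt S a b (fun t => M ≤ t ∧ t ≤ M + 1) (fun _ => False) ≤ _ :=
    (pairCnt_chain_up (P := fun t => t = M) hD ha M 1 (by omega) rfl
      (by intro t ht; omega) (fun _ h => h)).trans (Nat.mul_le_mul_right _ (pairCnt_start M))
  have s2 : pairCnt S a b (fun t => M ≤ t ∧ t ≤ M + 1) (fun t => s ≤ t ∧ t ≤ s + 1) ≤ _ :=
    (pairCnt_edge_of_rel hB M s (P := fun t => M ≤ t ∧ t ≤ M + 1) (Q := fun _ => False)
      (by omega) (by omega) hR (fun _ h => h) (by intro t ht; omega)).trans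
      (Nat.mul_le_mul_right _ s1)
  have s3 : pairCnt S a b (fun t => M ≤ t ∧ t ≤ M + 1) (fun t => i + 1 ≤ t ∧ t ≤ s + 1) ≤ _ :=
    le_trans (by
      rw [pairCnt_comm, pairCnt_comm (a := a)]
      exact pairCnt_chain_down hD hb s _ (by omega) (by omega) (by omega)
        (by intro t ht; omega) (fun _ h => h)) (Nat.mul_le_mul_right (D ^ (s - 1 - i)) s2)
  have s4 : pairCnt S a b (fun t => i ≤ t ∧ t ≤ M + 1) (fun t => i + 1 ≤ t ∧ t ≤ s + 1) ≤ _ :=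
    (pairCnt_arc_down hB ha hb M i (M - i) (by omega) (by omega) (by omega) rfl hgl
      (fun ω hω => (hg ω hω).ne _ (by omega) (by omega)) (hC _ (by omega))
      (P := fun t => M ≤ t ∧ t ≤ M + 1) (Q := fun t => i + 1 ≤ t ∧ t ≤ s + 1) (by omega)
      (by omega) (by intro t ht; omega) (fun _ h => h)).trans (Nat.mul_le_mul_right _ s3)
  have s5 : pairCnt S a b (fun t => i ≤ t ∧ t ≤ M + 1) (fun t => i + 1 ≤ t ∧ t ≤ h - 1) ≤ _ :=
    le_trans (by
      rw [pairCnt_comm, pairCnt_comm (a := a)]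
      exact pairCnt_chain_up hD hb (s + 1) _ (by omega) (by omega)
        (by intro t ht; omega) (fun _ h => h)) (Nat.mul_le_mul_right (D ^ (h - s - 2)) s4)
  have s6 : pairCnt S a b (fun t => i ≤ t ∧ t ≤ h) (fun t => i + 1 ≤ t ∧ t ≤ h - 1) ≤ _ :=
    (pairCnt_arc_up hB ha hb (M + 1) h (h - (M + 1)) (by omega) (by omega) (by omega) rfl hgr
      (fun ω hω => (hg ω hω).ne _ (by omega) (by omega)) (hC _ (by omega))
      (P := fun t => i ≤ t ∧ t ≤ M + 1) (Q := fun t => i + 1 ≤ t ∧ t ≤ h - 1) (by omega)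
      (by omega) (by intro t ht; omega) (fun _ h => h)).trans (Nat.mul_le_mul_right _ s5)
  have s7 : pairCnt S a b (fun t => t ≤ h) (fun t => i + 1 ≤ t ∧ t ≤ h - 1) ≤ _ :=
    (pairCnt_chain_down hD ha i i (by omega) le_rfl (P := fun t => i ≤ t ∧ t ≤ h)
      (by omega) (by intro t ht; omega) (fun _ h => h)).trans (Nat.mul_le_mul_right _ s6)
  have s8 : pairCnt S a b (fun t => t ≤ k) (fun t => i + 1 ≤ t ∧ t ≤ h - 1) ≤ _ :=
    (pairCnt_chain_up hD ha h (k - h) (by omega) (P := fun t => t ≤ h)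
      (by omega) (by intro t ht; omega) (fun _ h => h)).trans (Nat.mul_le_mul_right _ s7)
  have s9 : pairCnt S a b (fun t => t ≤ k) (fun t => t = 0 ∨ t = k ∨ i ≤ t ∧ t ≤ h) ≤ _ :=
    le_trans (pairCnt_copy (fun t h => .inl h) fun t ht => by
      by_cases e0 : t = 0
      · exact .inr ⟨by omega, by rwa [e0]⟩
      by_cases e1 : t = k
      · exact .inr ⟨by omega, by rwa [e1]⟩
      by_cases e2 : t = i
      · exact .inr ⟨by omega, by rwa [e2]⟩
      by_cases e3 : t = h
      · exact .inr ⟨by omega, by rwa [e3]⟩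
      · left; omega) s8
  have s10 : pairCnt S a b (fun t => t ≤ k) (fun t => t = k ∨ t ≤ h) ≤ _ :=
    le_trans (by
      rw [pairCnt_comm, pairCnt_comm (a := a)]
      exact pairCnt_segment hB hb 0 i (by omega) (hC i (by omega)) (by omega) (by omega)
        (by intro t ht; omega) (fun _ h => h)) (Nat.mul_le_mul_right (C * f ^ (i - 1)) s9)
  have s11 : pairCnt S a b (fun t => t ≤ k) (fun t => t ≤ k) ≤ _ :=
    le_trans (by
      rw [pairCnt_comm, pairCnt_comm (a := a)]
      exact pairCnt_segment hB hb h (k - h) (by omega) (hC _ (by omega)) (by omega) (by omega)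
        (by intro t ht; omega) (fun _ h => h)) (Nat.mul_le_mul_right (C * f ^ (k - h - 1)) s10)
  calc _ ≤ _ := Nat.mul_le_mul_left _ s11
    _ = 2 * C ^ 4 * Fintype.card V * f ^ (1 + (M - i) + (h - (M + 1)) + (i - 1) + (k - h - 1))
        * D ^ (2 + 1 + (s - 1 - i) + (h - s - 2) + i + (k - h)) := by ring
    _ = 2 * C ^ 4 * Fintype.card V * f ^ (1 + (M - i) + (h - (M + 1)) + (i - 1) + (k - h - 1))
        * D ^ k := by congr 2; omega
    _ ≤ _ := by gcongr; omega

/-- The number of meets on a short interval. -/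
lemma pairCnt_short_le (hf : 1 ≤ f) (hB : BlockingSystem G π R k f) (hD1 : 1 ≤ D)
    (hD : ∀ v, {u | G.Adj v u}.ncard ≤ D)
    (hC : ∀ l, 2 * l ≤ k + 1 → ∀ x y : V, (sparseTrails G R l x y).card ≤ C * f ^ (l - 1))
    (ha : ∀ ω ∈ S, IsGoodPath G π R χ M k (a ω)) (hb : ∀ ω ∈ S, IsGoodPath G π R χ M k (b ω))
    {lo hi i h t s r : ℕ} (hlo : lo ≤ i) (hih : i + 2 ≤ h) (hhi : h ≤ hi) (hhik : hi ≤ k)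
    (hshort : 2 * (hi - lo) ≤ k + 1)
    (hit : i ≤ t) (hth : t < h) (his : i ≤ s) (hsr : s < r) (hrh : r < h)
    (hts : i < t → i < s) (htr : t + 1 < h → r + 1 < h)
    (hg : ∀ ω ∈ S, IsGap (a ω) (b ω) i h) (h0 : ∀ ω ∈ S, a ω lo = b ω lo)
    (hlast : ∀ ω ∈ S, a ω hi = b ω hi)
    (hR : ∀ ω ∈ S, R (stepEdge (a ω) t) (stepEdge (b ω) s))
    (hR' : ∀ ω ∈ S, R (stepEdge (a ω) t) (stepEdge (b ω) r)) :
    D * pairCnt S a b (fun u => lo ≤ u ∧ u ≤ hi) (fun u => lo ≤ u ∧ u ≤ hi) ≤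
      4 * C ^ 5 * Fintype.card V * f ^ (hi - lo) * D ^ (hi - lo) := by
  have hgl : ∀ ω ∈ S, a ω i = b ω i := fun ω hω => (hg ω hω).left
  have hgr : ∀ ω ∈ S, a ω h = b ω h := fun ω hω => (hg ω hω).right
  have s1 : pairCnt S a b (fun u => t ≤ u ∧ u ≤ t + 1) (fun _ => False) ≤ _ :=
    (pairCnt_chain_up (P := fun u => u = t) hD ha t 1 (by omega) rfl
      (by intro u hu; omega) (fun _ h => h)).trans (Nat.mul_le_mul_right _ (pairCnt_start t))
  have s2 : pairCnt S a b (fun u => t ≤ u ∧ u ≤ t + 1) (fun u => u = s ∨ u = s + 1) ≤ _ :=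
    (pairCnt_edge_of_rel hB t s (P := fun u => t ≤ u ∧ u ≤ t + 1) (Q := fun _ => False)
      (by omega) (by omega) hR (fun _ h => h) (by intro t ht; omega)).trans
      (Nat.mul_le_mul_right _ s1)
  have s3 : pairCnt S a b (fun u => t ≤ u ∧ u ≤ t + 1)
      (fun u => u = s ∨ u = s + 1 ∨ u = r ∨ u = r + 1) ≤ _ :=
    (pairCnt_edge_of_rel hB t r (P := fun u => t ≤ u ∧ u ≤ t + 1)
      (Q := fun u => u = s ∨ u = s + 1)
      (by omega) (by omega) hR' (fun _ h => h) (by intro t ht; omega)).trans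
      (Nat.mul_le_mul_right _ s2)
  have s4 : pairCnt S a b (fun u => (t ≤ u ∨ i + 1 ≤ u) ∧ u ≤ t + 1)
      (fun u => u = s ∨ u = s + 1 ∨ u = r ∨ u = r + 1) ≤ _ :=
    (pairCnt_chain_down hD ha t (t - i - 1) (by omega) (by omega)
      (P := fun u => t ≤ u ∧ u ≤ t + 1)
      (by omega) (by intro t ht; omega) (fun _ h => h)).trans (Nat.mul_le_mul_right _ s3)
  have s5 : pairCnt S a b (fun u => (t ≤ u ∨ i + 1 ≤ u) ∧ (u ≤ t + 1 ∨ u ≤ h - 1))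
      (fun u => u = s ∨ u = s + 1 ∨ u = r ∨ u = r + 1) ≤ _ :=
    (pairCnt_chain_up hD ha (t + 1) (h - t - 2) (by omega)
      (P := fun u => (t ≤ u ∨ i + 1 ≤ u) ∧ u ≤ t + 1)
      (by omega) (by intro t ht; omega) (fun _ h => h)).trans (Nat.mul_le_mul_right _ s4)
  have s6 : pairCnt S a b (fun u => i ≤ u ∧ (u ≤ t + 1 ∨ u ≤ h - 1))
      (fun u => i ≤ u ∧ u ≤ s + 1 ∨ u = r ∨ u = r + 1) ≤ _ :=
    le_trans (by
      rcases Nat.eq_or_lt_of_le hit with rfl | hit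
      · have c1 : pairCnt S a b (fun u => i ≤ u ∧ (u ≤ i + 1 ∨ u ≤ h - 1))
            (fun u => u = i ∨ u = s ∨ u = s + 1 ∨ u = r ∨ u = r + 1) ≤
            pairCnt S a b (fun u => (i ≤ u ∨ i + 1 ≤ u) ∧ (u ≤ i + 1 ∨ u ≤ h - 1))
            (fun u => u = s ∨ u = s + 1 ∨ u = r ∨ u = r + 1) := by
          refine pairCnt_copy (by intro u hu; left; omega) fun u hu => ?_
          rcases hu with rfl | hu
          · exact .inr ⟨by omega, hgl⟩
          · exact .inl hu
        refine le_trans ?_ (Nat.mul_le_mul c1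
          (Nat.mul_le_mul_left C (Nat.pow_le_pow_right hf (Nat.sub_le (s - i) 1))))
        rw [pairCnt_comm, pairCnt_comm (a := a)]
        exact pairCnt_segment hB hb i (s - i) (by omega) (hC _ (by omega)) (by omega) (by omega)
          (by intro u hu; omega) (by intro u hu; omega)
      · have := hts hit
        refine le_trans (pairCnt_copy (P := fun u => i + 1 ≤ u ∧ (u ≤ t + 1 ∨ u ≤ h - 1))
          (Q := fun u => i ≤ u ∧ u ≤ s + 1 ∨ u = r ∨ u = r + 1) ?_ (fun _ h => .inl h)) ?_
        · intro u hu
          by_cases e : u = i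
          · exact .inr ⟨by omega, by rwa [e]⟩
          · left; omega
        rw [pairCnt_comm, pairCnt_comm (a := a)]
        exact pairCnt_arc_down hB hb ha s i (s - i) (by omega) (by omega) (by omega) rfl
          (fun ω hω => (hgl ω hω).symm) (fun ω hω => ((hg ω hω).ne _ (by omega) (by omega)).symm)
          (hC _ (by omega)) (by omega) (by omega) (by intro u hu; omega) (by intro u hu; omega)) (Nat.mul_le_mul_right (C * f ^ (s - i)) s5)
  have s7 : pairCnt S a b (fun u => i ≤ u ∧ (u ≤ t + 1 ∨ u ≤ h - 1))
      (fun u => i ≤ u ∧ u ≤ r + 1) ≤ _ :=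
    le_trans (by
      rw [pairCnt_comm, pairCnt_comm (a := a)]
      exact pairCnt_segment hB hb (s + 1) (r - (s + 1)) (by omega) (hC _ (by omega)) (by omega)
        (by omega) (by intro u hu; omega) (fun _ h => h)) (Nat.mul_le_mul_right (C * f ^ (r - (s + 1) - 1)) s6)
  have s8 : pairCnt S a b (fun u => i ≤ u ∧ u ≤ h) (fun u => i ≤ u ∧ u ≤ h) ≤ _ :=
    le_trans (by
      by_cases hth' : t + 1 = h
      · have c1 : pairCnt S a b (fun u => i ≤ u ∧ u ≤ h)
            (fun u => u = h ∨ i ≤ u ∧ u ≤ r + 1) ≤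
            pairCnt S a b (fun u => i ≤ u ∧ (u ≤ t + 1 ∨ u ≤ h - 1))
            (fun u => i ≤ u ∧ u ≤ r + 1) := by
          refine pairCnt_copy (by intro u hu; left; omega) fun u hu => ?_
          rcases hu with rfl | hu
          · exact .inr ⟨by omega, hgr⟩
          · exact .inl hu
        refine le_trans ?_ (Nat.mul_le_mul c1
          (Nat.mul_le_mul_left C (Nat.pow_le_pow_right hf (Nat.sub_le (h - (r + 1)) 1))))
        rw [pairCnt_comm, pairCnt_comm (a := a)]
        exact pairCnt_segment hB hb (r + 1) (h - (r + 1)) (by omega) (hC _ (by omega)) (by omega)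
          (by omega) (by intro u hu; omega) (by intro u hu; omega)
      · have := htr (by omega)
        refine le_trans (pairCnt_copy (P := fun u => i ≤ u ∧ (u ≤ t + 1 ∨ u ≤ h - 1))
          (Q := fun u => i ≤ u ∧ u ≤ h) ?_ (fun _ h => .inl h)) ?_
        · intro u hu
          by_cases e : u = h
          · exact .inr ⟨by omega, by rwa [e]⟩
          · left; omega
        rw [pairCnt_comm, pairCnt_comm (a := a)]
        exact pairCnt_arc_up hB hb ha (r + 1) h (h - (r + 1)) (by omega) (by omega) (by omega) rfl
          (fun ω hω => (hgr ω hω).symm) (fun ω hω => ((hg ω hω).ne _ (by omega) (by omega)).symm)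
          (hC _ (by omega)) (by omega) (by omega) (by intro u hu; omega) (by intro u hu; omega)) (Nat.mul_le_mul_right (C * f ^ (h - (r + 1))) s7)
  have s9 : pairCnt S a b (fun u => lo ≤ u ∧ u ≤ h) (fun u => i ≤ u ∧ u ≤ h) ≤ _ :=
    (pairCnt_chain_down hD ha i (i - lo) (by omega) (by omega) (P := fun u => i ≤ u ∧ u ≤ h)
      (by omega) (by intro t ht; omega) (fun _ h => h)).trans (Nat.mul_le_mul_right _ s8)
  have s10 : pairCnt S a b (fun u => lo ≤ u ∧ u ≤ hi) (fun u => i ≤ u ∧ u ≤ h) ≤ _ :=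
    (pairCnt_chain_up hD ha h (hi - h) (by omega) (P := fun u => lo ≤ u ∧ u ≤ h)
      (by omega) (by intro t ht; omega) (fun _ h => h)).trans (Nat.mul_le_mul_right _ s9)
  have s11 : pairCnt S a b (fun u => lo ≤ u ∧ u ≤ hi)
      (fun u => u = lo ∨ u = hi ∨ i ≤ u ∧ u ≤ h) ≤ _ :=
    le_trans (pairCnt_copy (fun t h => .inl h) fun u hu => by
      rcases hu with rfl | rfl | hu
      · exact .inr ⟨by omega, h0⟩
      · exact .inr ⟨by omega, hlast⟩
      · exact .inl hu) s10
  have s12 : pairCnt S a b (fun u => lo ≤ u ∧ u ≤ hi) (fun u => u = hi ∨ lo ≤ u ∧ u ≤ h) ≤ _ :=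
    le_trans (by
      rw [pairCnt_comm, pairCnt_comm (a := a)]
      exact pairCnt_segment hB hb lo (i - lo) (by omega) (hC _ (by omega)) (by omega) (by omega)
        (by intro t ht; omega) (fun _ h => h)) (Nat.mul_le_mul_right (C * f ^ (i - lo - 1)) s11)
  have s13 : pairCnt S a b (fun u => lo ≤ u ∧ u ≤ hi) (fun u => lo ≤ u ∧ u ≤ hi) ≤ _ :=
    le_trans (by
      rw [pairCnt_comm, pairCnt_comm (a := a)]
      exact pairCnt_segment hB hb h (hi - h) (by omega) (hC _ (by omega)) (by omega) (by omega)
        (by intro t ht; omega) (fun _ h => h)) (Nat.mul_le_mul_right (C * f ^ (hi - h - 1)) s12)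
  calc _ ≤ _ := Nat.mul_le_mul_left _ s13
    _ = 4 * C ^ 5 * Fintype.card V *
        f ^ (2 + (s - i) + (r - (s + 1) - 1) + (h - (r + 1)) + (i - lo - 1) + (hi - h - 1))
        * D ^ (2 + (t - i - 1) + (h - t - 2) + (i - lo) + (hi - h)) := by ring
    _ ≤ _ := by gcongr <;> omega

end Meets

section MeetData

variable {V : Type} {G : SimpleGraph V} {π : Sym2 V → ℕ} {R : Sym2 V → Sym2 V → Prop}
  {χ : V → ℕ} {M k f D C : ℕ}

lemma exists_isGap {a b : ℕ → V} {lo hi u : ℕ} (hlo : lo < u) (hhi : u < hi) (h0 : a lo = b lo)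
    (h1 : a hi = b hi) (hu : a u ≠ b u) :
    ∃ i h, lo ≤ i ∧ i < u ∧ u < h ∧ h ≤ hi ∧ IsGap a b i h := by
  classical
  have hex : ∃ h, u < h ∧ a h = b h := ⟨hi, hhi, h1⟩
  have hfs := Nat.find_spec hex
  have hfm : ∀ {t}, t < Nat.find hex → ¬ (u < t ∧ a t = b t) := fun h => Nat.find_min hex h
  have hle : Nat.find hex ≤ hi := Nat.find_min' hex ⟨hhi, h1⟩
  set P : ℕ → Prop := fun t => a t = b t with hP
  have hg1 : P (Nat.findGreatest P u) := Nat.findGreatest_spec (P := P) hlo.le h0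
  have hg2 : lo ≤ Nat.findGreatest P u := Nat.le_findGreatest hlo.le h0
  have hg3 : Nat.findGreatest P u ≤ u := Nat.findGreatest_le u
  have hg4 : Nat.findGreatest P u ≠ u := fun h => hu (by rw [h] at hg1; exact hg1)
  refine ⟨Nat.findGreatest P u, Nat.find hex, hg2, by omega, hfs.1, hle, by omega, hg1, hfs.2, ?_⟩
  intro t ht1 ht2 he
  rcases Nat.lt_or_ge u t with h | h
  · exact hfm ht2 ⟨h, he⟩
  · exact Nat.findGreatest_is_greatest ht1 h he

/-- Two sequences meet around a gap in `[lo, hi]`, with the `t`-th edge of the first one related to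
the `s`-th and `r`-th edges of the second one. -/
structure IsShortMeet (R : Sym2 V → Sym2 V → Prop) (a b : ℕ → V) (lo hi i h t s r : ℕ) : Prop where
  gap : IsGap a b i h
  lo_le : lo ≤ i
  le_hi : h ≤ hi
  le_t : i ≤ t
  t_lt : t < h
  le_s : i ≤ s
  s_lt : s < r
  r_lt : r < h
  lt_s : i < t → i < s
  r_succ_lt : t + 1 < h → r + 1 < h
  rel_s : R (stepEdge a t) (stepEdge b s)
  rel_r : R (stepEdge a t) (stepEdge b r)

lemma IsGap.exists_isShortMeet {a b : ℕ → V} {lo hi i h t : ℕ} (hg : IsGap a b i h)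
    (hB : BlockingSystem G π R k f) (ha : IsGoodPath G π R χ M k a)
    (hb : IsGoodPath G π R χ M k b) (hlo : lo ≤ i) (hhi : h ≤ hi) (hk : hi ≤ k)
    (hle : 2 * (hi - lo) ≤ k + 1) (hit : i ≤ t) (hth : t < h)
    (hamax : ∀ t', i ≤ t' → t' < h → π (stepEdge a t') ≤ π (stepEdge a t))
    (hbmax : ∀ t', i ≤ t' → t' < h → π (stepEdge b t') ≤ π (stepEdge a t)) :
    ∃ s r, IsShortMeet R a b lo hi i h t s r := by
  obtain ⟨s, r, h1, h2, h3, h4, h5⟩ :=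
    hg.exists_two_rel hB ha hb (by omega) (by omega) hit hth hamax hbmax
  refine ⟨s, r, hg, hlo, hhi, hit, hth, h1, h2, h3, fun hlt => ?_, fun hlt => ?_, h4, h5⟩
  · by_contra hcon
    have := ha.of_rel (i := i) (by omega) (by omega) h4 hg.left (by omega)
    omega
  · by_contra hcon
    have := ha.of_rel (i := h) (by omega) (by omega) h5 hg.right (by omega)
    omega

lemma exists_isShortMeet {a b : ℕ → V} {lo hi : ℕ} (hB : BlockingSystem G π R k f)
    (ha : IsGoodPath G π R χ M k a) (hb : IsGoodPath G π R χ M k b) (hk : hi ≤ k)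
    (hle : 2 * (hi - lo) ≤ k + 1) (h0 : a lo = b lo) (h1 : a hi = b hi)
    (hu : ∃ u, lo < u ∧ u < hi ∧ a u ≠ b u) :
    ∃ i h t s r, IsShortMeet R a b lo hi i h t s r ∨ IsShortMeet R b a lo hi i h t s r := by
  obtain ⟨u, hu1, hu2, hu⟩ := hu
  obtain ⟨i, h, hi1, hi2, hi3, hi4, hg⟩ := exists_isGap hu1 hu2 h0 h1 hu
  have hne : (Finset.Ico i h).Nonempty := Finset.nonempty_Ico.2 (by omega)
  obtain ⟨t, ht, htm⟩ := Finset.exists_max_image (Finset.Ico i h) (fun t => π (stepEdge a t)) hne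
  obtain ⟨t', ht', htm'⟩ := Finset.exists_max_image (Finset.Ico i h) (fun t => π (stepEdge b t)) hne
  simp only [Finset.mem_Ico, and_imp] at ht htm ht' htm'
  rcases le_total (π (stepEdge b t')) (π (stepEdge a t)) with hle' | hle'
  · obtain ⟨s, r, hsr⟩ := hg.exists_isShortMeet hB ha hb hi1 hi4 hk hle ht.1 ht.2 htm
      (fun j hj hj' => (htm' j hj hj').trans hle')
    exact ⟨i, h, t, s, r, .inl hsr⟩
  · obtain ⟨s, r, hsr⟩ := hg.symm.exists_isShortMeet hB hb ha hi1 hi4 hk hle ht'.1 ht'.2 htm'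
      (fun j hj hj' => (htm j hj hj').trans hle')
    exact ⟨i, h, t', s, r, .inr hsr⟩

/-- Two sequences meet around a gap containing the middle edge, with the middle edge of the first
one related to the `s`-th edge of the second one. -/
structure IsLongMeet (R : Sym2 V → Sym2 V → Prop) (M k : ℕ) (a b : ℕ → V) (i h s : ℕ) : Prop where
  gap : IsGap a b i h
  lt_mid : i < M
  mid_lt : M + 1 < h
  le_k : h ≤ k
  lt_s : i < s
  s_lt : s + 1 < h
  rel : R (stepEdge a M) (stepEdge b s)

lemma IsGap.exists_isLongMeet {a b : ℕ → V} {i h : ℕ} (hg : IsGap a b i h)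
    (hB : BlockingSystem G π R k f) (ha : IsGoodPath G π R χ M k a)
    (hb : IsGoodPath G π R χ M k b) (hi : i < M) (hh : M + 1 < h) (hk : h ≤ k)
    (hle : π (stepEdge b M) ≤ π (stepEdge a M)) : ∃ s, IsLongMeet R M k a b i h s := by
  obtain ⟨s, h1, h2, h3⟩ := hg.exists_rel (t := M) hB ha hb hk (by omega) (by omega)
    (fun t _ ht => ha.mid t (by omega)) (fun t _ ht => (hb.mid t (by omega)).trans hle)
  refine ⟨s, hg, hi, hh, hk, ?_, ?_, h3⟩
  · by_contra hcon
    have := ha.of_rel (i := i) (by omega) (by omega) h3 hg.left (by omega)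
    omega
  · by_contra hcon
    have := ha.of_rel (i := h) (by omega) (by omega) h3 hg.right (by omega)
    omega

lemma exists_isLongMeet {a b : ℕ → V} (hk : k = 2 * M + 1) (hB : BlockingSystem G π R k f)
    (ha : IsGoodPath G π R χ M k a) (hb : IsGoodPath G π R χ M k b) (h0 : a 0 = b 0)
    (h1 : a k = b k) (hM : a M ≠ b M) (hM' : a (M + 1) ≠ b (M + 1)) :
    ∃ i h s, IsLongMeet R M k a b i h s ∨ IsLongMeet R M k b a i h s := by
  have hM0 : M ≠ 0 := by
    rintro rfl
    exact hM h0
  obtain ⟨i, h, hi1, hi2, hi3, hi4, hg⟩ := exists_isGap (u := M) (by omega) (by omega) h0 h1 hM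
  have hh : M + 1 < h := by
    rcases Nat.eq_or_lt_of_le hi3 with h' | h'
    · exact absurd (by simpa [← h'] using hg.right) hM'
    · exact h'
  rcases le_total (π (stepEdge b M)) (π (stepEdge a M)) with hle | hle
  · obtain ⟨s, hs⟩ := hg.exists_isLongMeet hB ha hb hi2 hh hi4 hle
    exact ⟨i, h, s, .inl hs⟩
  · obtain ⟨s, hs⟩ := hg.symm.exists_isLongMeet hB hb ha hi2 hh hi4 hle
    exact ⟨i, h, s, .inr hs⟩

end MeetData

section MeetCounting

variable {Ω V : Type} {S : Finset Ω} {a b : Ω → ℕ → V}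

lemma mul_pairCnt_le_of_cover {J : Type} {P Q : ℕ → Prop} (I : Finset J) (Φ : J → Ω → Prop)
    (hcov : ∀ ω ∈ S, ∃ j ∈ I, Φ j ω) (d N : ℕ)
    (hN : ∀ j ∈ I, ∀ T ⊆ S, (∀ ω ∈ T, Φ j ω) → d * pairCnt T a b P Q ≤ N) :
    d * pairCnt S a b P Q ≤ I.card * N := by
  classical
  have h1 : pairCnt S a b P Q ≤ ∑ j ∈ I, pairCnt (S.filter (Φ j)) a b P Q := by
    unfold pairCnt cnt
    refine le_trans (Finset.card_le_card ?_) Finset.card_biUnion_le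
    intro g hg
    obtain ⟨ω, hω, rfl⟩ := Finset.mem_image.1 hg
    obtain ⟨j, hj, hjω⟩ := hcov ω hω
    exact Finset.mem_biUnion.2 ⟨j, hj, Finset.mem_image_of_mem _ (Finset.mem_filter.2 ⟨hω, hjω⟩)⟩
  calc _ ≤ d * ∑ j ∈ I, pairCnt (S.filter (Φ j)) a b P Q := Nat.mul_le_mul_left _ h1
    _ = ∑ j ∈ I, d * pairCnt (S.filter (Φ j)) a b P Q := Finset.mul_sum _ _ _
    _ ≤ ∑ _j ∈ I, N := Finset.sum_le_sum fun j hj =>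
        hN j hj _ (Finset.filter_subset _ _) fun ω hω => (Finset.mem_filter.1 hω).2
    _ = _ := by simp

variable [Fintype V] {G : SimpleGraph V}
  {π : Sym2 V → ℕ} {R : Sym2 V → Sym2 V → Prop} {χ : V → ℕ} {M k f D C : ℕ}

lemma mul_pairCnt_shortMeets_le (hf : 1 ≤ f) (hB : BlockingSystem G π R k f) (hD1 : 1 ≤ D)
    (hD : ∀ v, {u | G.Adj v u}.ncard ≤ D)
    (hC : ∀ l, 2 * l ≤ k + 1 → ∀ x y : V, (sparseTrails G R l x y).card ≤ C * f ^ (l - 1))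
    (ha : ∀ ω ∈ S, IsGoodPath G π R χ M k (a ω)) (hb : ∀ ω ∈ S, IsGoodPath G π R χ M k (b ω))
    {lo hi : ℕ} (hlohi : lo ≤ hi) (hhik : hi ≤ k) (hshort : 2 * (hi - lo) ≤ k + 1)
    (h0 : ∀ ω ∈ S, a ω lo = b ω lo) (hlast : ∀ ω ∈ S, a ω hi = b ω hi)
    (hne : ∀ ω ∈ S, ∃ u, lo < u ∧ u < hi ∧ a ω u ≠ b ω u) :
    D * pairCnt S a b (· ≤ k) (fun u => lo ≤ u ∧ u ≤ hi) ≤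
      (2 * (k + 1) ^ 5 * (4 * C ^ 5)) * Fintype.card V * f ^ (hi - lo) * D ^ k := by
  have h1 : D * pairCnt S a b (fun u => lo ≤ u ∧ u ≤ hi) (fun u => lo ≤ u ∧ u ≤ hi) ≤
      ((Finset.univ : Finset (Bool × (Fin 5 → Fin (k + 1))))).card *
        (4 * C ^ 5 * Fintype.card V * f ^ (hi - lo) * D ^ (hi - lo)) := by
    refine mul_pairCnt_le_of_cover _ (fun j ω => bif j.1
      then IsShortMeet R (a ω) (b ω) lo hi (j.2 0) (j.2 1) (j.2 2) (j.2 3) (j.2 4)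
      else IsShortMeet R (b ω) (a ω) lo hi (j.2 0) (j.2 1) (j.2 2) (j.2 3) (j.2 4)) ?_ _ _ ?_
    · intro ω hω
      obtain ⟨i, h, t, s, r, H⟩ := exists_isShortMeet hB (ha ω hω) (hb ω hω) hhik hshort
        (h0 ω hω) (hlast ω hω) (hne ω hω)
      have key : ∀ u ≤ k, ((Fin.ofNat (k + 1) u : Fin (k + 1)) : ℕ) = u := fun u hu => by
        simp only [Fin.val_ofNat]
        exact Nat.mod_eq_of_lt (by omega)
      have hb' : i ≤ k ∧ h ≤ k ∧ t ≤ k ∧ s ≤ k ∧ r ≤ k := by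
        rcases H with H | H <;>
        · have := H.le_hi; have := H.gap.add_two_le; have := H.t_lt; have := H.s_lt
          have := H.r_lt
          omega
      obtain ⟨b1, b2, b3, b4, b5⟩ := hb'
      rcases H with H | H
      · refine ⟨(true, ![Fin.ofNat _ i, Fin.ofNat _ h, Fin.ofNat _ t, Fin.ofNat _ s,
          Fin.ofNat _ r]), Finset.mem_univ _, ?_⟩
        simpa only [cond_true, Matrix.cons_val, key _ b1, key _ b2, key _ b3, key _ b4,
          key _ b5] using H
      · refine ⟨(false, ![Fin.ofNat _ i, Fin.ofNat _ h, Fin.ofNat _ t, Fin.ofNat _ s,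
          Fin.ofNat _ r]), Finset.mem_univ _, ?_⟩
        simpa only [cond_false, Matrix.cons_val, key _ b1, key _ b2, key _ b3, key _ b4,
          key _ b5] using H
    · rintro ⟨o, j⟩ - T hTS hT
      rcases T.eq_empty_or_nonempty with rfl | ⟨ω₀, hω₀⟩
      · simp [pairCnt, cnt]
      cases o
      · have H := hT ω₀ hω₀
        simp only [cond_false] at H hT
        rw [pairCnt_comm]
        exact pairCnt_short_le hf hB hD1 hD hC (fun ω hω => hb ω (hTS hω))
          (fun ω hω => ha ω (hTS hω)) H.lo_le H.gap.add_two_le H.le_hi hhik hshort H.le_t H.t_lt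
          H.le_s H.s_lt H.r_lt H.lt_s H.r_succ_lt (fun ω hω => (hT ω hω).gap)
          (fun ω hω => (h0 ω (hTS hω)).symm) (fun ω hω => (hlast ω (hTS hω)).symm)
          (fun ω hω => (hT ω hω).rel_s) (fun ω hω => (hT ω hω).rel_r)
      · have H := hT ω₀ hω₀
        simp only [cond_true] at H hT
        exact pairCnt_short_le hf hB hD1 hD hC (fun ω hω => ha ω (hTS hω))
          (fun ω hω => hb ω (hTS hω)) H.lo_le H.gap.add_two_le H.le_hi hhik hshort H.le_t H.t_lt
          H.le_s H.s_lt H.r_lt H.lt_s H.r_succ_lt (fun ω hω => (hT ω hω).gap)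
          (fun ω hω => h0 ω (hTS hω)) (fun ω hω => hlast ω (hTS hω))
          (fun ω hω => (hT ω hω).rel_s) (fun ω hω => (hT ω hω).rel_r)
  have h2 : pairCnt S a b (fun u => u ≤ hi) (fun u => lo ≤ u ∧ u ≤ hi) ≤ _ :=
    pairCnt_chain_down hD ha lo lo (by omega) le_rfl (P := fun u => lo ≤ u ∧ u ≤ hi)
      (by omega) (by intro t ht; omega) (fun _ h => h)
  have h3 : pairCnt S a b (fun u => u ≤ k) (fun u => lo ≤ u ∧ u ≤ hi) ≤ _ :=
    (pairCnt_chain_up hD ha hi (k - hi) (by omega) (P := fun u => u ≤ hi)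
      (by omega) (by intro t ht; omega) (fun _ h => h)).trans (Nat.mul_le_mul_right _ h2)
  calc _ ≤ _ := Nat.mul_le_mul_left _ h3
    _ = D * pairCnt S a b (fun u => lo ≤ u ∧ u ≤ hi) (fun u => lo ≤ u ∧ u ≤ hi) *
        (D ^ lo * D ^ (k - hi)) := by ring
    _ ≤ _ := Nat.mul_le_mul_right _ h1
    _ = (2 * (k + 1) ^ 5 * (4 * C ^ 5)) * Fintype.card V * f ^ (hi - lo) *
        D ^ (hi - lo + lo + (k - hi)) := by
      simp only [Finset.card_univ, Fintype.card_prod, Fintype.card_bool, Fintype.card_fun,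
        Fintype.card_fin]
      ring
    _ = _ := by congr 2; omega

lemma mul_pairCnt_longMeets_le (hk : k = 2 * M + 1) (hf : 1 ≤ f) (hB : BlockingSystem G π R k f)
    (hD : ∀ v, {u | G.Adj v u}.ncard ≤ D)
    (hC : ∀ l, 2 * l ≤ k + 1 → ∀ x y : V, (sparseTrails G R l x y).card ≤ C * f ^ (l - 1))
    (ha : ∀ ω ∈ S, IsGoodPath G π R χ M k (a ω)) (hb : ∀ ω ∈ S, IsGoodPath G π R χ M k (b ω))
    (h0 : ∀ ω ∈ S, a ω 0 = b ω 0) (hlast : ∀ ω ∈ S, a ω k = b ω k)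
    (hM : ∀ ω ∈ S, a ω M ≠ b ω M) (hM' : ∀ ω ∈ S, a ω (M + 1) ≠ b ω (M + 1)) :
    D ^ 2 * pairCnt S a b (· ≤ k) (· ≤ k) ≤
      (2 * (k + 1) ^ 3 * (2 * C ^ 4)) * Fintype.card V * f ^ k * D ^ k := by
  have h1 : D ^ 2 * pairCnt S a b (· ≤ k) (· ≤ k) ≤
      ((Finset.univ : Finset (Bool × (Fin 3 → Fin (k + 1))))).card *
        (2 * C ^ 4 * Fintype.card V * f ^ k * D ^ k) := by
    refine mul_pairCnt_le_of_cover _ (fun j ω => bif j.1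
      then IsLongMeet R M k (a ω) (b ω) (j.2 0) (j.2 1) (j.2 2)
      else IsLongMeet R M k (b ω) (a ω) (j.2 0) (j.2 1) (j.2 2)) ?_ _ _ ?_
    · intro ω hω
      obtain ⟨i, h, s, H⟩ := exists_isLongMeet hk hB (ha ω hω) (hb ω hω)
        (h0 ω hω) (hlast ω hω) (hM ω hω) (hM' ω hω)
      have key : ∀ u ≤ k, ((Fin.ofNat (k + 1) u : Fin (k + 1)) : ℕ) = u := fun u hu => by
        simp only [Fin.val_ofNat]
        exact Nat.mod_eq_of_lt (by omega)
      have hb' : i ≤ k ∧ h ≤ k ∧ s ≤ k := by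
        rcases H with H | H <;>
        · have := H.le_k; have := H.gap.add_two_le; have := H.s_lt
          omega
      obtain ⟨b1, b2, b3⟩ := hb'
      rcases H with H | H
      · refine ⟨(true, ![Fin.ofNat _ i, Fin.ofNat _ h, Fin.ofNat _ s]), Finset.mem_univ _, ?_⟩
        simpa only [cond_true, Matrix.cons_val, key _ b1, key _ b2, key _ b3] using H
      · refine ⟨(false, ![Fin.ofNat _ i, Fin.ofNat _ h, Fin.ofNat _ s]), Finset.mem_univ _, ?_⟩
        simpa only [cond_false, Matrix.cons_val, key _ b1, key _ b2, key _ b3] using H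
    · rintro ⟨o, j⟩ - T hTS hT
      rcases T.eq_empty_or_nonempty with rfl | ⟨ω₀, hω₀⟩
      · simp [pairCnt, cnt]
      cases o
      · have H := hT ω₀ hω₀
        simp only [cond_false] at H hT
        rw [pairCnt_comm]
        exact pairCnt_long_le hk hf hB hD hC (fun ω hω => hb ω (hTS hω))
          (fun ω hω => ha ω (hTS hω)) H.lt_mid H.mid_lt H.le_k H.lt_s H.s_lt
          (fun ω hω => (hT ω hω).gap) (fun ω hω => (h0 ω (hTS hω)).symm)
          (fun ω hω => (hlast ω (hTS hω)).symm) (fun ω hω => (hT ω hω).rel)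
      · have H := hT ω₀ hω₀
        simp only [cond_true] at H hT
        exact pairCnt_long_le hk hf hB hD hC (fun ω hω => ha ω (hTS hω))
          (fun ω hω => hb ω (hTS hω)) H.lt_mid H.mid_lt H.le_k H.lt_s H.s_lt
          (fun ω hω => (hT ω hω).gap) (fun ω hω => h0 ω (hTS hω))
          (fun ω hω => hlast ω (hTS hω)) (fun ω hω => (hT ω hω).rel)
  refine h1.trans (le_of_eq ?_)
  simp only [Finset.card_univ, Fintype.card_prod, Fintype.card_bool, Fintype.card_fun,
    Fintype.card_fin]
  ring

end MeetCounting

section Counting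

variable {α β : Type}

lemma sq_card_le_card_mul_card_fiber_pairs [Fintype β] (S : Finset α) (g : α → β) [DecidableEq β] :
    S.card ^ 2 ≤ Fintype.card β * ((S ×ˢ S).filter (fun p => g p.1 = g p.2)).card := by
  classical
  have h1 : S.card = ∑ y : β, (S.filter (fun a => g a = y)).card :=
    Finset.card_eq_sum_card_fiberwise (fun _ _ => Finset.mem_coe.2 (Finset.mem_univ _))
  have h2 : ((S ×ˢ S).filter (fun p => g p.1 = g p.2)).card
      = ∑ y : β, (S.filter (fun a => g a = y)).card ^ 2 := by
    rw [Finset.card_eq_sum_card_fiberwise (f := fun p : α × α => g p.1) (t := Finset.univ)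
      (fun _ _ => Finset.mem_coe.2 (Finset.mem_univ _))]
    refine Finset.sum_congr rfl fun y _ => ?_
    rw [sq, ← Finset.card_product]
    congr 1
    ext ⟨a, b⟩
    simp only [Finset.mem_filter, Finset.mem_product]
    constructor
    · rintro ⟨⟨⟨ha, hb⟩, hab⟩, hy⟩
      exact ⟨⟨ha, hy⟩, hb, by rw [← hab]; exact hy⟩
    · rintro ⟨⟨ha, hy⟩, hb, hy'⟩
      exact ⟨⟨⟨ha, hb⟩, by rw [hy, hy']⟩, hy⟩
  rw [h2, h1]
  exact sq_sum_le_card_mul_sum_sq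

lemma card_filter_lt_mul_le (S : Finset α) (w : α → ℕ) {D K F T : ℕ} (hF : 0 < F)
    (h : D * ∑ a ∈ S, w a ≤ T * F) :
    (S.filter (fun a => K * F < D * w a)).card * K ≤ T := by
  refine Nat.le_of_mul_le_mul_right ?_ hF
  calc (S.filter (fun a => K * F < D * w a)).card * K * F
      = ∑ _a ∈ S.filter (fun a => K * F < D * w a), K * F := by
        rw [Finset.sum_const, smul_eq_mul, mul_assoc]
    _ ≤ ∑ a ∈ S.filter (fun a => K * F < D * w a), D * w a :=
        Finset.sum_le_sum fun a ha => (Finset.mem_filter.1 ha).2.le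
    _ ≤ ∑ a ∈ S, D * w a := Finset.sum_le_sum_of_subset (Finset.filter_subset _ _)
    _ = D * ∑ a ∈ S, w a := by rw [Finset.mul_sum]
    _ ≤ T * F := h

/-- Discarding the elements of large weight for each of four weights keeps half of a set. -/
lemma exists_subset_weights_le (S : Finset α) (w : Fin 4 → α → ℕ) (F : Fin 4 → ℕ)
    {D T X c : ℕ} (hT : 0 < T) (hF : ∀ i, 0 < F i) (hX : X ≤ c * S.card)
    (h : ∀ i, D * ∑ a ∈ S, w i a ≤ T * X * F i) :
    ∃ S' ⊆ S, X ≤ 2 * c * S'.card ∧ ∀ i, ∀ a ∈ S', D * w i a ≤ 8 * c * T * F i := by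
  classical
  refine ⟨S.filter (fun a => ∀ i, D * w i a ≤ 8 * c * T * F i), Finset.filter_subset _ _, ?_,
    fun i a ha => (Finset.mem_filter.1 ha).2 i⟩
  set S' := S.filter (fun a => ∀ i, D * w i a ≤ 8 * c * T * F i) with hS'
  set bad : Fin 4 → Finset α := fun i => S.filter (fun a => 8 * c * T * F i < D * w i a) with hbad
  have hb : ∀ i, 8 * c * (bad i).card ≤ X := fun i => by
    have := card_filter_lt_mul_le S (w i) (K := 8 * c * T) (hF i) (h i)
    exact Nat.le_of_mul_le_mul_right (c := T) (by rw [mul_comm X T]; exact le_trans (by simp only [hbad]; exact le_of_eq (by ring)) this) hT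
  have hsub : S ⊆ S' ∪ Finset.univ.biUnion bad := by
    intro a ha
    by_cases hall : ∀ i, D * w i a ≤ 8 * c * T * F i
    · exact Finset.mem_union_left _ (Finset.mem_filter.2 ⟨ha, hall⟩)
    · push Not at hall
      obtain ⟨i, hi⟩ := hall
      exact Finset.mem_union_right _
        (Finset.mem_biUnion.2 ⟨i, Finset.mem_univ _, Finset.mem_filter.2 ⟨ha, hi⟩⟩)
  have h1 : S.card ≤ S'.card + ∑ i, (bad i).card :=
    (Finset.card_le_card hsub).trans ((Finset.card_union_le _ _).trans
      (Nat.add_le_add_left Finset.card_biUnion_le _))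
  have h2 : 8 * c * ∑ i, (bad i).card ≤ 4 * X := by
    rw [Finset.mul_sum]
    exact (Finset.sum_le_card_nsmul _ _ X fun i _ => hb i).trans (by simp)
  have h3 : c * S.card ≤ c * S'.card + c * ∑ i, (bad i).card := by
    rw [← mul_add]; exact Nat.mul_le_mul_left _ h1
  nlinarith

end Counting

section Variants

variable {V : Type}

open Classical in
/-- The restrictions to `[lo, hi]` of the members of `P` that agree with `a` at `lo` and at `hi`
but not in between. -/
noncomputable def variants (P : Finset (ℕ → V)) (lo hi : ℕ) (a : ℕ → V) : Finset (ℕ → Option V) :=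
  (P.filter fun b => a lo = b lo ∧ a hi = b hi ∧ ∃ u, lo < u ∧ u < hi ∧ a u ≠ b u).image
    (reveal {u | lo ≤ u ∧ u ≤ hi})

open Classical in
lemma sum_card_variants_le (P : Finset (ℕ → V)) (lo hi k : ℕ)
    (hext : ∀ a ∈ P, ∀ b ∈ P, (∀ t ≤ k, a t = b t) → a = b) :
    ∑ a ∈ P, (variants P lo hi a).card ≤
      pairCnt ((P ×ˢ P).filter fun p => p.1 lo = p.2 lo ∧ p.1 hi = p.2 hi ∧
        ∃ u, lo < u ∧ u < hi ∧ p.1 u ≠ p.2 u) Prod.fst Prod.snd (· ≤ k)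
        (fun u => lo ≤ u ∧ u ≤ hi) := by
  rw [← Finset.card_sigma]
  refine le_trans ?_ (card_image_le_pairCnt
    (fun p : (ℕ → V) × (ℕ → V) => (p.1, reveal {u | lo ≤ u ∧ u ≤ hi} p.2)) ?_)
  · refine Finset.card_le_card_of_injOn (fun x => (x.1, x.2)) ?_ ?_
    · rintro ⟨a, r⟩ hx
      obtain ⟨ha, hr⟩ := Finset.mem_sigma.1 (Finset.mem_coe.1 hx)
      obtain ⟨b, hb, hbr⟩ := Finset.mem_image.1 hr
      obtain ⟨hb, hab⟩ := Finset.mem_filter.1 hb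
      exact Finset.mem_coe.2 (Finset.mem_image.2 ⟨(a, b), Finset.mem_filter.2
        ⟨Finset.mk_mem_product ha hb, hab⟩, by simp only at hbr; rw [← hbr]⟩)
    · rintro ⟨a, r⟩ _ ⟨a', r'⟩ _ h
      simp only [Prod.mk.injEq] at h
      obtain ⟨rfl, rfl⟩ := h
      rfl
  · rintro ⟨a, b⟩ h1 ⟨a', b'⟩ h2 ha hb
    have h1' := Finset.mem_product.1 (Finset.mem_filter.1 h1).1
    have h2' := Finset.mem_product.1 (Finset.mem_filter.1 h2).1
    exact Prod.ext (hext _ h1'.1 _ h2'.1 ha) (reveal_eq_iff.2 hb)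

open Classical in
lemma card_filter_agree_le (P P' : Finset (ℕ → V)) (hP : P' ⊆ P) {u k : ℕ} (huk : u ≤ k)
    (hext : ∀ a ∈ P, ∀ b ∈ P, (∀ t ≤ k, a t = b t) → a = b) {a : ℕ → V} :
    (P'.filter fun b => a 0 = b 0 ∧ a k = b k ∧ a u = b u).card ≤
      (1 + (variants P 0 u a).card) * (1 + (variants P u k a).card) := by
  have hmem : ∀ lo hi, lo ≤ hi → ∀ b ∈ P, a lo = b lo → a hi = b hi →
      reveal {u | lo ≤ u ∧ u ≤ hi} b ∈
        insert (reveal {u | lo ≤ u ∧ u ≤ hi} a) (variants P lo hi a) := by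
    intro lo hi hle b hb h1 h2
    by_cases h : ∃ u, lo < u ∧ u < hi ∧ a u ≠ b u
    · exact Finset.mem_insert_of_mem
        (Finset.mem_image_of_mem _ (Finset.mem_filter.2 ⟨hb, h1, h2, h⟩))
    · push Not at h
      refine Finset.mem_insert.2 (.inl (reveal_eq_iff.2 ?_))
      rintro t ⟨ht1, ht2⟩
      rcases ht1.eq_or_lt with rfl | ht1
      · exact h1.symm
      · rcases ht2.eq_or_lt with rfl | ht2
        · exact h2.symm
        · exact (h t ht1 ht2).symm
  calc _ ≤ ((insert (reveal {t | 0 ≤ t ∧ t ≤ u} a) (variants P 0 u a)) ×ˢ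
          (insert (reveal {t | u ≤ t ∧ t ≤ k} a) (variants P u k a))).card := by
        refine Finset.card_le_card_of_injOn
          (fun b => (reveal {t | 0 ≤ t ∧ t ≤ u} b, reveal {t | u ≤ t ∧ t ≤ k} b)) ?_ ?_
        · intro b hb
          obtain ⟨hb, h0, hk, hu⟩ := Finset.mem_filter.1 (Finset.mem_coe.1 hb)
          exact Finset.mem_coe.2 (Finset.mk_mem_product (hmem _ _ (Nat.zero_le _) _ (hP hb) h0 hu)
            (hmem _ _ huk _ (hP hb) hu hk))
        · intro b hb b' hb' h
          have hb := (Finset.mem_filter.1 (Finset.mem_coe.1 hb)).1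
          have hb' := (Finset.mem_filter.1 (Finset.mem_coe.1 hb')).1
          simp only [Prod.mk.injEq] at h
          refine hext _ (hP hb) _ (hP hb') fun t ht => ?_
          rcases le_total t u with htu | htu
          · exact reveal_eq_iff.1 h.1 t ⟨Nat.zero_le _, htu⟩
          · exact reveal_eq_iff.1 h.2 t ⟨htu, ht⟩
    _ ≤ _ := by
        rw [Finset.card_product]
        exact Nat.mul_le_mul ((Finset.card_insert_le _ _).trans (by omega))
          ((Finset.card_insert_le _ _).trans (by omega))

end Variants

section Combine

open Classical in
/-- A near-maximal family of good paths forces the degree bound to be small. -/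
theorem exists_pow_le_of_isGoodPath (M C c : ℕ) (hC1 : 1 ≤ C) : ∃ K, ∀ (V : Type) [Fintype V]
    (G : SimpleGraph V) (π : Sym2 V → ℕ) (R : Sym2 V → Sym2 V → Prop) (χ : V → ℕ) (k f D : ℕ)
    (P : Finset (ℕ → V)), k = 2 * M + 1 → 1 ≤ f → 1 ≤ D → 1 ≤ Fintype.card V →
    BlockingSystem G π R k f → (∀ v, {u | G.Adj v u}.ncard ≤ D) →
    (∀ l, 2 * l ≤ k + 1 → ∀ x y : V, (sparseTrails G R l x y).card ≤ C * f ^ (l - 1)) →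
    (∀ a ∈ P, IsGoodPath G π R χ M k a) →
    (∀ a ∈ P, ∀ b ∈ P, (∀ t ≤ k, a t = b t) → a = b) →
    Fintype.card V * D ^ k ≤ c * P.card →
    D ^ (k + 2) ≤ K * (Fintype.card V * (D ^ 2 + D * f ^ (M + 1) + f ^ k)) := by
  set T := 2 * (2 * M + 1 + 1) ^ 5 * (4 * C ^ 5) with hT
  set L := 2 * (2 * M + 1 + 1) ^ 3 * (2 * C ^ 4) with hL
  set K := 8 * c * T with hK
  refine ⟨2 * c * (2 * (1 + 2 * K + K ^ 2) + 2 * c * L), ?_⟩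
  intro V _ G π R χ k f D P hk hf hD1 hn hB hD hC hP hext hN
  set n := Fintype.card V with hn'
  have hTpos : 0 < T := by positivity
  -- discard the paths with too many variants
  let lo : Fin 4 → ℕ := ![0, M, 0, M + 1]
  let hi : Fin 4 → ℕ := ![M, k, M + 1, k]
  have hlohi : ∀ i, lo i ≤ hi i ∧ hi i ≤ k ∧ 2 * (hi i - lo i) ≤ k + 1 := by
    intro i
    fin_cases i <;> simp [lo, hi] <;> omega
  have hsum : ∀ i, D * ∑ a ∈ P, (variants P (lo i) (hi i) a).card ≤
      T * (n * D ^ k) * f ^ (hi i - lo i) := by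
    intro i
    obtain ⟨h1, h2, h3⟩ := hlohi i
    calc _ ≤ D * _ := Nat.mul_le_mul_left _ (sum_card_variants_le P (lo i) (hi i) k hext)
      _ ≤ _ := mul_pairCnt_shortMeets_le hf hB hD1 hD hC
          (fun ω hω => hP _ (Finset.mem_product.1 (Finset.mem_filter.1 hω).1).1)
          (fun ω hω => hP _ (Finset.mem_product.1 (Finset.mem_filter.1 hω).1).2) h1 h2 h3
          (fun ω hω => (Finset.mem_filter.1 hω).2.1) (fun ω hω => (Finset.mem_filter.1 hω).2.2.1)
          (fun ω hω => (Finset.mem_filter.1 hω).2.2.2)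
      _ = _ := by rw [hT, ← hk]; ring
  obtain ⟨P', hP', hN', hw⟩ := exists_subset_weights_le P
    (fun i a => (variants P (lo i) (hi i) a).card) (fun i => f ^ (hi i - lo i)) hTpos
    (fun i => Nat.pow_pos hf) hN hsum
  -- count the pairs with the same ends
  have hcs := sq_card_le_card_mul_card_fiber_pairs P' (fun a => (a 0, a k))
  rw [Fintype.card_prod] at hcs
  set E := (P' ×ˢ P').filter (fun p => (p.1 0, p.1 k) = (p.2 0, p.2 k)) with hE
  set Q := D ^ 2 + 2 * K * (D * f ^ (M + 1)) + K ^ 2 * f ^ k with hQ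
  have hagree : ∀ u ≤ k, u = M ∨ u = M + 1 →
      D ^ 2 * ((P' ×ˢ P').filter
        (fun p => p.1 0 = p.2 0 ∧ p.1 k = p.2 k ∧ p.1 u = p.2 u)).card ≤ P'.card * Q := by
    intro u huk hu
    have hv : ∀ a ∈ P', D * (variants P 0 u a).card ≤ K * f ^ u ∧
        D * (variants P u k a).card ≤ K * f ^ (k - u) := by
      intro a ha
      rcases hu with rfl | rfl
      · exact ⟨by simpa [lo, hi] using hw 0 a ha, by simpa [lo, hi] using hw 1 a ha⟩
      · exact ⟨by simpa [lo, hi] using hw 2 a ha, by simpa [lo, hi] using hw 3 a ha⟩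
    have hfib : ((P' ×ˢ P').filter
        (fun p => p.1 0 = p.2 0 ∧ p.1 k = p.2 k ∧ p.1 u = p.2 u)).card =
        ∑ a ∈ P', (P'.filter fun b => a 0 = b 0 ∧ a k = b k ∧ a u = b u).card := by
      rw [← Finset.card_sigma]
      refine Finset.card_bij' (fun p _ => ⟨p.1, p.2⟩) (fun x _ => (x.1, x.2)) ?_ ?_ ?_ ?_
      · rintro ⟨a, b⟩ h
        simpa [and_assoc] using h
      · rintro ⟨a, b⟩ h
        simpa [and_assoc] using h
      · intros; rfl
      · intros; rfl
    rw [hfib, Finset.mul_sum, ← smul_eq_mul P'.card]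
    refine Finset.sum_le_card_nsmul _ _ _ fun a ha => ?_
    obtain ⟨h1, h2⟩ := hv a ha
    have hfu : f ^ u ≤ f ^ (M + 1) := Nat.pow_le_pow_right hf (by omega)
    have hfu' : f ^ (k - u) ≤ f ^ (M + 1) := Nat.pow_le_pow_right hf (by omega)
    have hfk : f ^ u * f ^ (k - u) = f ^ k := by rw [← pow_add]; congr 1; omega
    calc _ ≤ D ^ 2 * ((1 + (variants P 0 u a).card) * (1 + (variants P u k a).card)) :=
          Nat.mul_le_mul_left _ (card_filter_agree_le P P' hP' huk hext)
      _ = (D + D * (variants P 0 u a).card) * (D + D * (variants P u k a).card) := by ring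
      _ ≤ (D + K * f ^ u) * (D + K * f ^ (k - u)) := by gcongr
      _ = D ^ 2 + K * (D * f ^ u) + K * (D * f ^ (k - u)) + K ^ 2 * (f ^ u * f ^ (k - u)) := by ring
      _ ≤ D ^ 2 + K * (D * f ^ (M + 1)) + K * (D * f ^ (M + 1)) + K ^ 2 * f ^ k := by
          rw [hfk]; gcongr
      _ = Q := by rw [hQ]; ring
  set F := (P' ×ˢ P').filter (fun p => (p.1 0 = p.2 0 ∧ p.1 k = p.2 k) ∧ p.1 M ≠ p.2 M ∧
    p.1 (M + 1) ≠ p.2 (M + 1)) with hF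
  have hlong : D ^ 2 * F.card ≤ L * n * f ^ k * D ^ k := by
    have hmem : ∀ ω ∈ F, ω.1 ∈ P ∧ ω.2 ∈ P := fun ω hω =>
      ⟨hP' (Finset.mem_product.1 (Finset.mem_filter.1 hω).1).1,
        hP' (Finset.mem_product.1 (Finset.mem_filter.1 hω).1).2⟩
    have h1 : F.card ≤ pairCnt F Prod.fst Prod.snd (· ≤ k) (· ≤ k) := by
      refine le_trans ?_ (card_image_le_pairCnt id ?_)
      · rw [Finset.image_id]
      · intro ω hω ω' hω' ha hb
        exact Prod.ext (hext _ (hmem ω hω).1 _ (hmem ω' hω').1 ha)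
          (hext _ (hmem ω hω).2 _ (hmem ω' hω').2 hb)
    refine (Nat.mul_le_mul_left _ h1).trans ?_
    rw [hL, ← hk]
    exact mul_pairCnt_longMeets_le hk hf hB hD hC (fun ω hω => hP _ (hmem ω hω).1)
      (fun ω hω => hP _ (hmem ω hω).2) (fun ω hω => (Finset.mem_filter.1 hω).2.1.1)
      (fun ω hω => (Finset.mem_filter.1 hω).2.1.2) (fun ω hω => (Finset.mem_filter.1 hω).2.2.1)
      (fun ω hω => (Finset.mem_filter.1 hω).2.2.2)
  have hEle : D ^ 2 * E.card ≤ P'.card * (2 * Q) + L * n * f ^ k * D ^ k := by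
    have hsub : E ⊆ ((P' ×ˢ P').filter
          (fun p => p.1 0 = p.2 0 ∧ p.1 k = p.2 k ∧ p.1 M = p.2 M)) ∪
        ((P' ×ˢ P').filter
          (fun p => p.1 0 = p.2 0 ∧ p.1 k = p.2 k ∧ p.1 (M + 1) = p.2 (M + 1))) ∪ F := by
      intro p hp
      simp only [hE, hF, Finset.mem_filter, Finset.mem_union, Prod.mk.injEq] at hp ⊢
      tauto
    have h1 := hagree M (by omega) (.inl rfl)
    have h2 := hagree (M + 1) (by omega) (.inr rfl)
    have h3 := (Finset.card_le_card hsub).trans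
      ((Finset.card_union_le _ _).trans (Nat.add_le_add_right (Finset.card_union_le _ _) _))
    have h4 := Nat.mul_le_mul_left (D ^ 2) h3
    rw [mul_add, mul_add] at h4
    linarith
  -- conclude
  set N := P'.card with hNdef
  have hXpos : 0 < n * D ^ k := Nat.mul_pos hn (Nat.pow_pos hD1)
  have hNpos : 0 < N := by
    rcases Nat.eq_zero_or_pos N with h | h
    · rw [h] at hN'; omega
    · exact h
  have hmain : D ^ 2 * N ≤ n ^ 2 * (2 * Q + 2 * c * L * f ^ k) := by
    refine Nat.le_of_mul_le_mul_right (c := N) ?_ hNpos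
    calc D ^ 2 * N * N = D ^ 2 * N ^ 2 := by ring
      _ ≤ D ^ 2 * (n * n * E.card) := Nat.mul_le_mul_left _ hcs
      _ = n ^ 2 * (D ^ 2 * E.card) := by ring
      _ ≤ n ^ 2 * (N * (2 * Q) + L * f ^ k * (n * D ^ k)) := by
          refine Nat.mul_le_mul_left _ (hEle.trans (le_of_eq ?_)); ring
      _ ≤ n ^ 2 * (N * (2 * Q) + L * f ^ k * (2 * c * N)) := by gcongr
      _ = _ := by ring
  refine le_of_mul_le_mul_left (a := n) ?_ hn
  have hQle : Q ≤ (1 + 2 * K + K ^ 2) * (D ^ 2 + D * f ^ (M + 1) + f ^ k) := by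
    rw [hQ]
    nlinarith [Nat.zero_le (D ^ 2), Nat.zero_le (D * f ^ (M + 1)), Nat.zero_le (f ^ k),
      Nat.zero_le (K * D ^ 2), Nat.zero_le (K ^ 2 * D ^ 2), Nat.zero_le (K ^ 2 * (D * f ^ (M + 1))),
      Nat.zero_le (K * f ^ k)]
  have hfle : f ^ k ≤ D ^ 2 + D * f ^ (M + 1) + f ^ k := Nat.le_add_left _ _
  calc n * D ^ (k + 2) = D ^ 2 * (n * D ^ k) := by ring
    _ ≤ D ^ 2 * (2 * c * N) := Nat.mul_le_mul_left _ hN'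
    _ = 2 * c * (D ^ 2 * N) := by ring
    _ ≤ 2 * c * (n ^ 2 * (2 * Q + 2 * c * L * f ^ k)) := Nat.mul_le_mul_left _ hmain
    _ ≤ 2 * c * (n ^ 2 * (2 * ((1 + 2 * K + K ^ 2) * (D ^ 2 + D * f ^ (M + 1) + f ^ k)) +
          2 * c * L * (D ^ 2 + D * f ^ (M + 1) + f ^ k))) := by gcongr
    _ = _ := by ring

end Combine

section Core

variable {V : Type} [Fintype V] {G : SimpleGraph V} {π : Sym2 V → ℕ}

open Classical in
lemma card_filter_sym2_mem_le (F : Finset (Sym2 V)) (S : Finset V) (v : V) :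
    (F.filter fun e => ∀ x ∈ e, x ∈ S).card ≤
      (F.filter fun e => ∀ x ∈ e, x ∈ S.erase v).card + (S.filter fun u => s(v, u) ∈ F).card := by
  have hsub : (F.filter fun e => ∀ x ∈ e, x ∈ S) ⊆
      (F.filter fun e => ∀ x ∈ e, x ∈ S.erase v) ∪
        (S.filter fun u => s(v, u) ∈ F).image (fun u => s(v, u)) := by
    intro e he
    obtain ⟨heF, heS⟩ := Finset.mem_filter.1 he
    by_cases hve : v ∈ e
    · obtain ⟨u, rfl⟩ := Sym2.mem_iff_exists.1 hve
      exact Finset.mem_union_right _ (Finset.mem_image_of_mem _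
        (Finset.mem_filter.2 ⟨heS u (Sym2.mem_mk_right _ _), heF⟩))
    · exact Finset.mem_union_left _ (Finset.mem_filter.2 ⟨heF, fun x hx =>
        Finset.mem_erase.2 ⟨fun h => hve (h ▸ hx), heS x hx⟩⟩)
  exact (Finset.card_le_card hsub).trans ((Finset.card_union_le _ _).trans
    (Nat.add_le_add_left Finset.card_image_le _))

open Classical in
/-- A graph with many edges contains an induced subgraph of large minimum degree. -/
lemma exists_min_degree (F : Finset (Sym2 V)) {q : ℕ} (hF : q * Fintype.card V < F.card) :
    ∃ S : Finset V, (F.filter fun e => ∀ x ∈ e, x ∈ S).Nonempty ∧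
      ∀ v ∈ S, q ≤ (S.filter fun u => s(v, u) ∈ F).card := by
  obtain ⟨S, hS, hmin⟩ := (Set.toFinite
    {S : Finset V | q * S.card < (F.filter fun e => ∀ x ∈ e, x ∈ S).card}).exists_minimal
    ⟨Finset.univ, by simpa using hF⟩
  simp only [Set.mem_ofPred_eq] at hS hmin
  refine ⟨S, Finset.card_pos.1 (by omega), fun v hv => ?_⟩
  by_contra! hlt
  have h1 := card_filter_sym2_mem_le F S v
  have h2 : ¬ q * (S.erase v).card < (F.filter fun e => ∀ x ∈ e, x ∈ S.erase v).card := by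
    intro h
    exact Finset.notMem_erase v S (hmin h (Finset.erase_subset v S) hv)
  have h3 : S.card = (S.erase v).card + 1 := (Finset.card_erase_add_one hv).symm
  rw [h3] at hS
  push Not at h2
  nlinarith

/-- The edge `e` lies in a vertex set on which the edges up to `e` have minimum degree at
least `q`. -/
def IsCore (G : SimpleGraph V) (π : Sym2 V → ℕ) (q : ℕ) (e : Sym2 V) : Prop :=
  ∃ S : Set V, (∀ x ∈ e, x ∈ S) ∧
    ∀ v ∈ S, q ≤ {u ∈ S | G.Adj v u ∧ π s(v, u) ≤ π e}.ncard

open Classical in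
lemma card_not_isCore_le (q : ℕ) :
    (G.edgeFinset.filter fun e => ¬ IsCore G π q e).card ≤ q * Fintype.card V := by
  by_contra! h
  obtain ⟨S, hne, hS⟩ := exists_min_degree _ h
  obtain ⟨e, he, hmax⟩ := Finset.exists_max_image _ π hne
  obtain ⟨heF, heS⟩ := Finset.mem_filter.1 he
  refine (Finset.mem_filter.1 heF).2 ⟨S, fun x hx => heS x hx, fun v hv => (hS v hv).trans ?_⟩
  rw [← Set.ncard_coe_finset]
  refine Set.ncard_le_ncard ?_ (Set.toFinite _)
  intro u hu
  obtain ⟨huS, huF⟩ := Finset.mem_filter.1 (Finset.mem_coe.1 hu)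
  refine ⟨huS, by simpa using (Finset.mem_filter.1 huF).1,
    hmax _ (Finset.mem_filter.2 ⟨huF, fun x hx => ?_⟩)⟩
  rcases Sym2.mem_iff.1 hx with rfl | rfl
  · exact hv
  · exact huS

open Classical in
lemma mul_le_card_isCore {q D : ℕ} (hq : 16 * q ≤ D)
    (hm : Fintype.card V * D ≤ 8 * G.edgeSet.ncard) :
    Fintype.card V * D ≤ 16 * (G.edgeFinset.filter fun e => IsCore G π q e).card := by
  have h1 := card_not_isCore_le (G := G) (π := π) q
  have h2 := Finset.card_filter_add_card_filter_not (s := G.edgeFinset) (fun e => IsCore G π q e)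
  have h3 : G.edgeSet.ncard = G.edgeFinset.card := by
    rw [← Set.ncard_coe_finset, SimpleGraph.coe_edgeFinset]
  nlinarith

end Core

section Chain

variable {V : Type} {q M : ℕ}

/-- The sequence that starts at `x` and follows the choices `w` of neighbours for `M` steps. -/
def chain (nb : V → Fin q → V) (x : V) (w : Fin M → Fin q) : ℕ → V
  | 0 => x
  | t + 1 => if h : t < M then nb (chain nb x w t) (w ⟨t, h⟩) else chain nb x w t

lemma chain_succ {nb : V → Fin q → V} {x : V} {w : Fin M → Fin q} {t : ℕ} (h : t < M) :
    chain nb x w (t + 1) = nb (chain nb x w t) (w ⟨t, h⟩) := by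
  rw [chain, dif_pos h]

lemma chain_mem {nb : V → Fin q → V} {x : V} {w : Fin M → Fin q} {S : Set V} (hx : x ∈ S)
    (hnb : ∀ v ∈ S, ∀ i, nb v i ∈ S) (t : ℕ) : chain nb x w t ∈ S := by
  induction t with
  | zero => exact hx
  | succ t ih =>
    rw [chain]
    split_ifs
    · exact hnb _ ih _
    · exact ih

lemma chain_injective {nb : V → Fin q → V} {x : V} {S : Set V} (hx : x ∈ S)
    (hnb : ∀ v ∈ S, ∀ i, nb v i ∈ S) (hinj : ∀ v ∈ S, Function.Injective (nb v))
    {w w' : Fin M → Fin q} (h : ∀ t ≤ M, chain nb x w t = chain nb x w' t) : w = w' := by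
  funext ⟨t, ht⟩
  have h1 := h (t + 1) ht
  rw [chain_succ ht, chain_succ ht, h t ht.le] at h1
  exact hinj _ (chain_mem hx hnb t) h1

/-- The two-sided sequence with the edge `s(x, y)` in the middle. -/
def twoChain (nb : V → Fin q → V) (x y : V) (l r : Fin M → Fin q) (t : ℕ) : V :=
  if t ≤ M then chain nb x l (M - t) else chain nb y r (t - (M + 1))

lemma twoChain_le {nb : V → Fin q → V} {x y : V} {l r : Fin M → Fin q} {t : ℕ} (h : t ≤ M) :
    twoChain nb x y l r t = chain nb x l (M - t) := if_pos h

lemma twoChain_gt {nb : V → Fin q → V} {x y : V} {l r : Fin M → Fin q} {t : ℕ} (h : M < t) :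
    twoChain nb x y l r t = chain nb y r (t - (M + 1)) := if_neg (by omega)

lemma stepEdge_twoChain {nb : V → Fin q → V} {x y : V} {l r : Fin M → Fin q} {S : Set V}
    (hx : x ∈ S) (hy : y ∈ S) (hnb : ∀ v ∈ S, ∀ i, nb v i ∈ S) {t : ℕ} (ht : t < 2 * M + 1) :
    stepEdge (twoChain nb x y l r) t = s(x, y) ∨
      ∃ v ∈ S, ∃ i, stepEdge (twoChain nb x y l r) t = s(v, nb v i) := by
  unfold stepEdge
  rcases lt_trichotomy t M with h | rfl | h
  · right
    rw [twoChain_le h.le, twoChain_le (show t + 1 ≤ M from h),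
      show M - t = M - (t + 1) + 1 by omega, chain_succ (by omega), Sym2.eq_swap]
    exact ⟨_, chain_mem hx hnb _, _, rfl⟩
  · left
    rw [twoChain_le le_rfl, twoChain_gt (Nat.lt_succ_self t)]
    simp [chain]
  · right
    rw [twoChain_gt h, twoChain_gt (by omega), show t + 1 - (M + 1) = t - (M + 1) + 1 by omega,
      chain_succ (by omega)]
    exact ⟨_, chain_mem hy hnb _, _, rfl⟩

end Chain

section Walks

variable {V : Type} [Fintype V] {G : SimpleGraph V} {π : Sym2 V → ℕ}

lemma IsCore.exists_choice {q : ℕ} {e : Sym2 V} (he : IsCore G π q e) :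
    ∃ (S : Set V) (nb : V → Fin q → V), (∀ x ∈ e, x ∈ S) ∧ (∀ v ∈ S, ∀ i, nb v i ∈ S) ∧
      (∀ v ∈ S, Function.Injective (nb v)) ∧
      ∀ v ∈ S, ∀ i, G.Adj v (nb v i) ∧ π s(v, nb v i) ≤ π e := by
  classical
  obtain ⟨S, heS, hS⟩ := he
  have key : ∀ v, ∃ g : Fin q → V, v ∈ S → Function.Injective g ∧
      ∀ i, g i ∈ {u ∈ S | G.Adj v u ∧ π s(v, u) ≤ π e} := by
    intro v
    by_cases hv : v ∈ S
    · set N := {u ∈ S | G.Adj v u ∧ π s(v, u) ≤ π e} with hN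
      have hc : Fintype.card (Fin q) ≤ N.toFinset.card := by
        rw [Fintype.card_fin, ← Set.ncard_eq_toFinset_card']
        exact hS v hv
      obtain ⟨g, hg⟩ := Function.Embedding.exists_of_card_le_finset hc
      exact ⟨g, fun _ => ⟨g.injective, fun i =>
        Set.mem_toFinset.1 (Finset.mem_coe.1 (hg (Set.mem_range_self i)))⟩⟩
    · exact ⟨fun _ => v, fun h => absurd h hv⟩
  choose nb hnb using key
  exact ⟨S, nb, heS, fun v hv i => ((hnb v hv).2 i).1, fun v hv => (hnb v hv).1,
    fun v hv i => ((hnb v hv).2 i).2⟩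

open Classical in
/-- Every core edge is the middle of many walks with all other edges preceding it. -/
lemma exists_walks (q M : ℕ) : ∃ P : Finset (ℕ → V),
    (G.edgeFinset.filter fun e => IsCore G π q e).card * q ^ (2 * M) ≤ P.card ∧
    (∀ a ∈ P, (∀ t < 2 * M + 1, G.Adj (a t) (a (t + 1))) ∧
      ∀ t < 2 * M + 1, π (stepEdge a t) ≤ π (stepEdge a M)) ∧
    ∀ a ∈ P, ∀ b ∈ P, (∀ t ≤ 2 * M + 1, a t = b t) → a = b := by
  set E := G.edgeFinset.filter fun e => IsCore G π q e with hE
  have hch : ∀ e, ∃ (x y : V) (S : Set V) (nb : V → Fin q → V), s(x, y) = e ∧ (e ∈ E →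
      G.Adj x y ∧ x ∈ S ∧ y ∈ S ∧ (∀ v ∈ S, ∀ i, nb v i ∈ S) ∧
      (∀ v ∈ S, Function.Injective (nb v)) ∧
      ∀ v ∈ S, ∀ i, G.Adj v (nb v i) ∧ π s(v, nb v i) ≤ π e) := by
    intro e
    induction e with | h x y => ?_
    by_cases he : s(x, y) ∈ E
    · obtain ⟨he1, he2⟩ := Finset.mem_filter.1 he
      obtain ⟨S, nb, h1, h2, h3, h4⟩ := he2.exists_choice
      exact ⟨x, y, S, nb, rfl, fun _ => ⟨by simpa using he1, h1 x (Sym2.mem_mk_left _ _),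
        h1 y (Sym2.mem_mk_right _ _), h2, h3, h4⟩⟩
    · exact ⟨x, y, Set.univ, fun v _ => v, rfl, fun h => absurd h he⟩
  choose x y S nb hxy hch using hch
  let W : Sym2 V × (Fin M → Fin q) × (Fin M → Fin q) → ℕ → V := fun p =>
    twoChain (nb p.1) (x p.1) (y p.1) p.2.1 p.2.2
  have hmid : ∀ p, stepEdge (W p) M = p.1 := fun p => by
    refine Eq.trans ?_ (hxy p.1)
    simp only [stepEdge, W]
    rw [twoChain_le le_rfl, twoChain_gt (Nat.lt_succ_self M)]
    simp [chain]
  have hdet : ∀ p ∈ E ×ˢ (Finset.univ : Finset ((Fin M → Fin q) × (Fin M → Fin q))),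
      ∀ p' ∈ E ×ˢ (Finset.univ : Finset ((Fin M → Fin q) × (Fin M → Fin q))),
      (∀ t ≤ 2 * M + 1, W p t = W p' t) → p = p' := by
    rintro ⟨e, l, r⟩ hp ⟨e', l', r'⟩ hp' h
    have he : e = e' := by
      have := (hmid (e, l, r)).symm.trans (Eq.trans ?_ (hmid (e', l', r')))
      · exact this
      · rw [stepEdge, stepEdge, h M (by omega), h (M + 1) (by omega)]
    subst he
    obtain ⟨h1, h2, h3, h4, h5, h6⟩ := hch e (Finset.mem_product.1 hp).1
    have hl : l = l' := chain_injective h2 h4 h5 fun t ht => by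
      have := h (M - t) (by omega)
      simp only [W] at this
      rwa [twoChain_le (by omega), twoChain_le (by omega), show M - (M - t) = t by omega] at this
    have hr : r = r' := chain_injective h3 h4 h5 fun t ht => by
      have := h (M + 1 + t) (by omega)
      simp only [W] at this
      rwa [twoChain_gt (by omega), twoChain_gt (by omega),
        show M + 1 + t - (M + 1) = t by omega] at this
    rw [hl, hr]
  refine ⟨(E ×ˢ Finset.univ).image W, ?_, ?_, ?_⟩
  · rw [Finset.card_image_of_injOn (fun p hp p' hp' h =>
      hdet p hp p' hp' fun t _ => congrFun h t), Finset.card_product]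
    simp [two_mul, pow_add]
  · intro a ha
    obtain ⟨⟨e, l, r⟩, hp, rfl⟩ := Finset.mem_image.1 ha
    obtain ⟨h1, h2, h3, h4, h5, h6⟩ := hch e (Finset.mem_product.1 hp).1
    have hstep : ∀ t < 2 * M + 1, stepEdge (W (e, l, r)) t ∈ G.edgeSet ∧
        π (stepEdge (W (e, l, r)) t) ≤ π e := by
      intro t ht
      rcases stepEdge_twoChain (l := l) (r := r) h2 h3 h4 ht with h | ⟨v, hv, i, h⟩
      · simp only [W]
        rw [h]
        exact ⟨h1, by rw [hxy]⟩
      · simp only [W]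
        rw [h]
        exact h6 v hv i
    exact ⟨fun t ht => (hstep t ht).1, fun t ht => by rw [hmid]; exact (hstep t ht).2⟩
  · intro a ha b hb h
    obtain ⟨p, hp, rfl⟩ := Finset.mem_image.1 ha
    obtain ⟨p', hp', rfl⟩ := Finset.mem_image.1 hb
    rw [hdet p hp p' hp' h]

end Walks

section BadWalks

lemma card_le_cnt {V : Type} {k : ℕ} {S : Finset (ℕ → V)}
    (hext : ∀ a ∈ S, ∀ b ∈ S, (∀ t ≤ k, a t = b t) → a = b) :
    S.card ≤ cnt S (fun a => a) {u | u ≤ k} := by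
  classical
  calc S.card = (S.image id).card := by rw [Finset.image_id]
    _ ≤ _ := card_image_le_cnt id hext

variable {V : Type} [Fintype V] {G : SimpleGraph V} {π : Sym2 V → ℕ}
  {R : Sym2 V → Sym2 V → Prop} {k f D : ℕ} {S : Finset (ℕ → V)}

lemma cnt_walk_le_of_forward (hD : ∀ v, {u | G.Adj v u}.ncard ≤ D)
    (hadj : ∀ a ∈ S, ∀ t < k, G.Adj (a t) (a (t + 1))) {j N : ℕ} (hj : 1 ≤ j) (hjk : j ≤ k)
    (hstep : cnt S (fun a => a) {u | u ≤ j} ≤ cnt S (fun a => a) {u | u < j} * N) :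
    cnt S (fun a => a) {u | u ≤ k} ≤ Fintype.card V * D ^ (k - 1) * N := by
  have h1 : cnt S (fun a => a) {u | u ≤ k} ≤ cnt S (fun a => a) {u | u ≤ j} * D ^ (k - j) := by
    refine cnt_chain hD (fun t => j + t) (k - j) (by simp)
      (fun a ha t ht => hadj a ha (j + t) (by omega)) fun r hr => ?_
    rcases le_or_gt r j with h | h
    · exact .inl h
    · simp only [Set.mem_ofPred_eq] at hr
      exact .inr ⟨r - j, by omega, by omega, by omega⟩
  have h2 : cnt S (fun a => a) {u | u < j} ≤ cnt S (fun a => a) {u | u = 0} * D ^ (j - 1) := by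
    refine cnt_chain hD (fun t => t) (j - 1) (by simp)
      (fun a ha t ht => hadj a ha t (by omega)) fun r hr => ?_
    simp only [Set.mem_ofPred_eq] at hr ⊢
    rcases Nat.eq_zero_or_pos r with h | h
    · exact .inl h
    · exact .inr ⟨r, by omega, by omega, rfl⟩
  have h3 : cnt S (fun a => a) {u | u = 0} ≤ Fintype.card V :=
    (cnt_start (A := ∅) 0 fun p hp => .inr hp).trans
      ((Nat.mul_le_mul_right _ cnt_empty_le).trans (one_mul _).le)
  calc _ ≤ Fintype.card V * D ^ (j - 1) * N * D ^ (k - j) := by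
        refine h1.trans (Nat.mul_le_mul_right _ (hstep.trans (Nat.mul_le_mul_right _ ?_)))
        exact h2.trans (Nat.mul_le_mul_right _ h3)
    _ = Fintype.card V * D ^ (j - 1 + (k - j)) * N := by rw [pow_add]; ring
    _ = _ := by rw [show j - 1 + (k - j) = k - 1 by omega]

lemma cnt_walk_le_of_backward (hD : ∀ v, {u | G.Adj v u}.ncard ≤ D)
    (hadj : ∀ a ∈ S, ∀ t < k, G.Adj (a t) (a (t + 1))) {j N : ℕ} (hjk : j < k)
    (hstep : cnt S (fun a => a) {u | j ≤ u ∧ u ≤ k} ≤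
      cnt S (fun a => a) {u | j < u ∧ u ≤ k} * N) :
    cnt S (fun a => a) {u | u ≤ k} ≤ Fintype.card V * D ^ (k - 1) * N := by
  have hback : ∀ a ∈ S, ∀ m ≤ k, ∀ t < m, G.Adj (a (m - t)) (a (m - (t + 1))) := by
    intro a ha m hm t ht
    have := hadj a ha (m - (t + 1)) (by omega)
    rw [show m - (t + 1) + 1 = m - t by omega] at this
    exact this.symm
  have h1 : cnt S (fun a => a) {u | u ≤ k} ≤ cnt S (fun a => a) {u | j ≤ u ∧ u ≤ k} * D ^ j := by
    refine cnt_chain hD (fun t => j - t) j (by simp [hjk.le])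
      (fun a ha t ht => hback a ha j hjk.le t ht) fun r hr => ?_
    simp only [Set.mem_ofPred_eq] at hr
    rcases le_or_gt j r with h | h
    · exact .inl ⟨h, hr⟩
    · exact .inr ⟨j - r, by omega, by omega, by omega⟩
  have h2 : cnt S (fun a => a) {u | j < u ∧ u ≤ k} ≤
      cnt S (fun a => a) {u | u = k} * D ^ (k - (j + 1)) := by
    refine cnt_chain hD (fun t => k - t) (k - (j + 1)) (by simp)
      (fun a ha t ht => hback a ha k le_rfl t (by omega)) fun r hr => ?_
    simp only [Set.mem_ofPred_eq] at hr ⊢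
    rcases hr.2.eq_or_lt with h | h
    · exact .inl h
    · exact .inr ⟨k - r, by omega, by omega, by omega⟩
  have h3 : cnt S (fun a => a) {u | u = k} ≤ Fintype.card V :=
    (cnt_start (A := ∅) k fun p hp => .inr hp).trans
      ((Nat.mul_le_mul_right _ cnt_empty_le).trans (one_mul _).le)
  calc _ ≤ Fintype.card V * D ^ (k - (j + 1)) * N * D ^ j := by
        refine h1.trans (Nat.mul_le_mul_right _ (hstep.trans (Nat.mul_le_mul_right _ ?_)))
        exact h2.trans (Nat.mul_le_mul_right _ h3)
    _ = Fintype.card V * D ^ (k - (j + 1) + j) * N := by rw [pow_add]; ring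
    _ = _ := by rw [show k - (j + 1) + j = k - 1 by omega]

lemma card_walks_eq_le (hD : ∀ v, {u | G.Adj v u}.ncard ≤ D)
    (hadj : ∀ a ∈ S, ∀ t < k, G.Adj (a t) (a (t + 1)))
    (hext : ∀ a ∈ S, ∀ b ∈ S, (∀ t ≤ k, a t = b t) → a = b) {s t : ℕ} (hst : s < t) (ht : t ≤ k)
    (heq : ∀ a ∈ S, a s = a t) : S.card ≤ Fintype.card V * D ^ (k - 1) := by
  refine (card_le_cnt hext).trans ((cnt_walk_le_of_forward hD hadj (j := t) (N := 1) (by omega) ht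
    ?_).trans (mul_one _).le)
  rw [mul_one]
  refine cnt_le_of_determined fun q hq => ?_
  simp only [Set.mem_ofPred_eq] at hq
  rcases hq.eq_or_lt with rfl | h
  · exact ⟨s, hst, fun a ha => (heq a ha).symm⟩
  · exact ⟨q, h, fun _ _ => rfl⟩

lemma card_walks_rel_le (hB : BlockingSystem G π R k f) (hD : ∀ v, {u | G.Adj v u}.ncard ≤ D)
    (hadj : ∀ a ∈ S, ∀ t < k, G.Adj (a t) (a (t + 1)))
    (hext : ∀ a ∈ S, ∀ b ∈ S, (∀ t ≤ k, a t = b t) → a = b) {t j : ℕ} (ht : t < k) (hj : j ≤ k)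
    (hjt : j ≠ t) (hjt' : j ≠ t + 1) (hrel : ∀ a ∈ S, ∃ e', R (stepEdge a t) e' ∧ a j ∈ e') :
    S.card ≤ Fintype.card V * D ^ (k - 1) * (2 * f) := by
  refine (card_le_cnt hext).trans ?_
  rcases lt_or_gt_of_ne hjt with h | h
  · refine cnt_walk_le_of_backward hD hadj (j := j) (by omega)
      (cnt_vertex_of_rel hB t (t + 1) j ⟨h, ht.le⟩ ⟨by omega, by omega⟩ hrel fun r hr => ?_)
    simp only [Set.mem_ofPred_eq] at hr ⊢
    omega
  · refine cnt_walk_le_of_forward hD hadj (j := j) (by omega) hj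
      (cnt_vertex_of_rel hB t (t + 1) j h (show t + 1 < j by omega) hrel fun r hr => ?_)
    simp only [Set.mem_ofPred_eq] at hr ⊢
    omega

open Classical in
/-- Few walks repeat a vertex or have an edge related to an edge through another vertex. -/
lemma card_le_card_filter_add (hf : 1 ≤ f) (hB : BlockingSystem G π R k f)
    (hD : ∀ v, {u | G.Adj v u}.ncard ≤ D)
    (hadj : ∀ a ∈ S, ∀ t < k, G.Adj (a t) (a (t + 1)))
    (hext : ∀ a ∈ S, ∀ b ∈ S, (∀ t ≤ k, a t = b t) → a = b) :
    S.card ≤ (S.filter fun a => (∀ s ≤ k, ∀ t ≤ k, a s = a t → s = t) ∧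
        ∀ t < k, ∀ j ≤ k, j ≠ t → j ≠ t + 1 → ∀ e', R (stepEdge a t) e' → a j ∉ e').card +
      (k + 1) ^ 2 * (3 * f * (Fintype.card V * D ^ (k - 1))) := by
  set I := Finset.range (k + 1) ×ˢ Finset.range (k + 1) with hI
  set bad₁ : ℕ × ℕ → Finset (ℕ → V) := fun p =>
    S.filter fun a => p.1 < p.2 ∧ a p.1 = a p.2 with hbad₁
  set bad₂ : ℕ × ℕ → Finset (ℕ → V) := fun p =>
    S.filter fun a => (p.1 < k ∧ p.2 ≠ p.1 ∧ p.2 ≠ p.1 + 1) ∧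
      ∃ e', R (stepEdge a p.1) e' ∧ a p.2 ∈ e' with hbad₂
  have h1 : ∀ p ∈ I, (bad₁ p ∪ bad₂ p).card ≤ 3 * f * (Fintype.card V * D ^ (k - 1)) := by
    rintro ⟨s, t⟩ hp
    obtain ⟨hs, ht⟩ := Finset.mem_product.1 hp
    have hs := Finset.mem_range.1 hs
    have ht := Finset.mem_range.1 ht
    simp only at hs ht
    have hsub : ∀ S' ⊆ S, (∀ a ∈ S', ∀ t < k, G.Adj (a t) (a (t + 1))) ∧
        ∀ a ∈ S', ∀ b ∈ S', (∀ t ≤ k, a t = b t) → a = b := fun S' h =>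
      ⟨fun a ha => hadj a (h ha), fun a ha b hb => hext a (h ha) b (h hb)⟩
    have hb₁ : (bad₁ (s, t)).card ≤ Fintype.card V * D ^ (k - 1) := by
      by_cases hst : s < t
      · obtain ⟨g1, g2⟩ := hsub (bad₁ (s, t)) (Finset.filter_subset _ _)
        exact card_walks_eq_le hD g1 g2 hst (Nat.lt_succ_iff.1 ht)
          fun a ha => (Finset.mem_filter.1 ha).2.2
      · have : bad₁ (s, t) = ∅ := Finset.filter_eq_empty_iff.2 fun a _ h => hst h.1
        rw [this]
        exact Nat.zero_le _
    have hb₂ : (bad₂ (s, t)).card ≤ Fintype.card V * D ^ (k - 1) * (2 * f) := by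
      by_cases hst : s < k ∧ t ≠ s ∧ t ≠ s + 1
      · obtain ⟨g1, g2⟩ := hsub (bad₂ (s, t)) (Finset.filter_subset _ _)
        exact card_walks_rel_le hB hD g1 g2 hst.1 (Nat.lt_succ_iff.1 ht) hst.2.1 hst.2.2
          fun a ha => (Finset.mem_filter.1 ha).2.2
      · have : bad₂ (s, t) = ∅ := Finset.filter_eq_empty_iff.2 fun a _ h => hst h.1
        rw [this]
        exact Nat.zero_le _
    refine (Finset.card_union_le _ _).trans ?_
    calc _ ≤ f * (Fintype.card V * D ^ (k - 1)) + Fintype.card V * D ^ (k - 1) * (2 * f) :=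
          Nat.add_le_add (hb₁.trans (Nat.le_mul_of_pos_left _ hf)) hb₂
      _ = _ := by ring
  have hsub : S ⊆ (S.filter fun a => (∀ s ≤ k, ∀ t ≤ k, a s = a t → s = t) ∧
        ∀ t < k, ∀ j ≤ k, j ≠ t → j ≠ t + 1 → ∀ e', R (stepEdge a t) e' → a j ∉ e') ∪
      I.biUnion fun p => bad₁ p ∪ bad₂ p := by
    intro a ha
    by_contra hcon
    simp only [Finset.mem_union, Finset.mem_filter, Finset.mem_biUnion, hI, hbad₁, hbad₂,
      Finset.mem_product, Finset.mem_range] at hcon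
    push Not at hcon
    obtain ⟨hc1, hc2⟩ := hcon
    have hne : ∀ s t, s < t → t ≤ k → a s ≠ a t := fun s t hst ht =>
      (hc2 (s, t) ⟨by simp only; omega, by simp only; omega⟩).1 ha hst
    obtain ⟨t, ht, j, hj, hjt, hjt', e', he', hje'⟩ := hc1 ha fun s hs t ht h => by
      rcases lt_trichotomy s t with hlt | rfl | hlt
      · exact absurd h (hne s t hlt ht)
      · rfl
      · exact absurd h.symm (hne t s hlt hs)
    exact (hc2 (t, j) ⟨by simp only; omega, by simp only; omega⟩).2 ha ⟨ht, hjt, hjt'⟩ e' he' hje'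
  refine (Finset.card_le_card hsub).trans ((Finset.card_union_le _ _).trans
    (Nat.add_le_add_left ?_ _))
  refine (Finset.card_biUnion_le_card_mul _ _ _ h1).trans (le_of_eq ?_)
  rw [hI, Finset.card_product, Finset.card_range, sq]

end BadWalks

section Colouring

variable {V : Type} [Fintype V]

open Classical in
/-- Some colouring of the vertices colours many of the given injective sequences in order. -/
lemma exists_colouring (S : Finset (ℕ → V)) (k : ℕ)
    (hinj : ∀ a ∈ S, ∀ s ≤ k, ∀ t ≤ k, a s = a t → s = t) :
    ∃ χ : V → ℕ, S.card ≤ (S.filter fun a => ∀ t ≤ k, χ (a t) = t).card * (k + 1) ^ (k + 1) := by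
  have hgood : ∀ a ∈ S, Fintype.card (V → Fin (k + 1)) ≤
      (Finset.univ.filter fun χ : V → Fin (k + 1) => ∀ t ≤ k, (χ (a t) : ℕ) = t).card *
        (k + 1) ^ (k + 1) := by
    intro a ha
    have hinj' : Function.Injective (fun t : Fin (k + 1) => a t) := fun s t h =>
      Fin.ext (hinj a ha s (by omega) t (by omega) h)
    have hc : (k + 1) ^ (k + 1) = (Finset.univ : Finset (Fin (k + 1) → Fin (k + 1))).card := by
      simp
    rw [hc, ← Finset.card_product, ← Finset.card_univ]
    refine Finset.card_le_card_of_injOn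
      (fun χ => (Function.extend (fun t : Fin (k + 1) => a t) id χ, fun t => χ (a t))) ?_ ?_
    · intro χ _
      refine Finset.mem_coe.2 (Finset.mk_mem_product (Finset.mem_filter.2 ⟨Finset.mem_univ _, ?_⟩)
        (Finset.mem_univ _))
      intro t ht
      have := hinj'.extend_apply id χ ⟨t, by omega⟩
      simp only at this
      rw [this]
      rfl
    · intro χ _ χ' _ h
      simp only [Prod.mk.injEq] at h
      funext v
      by_cases hv : ∃ t : Fin (k + 1), a t = v
      · obtain ⟨t, rfl⟩ := hv
        exact congrFun h.2 t
      · have := congrFun h.1 v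
        rwa [Function.extend_apply' _ _ _ hv, Function.extend_apply' _ _ _ hv] at this
  have hsum : ∑ _χ : V → Fin (k + 1), S.card ≤ ∑ χ : V → Fin (k + 1),
      (S.filter fun a => ∀ t ≤ k, (χ (a t) : ℕ) = t).card * (k + 1) ^ (k + 1) := by
    have hswap : ∑ χ : V → Fin (k + 1), (S.filter fun a => ∀ t ≤ k, (χ (a t) : ℕ) = t).card =
        ∑ a ∈ S, (Finset.univ.filter fun χ : V → Fin (k + 1) =>
          ∀ t ≤ k, (χ (a t) : ℕ) = t).card := by
      simp only [Finset.card_filter]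
      exact Finset.sum_comm
    rw [← Finset.sum_mul, hswap, Finset.sum_mul, Finset.sum_const, Finset.card_univ, smul_eq_mul,
      mul_comm, ← smul_eq_mul, ← Finset.sum_const]
    exact Finset.sum_le_sum hgood
  obtain ⟨χ, _, hχ⟩ := Finset.exists_le_of_sum_le Finset.univ_nonempty hsum
  exact ⟨fun v => χ v, hχ⟩

end Colouring

section LowerBound

open Classical in
theorem exists_many_goodPaths (M : ℕ) : ∃ c, ∀ (V : Type) [Fintype V]
    (G : SimpleGraph V) (π : Sym2 V → ℕ) (R : Sym2 V → Sym2 V → Prop) (k f D : ℕ),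
    k = 2 * M + 1 → 1 ≤ f → c * f ≤ D → BlockingSystem G π R k f →
    (∀ v, {u | G.Adj v u}.ncard ≤ D) → Fintype.card V * D ≤ 8 * G.edgeSet.ncard →
    ∃ (χ : V → ℕ) (P : Finset (ℕ → V)), (∀ a ∈ P, IsGoodPath G π R χ M k a) ∧
      (∀ a ∈ P, ∀ b ∈ P, (∀ t ≤ k, a t = b t) → a = b) ∧
      Fintype.card V * D ^ k ≤ c * P.card := by
  set c₀ := 32 ^ (2 * M + 1) with hc₀
  set c₁ := (2 * M + 1 + 1) ^ (2 * M + 1 + 1) with hc₁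
  set c₂ := 2 * c₀ * ((2 * M + 1 + 1) ^ 2 * 3) with hc₂
  refine ⟨32 + c₂ + 2 * c₀ * c₁, ?_⟩
  intro V _ G π R k f D hk hf hfD hB hD hm
  set n := Fintype.card V with hn
  have hD32 : 32 ≤ D :=
    (Nat.mul_le_mul (by omega : 32 ≤ 32 + c₂ + 2 * c₀ * c₁) hf).trans hfD
  have hDc₂ : c₂ * f ≤ D :=
    (Nat.mul_le_mul_right f (by omega : c₂ ≤ 32 + c₂ + 2 * c₀ * c₁)).trans hfD
  obtain ⟨P, hP1, hP2, hP3⟩ := exists_walks (G := G) (π := π) (D / 16) M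
  rw [← hk] at hP2 hP3
  have hX : n * D ^ k ≤ c₀ * P.card := by
    have h1 := mul_le_card_isCore (π := π) (Nat.mul_div_le D 16) hm
    have h2 : D ≤ 32 * (D / 16) := by omega
    calc n * D ^ k = n * D * D ^ (2 * M) := by rw [hk]; ring
      _ ≤ 16 * (G.edgeFinset.filter fun e => IsCore G π (D / 16) e).card *
          (32 * (D / 16)) ^ (2 * M) := by gcongr
      _ = 16 * 32 ^ (2 * M) * ((G.edgeFinset.filter fun e => IsCore G π (D / 16) e).card *
          (D / 16) ^ (2 * M)) := by rw [mul_pow]; ring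
      _ ≤ 16 * 32 ^ (2 * M) * P.card := by gcongr
      _ ≤ 32 ^ (2 * M + 1) * P.card := by
          refine Nat.mul_le_mul_right _ ?_
          rw [pow_succ]; omega
  have hbad := card_le_card_filter_add hf hB hD (fun a ha => (hP2 a ha).1) hP3
  set P₁ := P.filter fun a => (∀ s ≤ k, ∀ t ≤ k, a s = a t → s = t) ∧
        ∀ t < k, ∀ j ≤ k, j ≠ t → j ≠ t + 1 → ∀ e', R (stepEdge a t) e' → a j ∉ e' with hP₁
  obtain ⟨χ, hχ⟩ := exists_colouring P₁ k fun a ha => (Finset.mem_filter.1 ha).2.1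
  refine ⟨χ, P₁.filter fun a => ∀ t ≤ k, χ (a t) = t, ?_, ?_, ?_⟩
  · intro a ha
    obtain ⟨ha1, hac⟩ := Finset.mem_filter.1 ha
    obtain ⟨ha, -, hau⟩ := Finset.mem_filter.1 ha1
    exact ⟨(hP2 a ha).1, (hP2 a ha).2, hau, hac⟩
  · intro a ha b hb
    exact hP3 a (Finset.mem_filter.1 (Finset.mem_filter.1 ha).1).1 b
      (Finset.mem_filter.1 (Finset.mem_filter.1 hb).1).1
  · set N := (P₁.filter fun a => ∀ t ≤ k, χ (a t) = t).card with hN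
    have h1 : 2 * c₀ * ((k + 1) ^ 2 * (3 * f * (n * D ^ (k - 1)))) ≤ n * D ^ k := by
      calc _ = c₂ * f * (n * D ^ (k - 1)) := by rw [hc₂, hk]; ring
        _ ≤ D * (n * D ^ (k - 1)) := Nat.mul_le_mul_right _ hDc₂
        _ = n * D ^ (k - 1 + 1) := by ring
        _ = n * D ^ k := by rw [show k - 1 + 1 = k by omega]
    have h2 : n * D ^ k ≤ 2 * c₀ * P₁.card := by
      have := Nat.mul_le_mul_left (2 * c₀) hbad
      rw [mul_add] at this
      linarith
    calc n * D ^ k ≤ 2 * c₀ * P₁.card := h2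
      _ ≤ 2 * c₀ * (N * (k + 1) ^ (k + 1)) := Nat.mul_le_mul_left _ hχ
      _ = 2 * c₀ * c₁ * N := by rw [hc₁, hk]; ring
      _ ≤ (32 + c₂ + 2 * c₀ * c₁) * N := Nat.mul_le_mul_right _ (Nat.le_add_left _ _)

/-- A blocking system with small multiplicity on a nearly regular graph has small degree. -/
theorem exists_degree_bound (M : ℕ) : ∃ C, ∀ (V : Type) [Fintype V]
    (G : SimpleGraph V) (π : Sym2 V → ℕ) (R : Sym2 V → Sym2 V → Prop) (k f D : ℕ),
    k = 2 * M + 1 → 1 ≤ f → 1 ≤ Fintype.card V → BlockingSystem G π R k f →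
    (∀ v, {u | G.Adj v u}.ncard ≤ D) → Fintype.card V * D ≤ 8 * G.edgeSet.ncard →
    D ≤ C * f ∨ D ^ k ≤ C * Fintype.card V ∨ D ^ (k + 1) ≤ C * (Fintype.card V * f ^ (M + 1)) ∨
      D ^ (k + 2) ≤ C * (Fintype.card V * f ^ k) := by
  obtain ⟨c, hc⟩ := exists_many_goodPaths M
  obtain ⟨C, hC1, hC⟩ := exists_card_sparseTrails_le (2 * M + 1)
  obtain ⟨K, hK⟩ := exists_pow_le_of_isGoodPath M C c hC1
  refine ⟨c + 3 * K, ?_⟩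
  intro V _ G π R k f D hk hf hn hB hD hm
  rcases Nat.eq_zero_or_pos D with rfl | hD1
  · exact .inl (Nat.zero_le _)
  by_cases hfD : c * f ≤ D
  · right
    obtain ⟨χ, P, h1, h2, h3⟩ := hc V G π R k f D hk hf hfD hB hD hm
    have h := hK V G π R χ k f D P hk hf hD1 hn hB hD
      (by subst hk; exact hC V G π R f hf hB) h1 h2 h3
    set n := Fintype.card V with hn
    have h' : D ^ (k + 2) ≤ K * (n * D ^ 2) + K * (n * (D * f ^ (M + 1))) + K * (n * f ^ k) := by
      refine h.trans (le_of_eq ?_); ring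
    have hle : 3 * K ≤ c + 3 * K := Nat.le_add_left _ _
    by_contra! hcon
    obtain ⟨g1, g2, g3⟩ := hcon
    have g1' : 3 * K * n < D ^ k := (Nat.mul_le_mul_right _ hle).trans_lt g1
    have g2' : 3 * K * (n * f ^ (M + 1)) < D ^ (k + 1) := (Nat.mul_le_mul_right _ hle).trans_lt g2
    have g3' : 3 * K * (n * f ^ k) < D ^ (k + 2) := (Nat.mul_le_mul_right _ hle).trans_lt g3
    have e1 : D ^ (k + 2) = D ^ k * D ^ 2 := pow_add _ _ _
    have e2 : D ^ (k + 2) = D ^ (k + 1) * D := pow_succ _ _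
    have i1 : 3 * K * n * D ^ 2 < D ^ (k + 2) := by
      rw [e1]; exact Nat.mul_lt_mul_of_pos_right g1' (Nat.pow_pos hD1)
    have i2 : 3 * K * (n * f ^ (M + 1)) * D < D ^ (k + 2) := by
      rw [e2]; exact Nat.mul_lt_mul_of_pos_right g2' hD1
    have j1 : 3 * K * n * D ^ 2 = 3 * (K * (n * D ^ 2)) := by ring
    have j2 : 3 * K * (n * f ^ (M + 1)) * D = 3 * (K * (n * (D * f ^ (M + 1)))) := by ring
    have j3 : 3 * K * (n * f ^ k) = 3 * (K * (n * f ^ k)) := by ring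
    omega
  · exact .inl ((not_le.1 hfD).le.trans (Nat.mul_le_mul_right _ (Nat.le_add_right _ _)))

end LowerBound

section Reduction

variable {V W : Type}

/-- Every edge of a closed trail lies on a cycle contained in the trail. -/
lemma exists_isCycle_of_isTrail {H : SimpleGraph V} {u : V} {w : H.Walk u u} (hw : w.IsTrail)
    {e : Sym2 V} (he : e ∈ w.edges) : ∃ (v : V) (c : H.Walk v v), c.IsCycle ∧
      c.length ≤ w.length ∧ (∀ e' ∈ c.edges, e' ∈ w.edges) ∧ e ∈ c.edges := by
  classical
  obtain ⟨x, y, p, h, q, rfl, rfl⟩ := exists_append_cons_of_mem_edges w he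
  have hsub := (q.append p).edges_bypass_subset_edges
  have hlen := (q.append p).length_bypass_le_length
  have hnd := hw.edges_nodup
  simp only [SimpleGraph.Walk.edges_append, SimpleGraph.Walk.edges_cons] at hnd hsub
  refine ⟨x, SimpleGraph.Walk.cons h (q.append p).bypass, ?_, ?_, ?_, by simp⟩
  · rw [SimpleGraph.Walk.cons_isCycle_iff]
    refine ⟨SimpleGraph.Walk.bypass_isPath _, fun hmem => ?_⟩
    have h1 := List.nodup_append.1 hnd
    have h2 := List.nodup_cons.1 h1.2.1
    rcases List.mem_append.1 (hsub hmem) with h3 | h3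
    · exact h2.1 h3
    · exact h1.2.2 _ h3 _ List.mem_cons_self rfl
  · simp only [SimpleGraph.Walk.length_append, SimpleGraph.Walk.length_cons] at hlen ⊢
    omega
  · intro e' he'
    simp only [SimpleGraph.Walk.edges_cons, List.mem_cons, SimpleGraph.Walk.edges_append, List.mem_append] at he' ⊢
    rcases he' with rfl | he'
    · exact .inr (.inl rfl)
    · rcases List.mem_append.1 (hsub he') with h3 | h3
      · exact .inr (.inr h3)
      · exact .inl h3

/-- A double-blocking set pulls back along a homomorphism that is injective on edges. -/
lemma blockingSystem_of_hom [Fintype W] {H : SimpleGraph V} {π : Sym2 V → ℕ} {k F : ℕ}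
    {B : Finset (Sym2 (Sym2 V))} (hπ : Set.InjOn π H.edgeSet) (hB : IsDoubleBlockingSet H π k B)
    {G : SimpleGraph W} (φ : G →g H) (hφ : Set.InjOn (Sym2.map φ) G.edgeSet)
    (hF : ∀ e ∈ G.edgeSet, edgeBlockCount B (Sym2.map φ e) ≤ F) :
    BlockingSystem G (fun e => π (Sym2.map φ e))
      (fun e e' => e ∈ G.edgeSet ∧ e' ∈ G.edgeSet ∧ s(Sym2.map φ e, Sym2.map φ e') ∈ B) k F := by
  have hmem : ∀ e ∈ G.edgeSet, Sym2.map φ e ∈ H.edgeSet := fun e he => by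
    induction e with | h x y => exact φ.map_adj he
  -- a blocked cycle inside the image of a trail is blocked at the last edge of the trail
  have key : ∀ {u : W} (w : G.Walk u u), ∀ e ∈ w.edges,
      (∀ e' ∈ w.edges, π (Sym2.map φ e') ≤ π (Sym2.map φ e)) → ∀ {v : V} (c : H.Walk v v),
      (∀ e' ∈ c.edges, e' ∈ (w.map φ).edges) → Sym2.map φ e ∈ c.edges → ∀ b,
      CycleBlockedBy π c b → ∃ e' ∈ w.edges, b = s(Sym2.map φ e, Sym2.map φ e') := by
    rintro u w e he hmax v c hsub hec b ⟨e₁, e₂, rfl, h1, h2, h3⟩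
    have hlift : ∀ e' ∈ c.edges, ∃ e'' ∈ w.edges, Sym2.map φ e'' = e' := fun e' he' => by
      have := hsub e' he'
      rw [SimpleGraph.Walk.edges_map] at this
      exact List.mem_map.1 this
    obtain ⟨e₁', he₁', rfl⟩ := hlift _ h1
    obtain ⟨e₂', he₂', rfl⟩ := hlift _ h2
    have heq : Sym2.map φ e₁' = Sym2.map φ e :=
      hπ (hmem _ (w.edges_subset_edgeSet he₁')) (hmem _ (w.edges_subset_edgeSet he))
        (le_antisymm (hmax _ he₁') (h3.2 _ hec))
    exact ⟨e₂', he₂', by rw [heq]⟩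
  have hcyc : ∀ {u : W} (w : G.Walk u u), w.IsTrail → ∀ e ∈ w.edges, ∃ (v : V) (c : H.Walk v v),
      c.IsCycle ∧ c.length ≤ w.length ∧ (∀ e' ∈ c.edges, e' ∈ (w.map φ).edges) ∧
        Sym2.map φ e ∈ c.edges := by
    intro u w hw e he
    have htr : (w.map φ).IsTrail := by
      rw [SimpleGraph.Walk.isTrail_def, SimpleGraph.Walk.edges_map]
      exact hw.edges_nodup.map_on fun x hx y hy h =>
        hφ (w.edges_subset_edgeSet hx) (w.edges_subset_edgeSet hy) h
    obtain ⟨v, c, h1, h2, h3, h4⟩ := exists_isCycle_of_isTrail htr (e := Sym2.map φ e) (by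
      rw [SimpleGraph.Walk.edges_map]; exact List.mem_map_of_mem he)
    exact ⟨v, c, h1, by simpa using h2, h3, h4⟩
  obtain ⟨hB0, hB1, hB2⟩ := hB
  constructor
  · rintro e e' ⟨h1, h2, h3⟩
    exact ⟨h2, h1, by rwa [Sym2.eq_swap]⟩
  · rintro e ⟨-, -, h⟩
    exact (hB0 _ h).1 rfl
  · intro e
    by_cases he : e ∈ G.edgeSet
    · refine le_trans (Set.ncard_le_ncard_of_injOn (fun e' => s(Sym2.map φ e, Sym2.map φ e')) ?_ ?_
        (B.finite_toSet.subset fun _ h => h.1)) (hF e he)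
      · rintro e' ⟨-, -, h⟩
        exact ⟨h, Sym2.mem_mk_left _ _⟩
      · rintro e' ⟨-, h1, -⟩ e'' ⟨-, h2, -⟩ h
        exact hφ h1 h2 (Sym2.congr_right.1 h)
    · have : {e' | e ∈ G.edgeSet ∧ e' ∈ G.edgeSet ∧ s(Sym2.map φ e, Sym2.map φ e') ∈ B} = ∅ :=
        Set.eq_empty_of_forall_notMem fun e' h => he h.1
      rw [this, Set.ncard_empty]
      exact Nat.zero_le _
  · intro u w hw hlen e he hmax
    obtain ⟨v, c, h1, h2, h3, h4⟩ := hcyc w hw e he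
    obtain ⟨b, hb, hbl⟩ := hB1 v c h1 (h2.trans hlen)
    obtain ⟨e', he', rfl⟩ := key w e he hmax c h3 h4 b hbl
    exact ⟨e', he', w.edges_subset_edgeSet he, w.edges_subset_edgeSet he', hb⟩
  · intro u w hw hlen e he hmax
    obtain ⟨v, c, h1, h2, h3, h4⟩ := hcyc w hw e he
    obtain ⟨b, hb, b', hb', hne, hbl, hbl'⟩ := hB2 v c h1 (h2.trans hlen)
    obtain ⟨e', he', rfl⟩ := key w e he hmax c h3 h4 b hbl
    obtain ⟨e'', he'', rfl⟩ := key w e he hmax c h3 h4 b' hbl'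
    exact ⟨e', he', e'', he'', fun h => hne (by rw [h]),
      ⟨w.edges_subset_edgeSet he, w.edges_subset_edgeSet he', hb⟩,
      ⟨w.edges_subset_edgeSet he, w.edges_subset_edgeSet he'', hb'⟩⟩

open Classical in
/-- Few edges lie in many pairs of a double-blocking set. -/
lemma card_filter_edgeBlockCount_le (E : Finset (Sym2 V)) (B : Finset (Sym2 (Sym2 V))) {f : ℕ}
    (hf : 0 < f) (hB : B.card ≤ f * E.card) :
    4 * (E.filter fun e => 8 * f < edgeBlockCount B e).card ≤ E.card := by
  have hcount : ∀ e, edgeBlockCount B e = (B.filter fun b => e ∈ b).card := fun e => by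
    rw [edgeBlockCount, ← Set.ncard_coe_finset, Finset.coe_filter]
    rfl
  have hdouble : ∑ e ∈ E, edgeBlockCount B e ≤ 2 * B.card := by
    simp only [hcount, Finset.card_filter]
    rw [Finset.sum_comm, mul_comm, ← smul_eq_mul]
    refine Finset.sum_le_card_nsmul _ _ _ fun b _ => ?_
    rw [← Finset.card_filter]
    induction b with | h x y => ?_
    refine (Finset.card_le_card (t := {x, y}) fun e he => ?_).trans Finset.card_le_two
    simpa using (Finset.mem_filter.1 he).2
  have := card_filter_lt_mul_le E (edgeBlockCount B) (D := 1) (K := 8) (T := 2 * E.card) hf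
    (by rw [one_mul]; nlinarith)
  simp only [one_mul] at this
  omega

open Classical in
/-- A labelling of the neighbours of `v` in which every label is used at most `D` times. -/
lemma exists_label [Fintype V] (H : SimpleGraph V) {D : ℕ} (hD : 1 ≤ D) (v : V) :
    ∃ L : V → Fin (H.degree v / D + 1), ∀ i, {u | H.Adj v u ∧ L u = i}.ncard ≤ D := by
  have e : H.neighborFinset v ≃ Fin (H.degree v) := Finset.equivFinOfCardEq rfl
  let idx : V → ℕ := fun u => if h : u ∈ H.neighborFinset v then e ⟨u, h⟩ else 0
  have hidx : ∀ u, idx u ≤ H.degree v := fun u => by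
    simp only [idx]
    split_ifs with h
    · exact (e ⟨u, h⟩).2.le
    · exact Nat.zero_le _
  refine ⟨fun u => ⟨idx u / D, Nat.lt_succ_of_le (Nat.div_le_div_right (hidx u))⟩, fun i => ?_⟩
  have hcard : (Finset.Ico (D * i : ℕ) (D * i + D) : Set ℕ).ncard ≤ D := by
    rw [Set.ncard_coe_finset, Nat.card_Ico, Nat.add_sub_cancel_left]
  refine le_trans (Set.ncard_le_ncard_of_injOn idx ?_ ?_ (Finset.finite_toSet _)) hcard
  · rintro u ⟨-, h⟩
    have h := congrArg Fin.val h
    simp only at h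
    have h1 := Nat.mul_div_le (idx u) D
    have h2 := Nat.lt_mul_div_succ (idx u) hD
    rw [h] at h1 h2
    exact Finset.mem_coe.2 (Finset.mem_Ico.2 ⟨h1, by rwa [mul_add, mul_one] at h2⟩)
  · rintro u ⟨hu, -⟩ u' ⟨hu', -⟩ h
    have hu := (H.mem_neighborFinset v u).2 hu
    have hu' := (H.mem_neighborFinset v u').2 hu'
    simp only [idx, dif_pos hu, dif_pos hu'] at h
    have := e.injective (Fin.ext h)
    exact congrArg Subtype.val this

open Classical in
/-- Splitting the vertices of a graph bounds its maximum degree by its average degree. -/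
lemma exists_split [Fintype V] (H : SimpleGraph V) {D : ℕ} (hD : 1 ≤ D) :
    ∃ (W : Type) (_ : Fintype W) (G : SimpleGraph W) (φ : G →g H),
      Set.InjOn (Sym2.map φ) G.edgeSet ∧ (∀ v, {u | G.Adj v u}.ncard ≤ D) ∧
      H.edgeSet.ncard ≤ G.edgeSet.ncard ∧
      Fintype.card W * D ≤ 2 * H.edgeSet.ncard + Fintype.card V * D ∧
      Fintype.card V ≤ Fintype.card W := by
  choose L hL using exists_label H hD
  let G : SimpleGraph (Σ v, Fin (H.degree v / D + 1)) :=
    { Adj := fun p q => H.Adj p.1 q.1 ∧ L p.1 q.1 = p.2 ∧ L q.1 p.1 = q.2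
      symm := ⟨fun p q h => ⟨h.1.symm, h.2.2, h.2.1⟩⟩
      loopless := ⟨fun p h => h.1.ne rfl⟩ }
  have hG : ∀ p q, G.Adj p q ↔ H.Adj p.1 q.1 ∧ L p.1 q.1 = p.2 ∧ L q.1 p.1 = q.2 := fun _ _ =>
    Iff.rfl
  refine ⟨_, inferInstance, G, ⟨Sigma.fst, fun h => h.1⟩, ?_, ?_, ?_, ?_, ?_⟩
  · intro e he e' he' h
    induction e with | h p q => ?_
    induction e' with | h p' q' => ?_
    obtain ⟨u, i⟩ := p
    obtain ⟨v, j⟩ := q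
    obtain ⟨u', i'⟩ := p'
    obtain ⟨v', j'⟩ := q'
    have h1 : L u v = i ∧ L v u = j := ((hG _ _).1 he).2
    have h2 : L u' v' = i' ∧ L v' u' = j' := ((hG _ _).1 he').2
    obtain ⟨rfl, rfl⟩ := h1
    obtain ⟨rfl, rfl⟩ := h2
    have h : s(u, v) = s(u', v') := h
    rcases Sym2.eq_iff.1 h with ⟨rfl, rfl⟩ | ⟨rfl, rfl⟩
    · rfl
    · exact Sym2.eq_swap
  · rintro ⟨v, i⟩
    refine (Set.ncard_le_ncard_of_injOn Sigma.fst ?_ ?_ (Set.toFinite _)).trans (hL v i)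
    · rintro ⟨u, j⟩ h
      exact ⟨h.1, h.2.1⟩
    · rintro ⟨u, j⟩ ⟨-, -, h⟩ ⟨u', j'⟩ ⟨-, -, h'⟩ he
      simp only at he h h'
      subst he
      rw [← h, ← h']
  · refine (Set.ncard_le_ncard (t := Sym2.map Sigma.fst '' G.edgeSet) ?_ (Set.toFinite _)).trans
      (Set.ncard_image_le (Set.toFinite _))
    intro e he
    induction e with | h u v => ?_
    exact ⟨s(⟨u, L u v⟩, ⟨v, L v u⟩), ⟨he, rfl, rfl⟩, rfl⟩
  · have hm : H.edgeSet.ncard = H.edgeFinset.card := by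
      rw [← Set.ncard_coe_finset, SimpleGraph.coe_edgeFinset]
    rw [Fintype.card_sigma, hm, ← H.sum_degrees_eq_twice_card_edges, Finset.sum_mul]
    simp only [Fintype.card_fin, add_mul, one_mul]
    rw [Finset.sum_add_distrib, Finset.sum_const, smul_eq_mul, Finset.card_univ]
    exact Nat.add_le_add_right (Finset.sum_le_sum fun v _ => Nat.div_mul_le_self _ _) _
  · rw [Fintype.card_sigma, Fintype.card, Finset.card_eq_sum_ones]
    exact Finset.sum_le_sum fun v _ => by simp

end Reduction

section Main

open Classical in
theorem exists_edge_bound (M : ℕ) : ∃ C : ℕ, ∀ (V : Type) [Fintype V] (H : SimpleGraph V)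
    (π : Sym2 V → ℕ) (B : Finset (Sym2 (Sym2 V))) (k f : ℕ), k = 2 * M + 1 → 0 < f →
    Set.InjOn π H.edgeSet → IsDoubleBlockingSet H π k B → B.card ≤ f * H.edgeSet.ncard →
    Fintype.card V < H.edgeSet.ncard → ∃ D, H.edgeSet.ncard ≤ Fintype.card V * D ∧
      (D ≤ C * f ∨ D ^ k ≤ C * Fintype.card V ∨ D ^ (k + 1) ≤ C * (Fintype.card V * f ^ (M + 1)) ∨
        D ^ (k + 2) ≤ C * (Fintype.card V * f ^ k)) := by
  obtain ⟨C, hC⟩ := exists_degree_bound M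
  refine ⟨C * (3 * 8 ^ (2 * M + 1)), ?_⟩
  intro V _ H π B k f hk hf hπ hB hBf hm
  set n := Fintype.card V with hn
  set m := H.edgeSet.ncard with hm'
  have hmE : m = H.edgeFinset.card := by
    rw [hm', ← Set.ncard_coe_finset, SimpleGraph.coe_edgeFinset]
  have hn0 : 0 < n := by
    rcases Nat.eq_zero_or_pos n with h | h
    · have := Fintype.card_eq_zero_iff.1 (hn.symm.trans h)
      have : m = 0 := by
        rw [hm', Set.eq_empty_of_isEmpty H.edgeSet, Set.ncard_empty]
      omega
    · exact h
  set D := m / n + 1 with hD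
  have hmD : m ≤ n * D := (Nat.lt_mul_div_succ m hn0).le
  have hnD : n * D ≤ m + n := by
    rw [hD, mul_add, mul_one]
    exact Nat.add_le_add_right (Nat.mul_div_le m n) n
  refine ⟨D, hmD, ?_⟩
  -- delete the edges in too many pairs
  set A := H.edgeFinset.filter fun e => 8 * f < edgeBlockCount B e with hA
  have hAc := card_filter_edgeBlockCount_le H.edgeFinset B hf (by rwa [← hmE])
  set H₂ := H.deleteEdges (A : Set (Sym2 V)) with hH₂
  have hle : H₂ ≤ H := SimpleGraph.deleteEdges_le _
  have hm₂ : m ≤ H₂.edgeSet.ncard + A.card := by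
    rw [hm', hH₂, SimpleGraph.edgeSet_deleteEdges, ← Set.ncard_coe_finset A]
    exact Set.ncard_le_ncard_sdiff_add_ncard _ _ (Set.toFinite _)
  have hm₂' : H₂.edgeSet.ncard ≤ m :=
    Set.ncard_le_ncard (SimpleGraph.edgeSet_mono hle) (Set.toFinite _)
  obtain ⟨W, _, G, φ, hφ, hdeg, hG1, hG2, hG3⟩ := exists_split H₂ (D := D) (Nat.le_add_left 1 _)
  rw [← hn] at hG2 hG3
  have hsys : BlockingSystem G _ _ k (8 * f) :=
    blockingSystem_of_hom hπ hB ((SimpleGraph.Hom.ofLE hle).comp φ) hφ (fun e he => by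
      have h2 : Sym2.map φ e ∈ H₂.edgeSet := by
        induction e with | h x y => exact φ.map_adj he
      have h3 : Sym2.map φ e ∈ (H.deleteEdges (A : Set (Sym2 V))).edgeSet := h2
      rw [SimpleGraph.edgeSet_deleteEdges] at h3
      by_contra! hcon
      exact h3.2 (Finset.mem_coe.2 (Finset.mem_filter.2
        ⟨SimpleGraph.mem_edgeFinset.2 h3.1, hcon⟩)))
  have hW : Fintype.card W ≤ 3 * n := by
    refine le_of_mul_le_mul_right (a := D) ?_ (Nat.succ_pos _)
    linarith
  have hWm : Fintype.card W * D ≤ 8 * G.edgeSet.ncard := by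
    have hAc' : 4 * A.card ≤ m := by rw [hmE]; exact hAc
    omega
  have h8 : 8 ≤ 8 ^ (2 * M + 1) := by
    calc 8 = 8 ^ 1 := rfl
      _ ≤ _ := Nat.pow_le_pow_right (by norm_num) (by omega)
  have h8' : 8 ^ (M + 1) ≤ 8 ^ (2 * M + 1) := Nat.pow_le_pow_right (by norm_num) (by omega)
  have hbound : ∀ {x y z : ℕ}, z ≤ C * x → x ≤ 3 * 8 ^ (2 * M + 1) * y →
      z ≤ C * (3 * 8 ^ (2 * M + 1)) * y := fun hz hx => by
    rw [mul_assoc]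
    exact hz.trans (Nat.mul_le_mul_left _ hx)
  rcases hC W G _ _ k (8 * f) D hk (by omega) (hn0.trans_le hG3) hsys hdeg hWm with h | h | h | h
  · exact .inl (hbound h (Nat.mul_le_mul_right _ (by omega)))
  · exact .inr (.inl (hbound h (hW.trans (Nat.mul_le_mul_right _ (by omega)))))
  · refine .inr (.inr (.inl (hbound h ?_)))
    calc _ ≤ 3 * n * (8 * f) ^ (M + 1) := Nat.mul_le_mul_right _ hW
      _ = 3 * 8 ^ (M + 1) * (n * f ^ (M + 1)) := by rw [mul_pow]; ring
      _ ≤ _ := Nat.mul_le_mul_right _ (Nat.mul_le_mul_left _ h8')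
  · refine .inr (.inr (.inr (hbound h ?_)))
    calc _ ≤ 3 * n * (8 * f) ^ k := Nat.mul_le_mul_right _ hW
      _ = 3 * 8 ^ (2 * M + 1) * (n * f ^ k) := by rw [mul_pow, hk]; ring

lemma le_mul_rpow_of_pow_le {D C x : ℝ} {p : ℕ} (hp : p ≠ 0) (hC : 1 ≤ C)
    (hx : 0 ≤ x) (h : D ^ p ≤ C * x) : D ≤ C * x ^ (1 / (p : ℝ)) := by
  refine le_of_pow_le_pow_left₀ hp (by positivity) (h.trans ?_)
  rw [mul_pow, one_div, Real.rpow_inv_natCast_pow hx hp]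
  gcongr
  exact le_self_pow₀ hC hp

end Main

end DoubleBlocking

/-- For every odd positive integer `k` there is a constant `C_k > 0` such
that if `f` is a positive integer and `H` is a graph on `n` vertices, equipped with a
linear order on its edges, that admits a `2k` double-blocking set of size at most
`f·|E(H)|`, then `|E(H)| ≤ C_k·(n^{1+1/k} + n^{1+1/(k+2)}·f^{k/(k+2)} +
n^{1+1/(k+1)}·f^{1/2} + f·n)`. -/
theorem statement_8 (k : ℕ) (hk : Odd k) :
    ∃ C : ℝ, 0 < C ∧
      ∀ (V : Type) [Fintype V], ∀ (H : SimpleGraph V) (π : Sym2 V → ℕ)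
        (B : Finset (Sym2 (Sym2 V))) (f : ℕ),
        0 < f →
        Set.InjOn π H.edgeSet →
        IsDoubleBlockingSet H π k B →
        B.card ≤ f * H.edgeSet.ncard →
        (H.edgeSet.ncard : ℝ) ≤
          C * ((Fintype.card V : ℝ) ^ (1 + 1 / (k : ℝ))
            + (Fintype.card V : ℝ) ^ (1 + 1 / ((k : ℝ) + 2)) * (f : ℝ) ^ ((k : ℝ) / ((k : ℝ) + 2))
            + (Fintype.card V : ℝ) ^ (1 + 1 / ((k : ℝ) + 1)) * (f : ℝ) ^ ((1 : ℝ) / 2)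
            + (f : ℝ) * (Fintype.card V : ℝ)) := by
  obtain ⟨M, hM⟩ := hk
  obtain ⟨C, hC⟩ := DoubleBlocking.exists_edge_bound M
  have hC1 : (1 : ℝ) ≤ C + 1 := le_add_of_nonneg_left (Nat.cast_nonneg C)
  refine ⟨C + 1, by positivity, ?_⟩
  intro V _ H π B f hf hπ hB hBf
  have hk0 : (0 : ℝ) < k := by exact_mod_cast (by omega : 0 < k)
  have hf1 : (1 : ℝ) ≤ f := by exact_mod_cast hf
  have hn0 : (0 : ℝ) ≤ Fintype.card V := Nat.cast_nonneg _
  have t1 : (0 : ℝ) ≤ (Fintype.card V : ℝ) ^ (1 + 1 / (k : ℝ)) := by positivity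
  have t2 : (0 : ℝ) ≤ (Fintype.card V : ℝ) ^ (1 + 1 / ((k : ℝ) + 2)) *
    (f : ℝ) ^ ((k : ℝ) / ((k : ℝ) + 2)) := by positivity
  have t3 : (0 : ℝ) ≤ (Fintype.card V : ℝ) ^ (1 + 1 / ((k : ℝ) + 1)) *
    (f : ℝ) ^ ((1 : ℝ) / 2) := by positivity
  have t4 : (0 : ℝ) ≤ (f : ℝ) * (Fintype.card V : ℝ) := by positivity
  rcases le_or_gt H.edgeSet.ncard (Fintype.card V) with hm | hm
  · have hm : (H.edgeSet.ncard : ℝ) ≤ Fintype.card V := by exact_mod_cast hm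
    refine (hm.trans (le_mul_of_one_le_left hn0 hf1)).trans ?_
    refine le_trans ?_ (le_mul_of_one_le_left (by positivity) hC1)
    linarith
  obtain ⟨D, hmD, hD⟩ := hC V H π B k f hM hf hπ hB hBf hm
  have hmD : (H.edgeSet.ncard : ℝ) ≤ Fintype.card V * D := by exact_mod_cast hmD
  have hnpow : ∀ {p : ℝ}, 0 < p →
      (Fintype.card V : ℝ) ^ (1 + 1 / p) = Fintype.card V * (Fintype.card V : ℝ) ^ (1 / p) :=
    fun hp => by rw [Real.rpow_add' hn0 (by positivity), Real.rpow_one]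
  -- it suffices to compare the degree parameter with a single term
  have hterm : ∀ {x : ℝ}, (D : ℝ) ≤ (C + 1) * x →
      (H.edgeSet.ncard : ℝ) ≤ (C + 1) * (Fintype.card V * x) := fun h =>
    (hmD.trans (mul_le_mul_of_nonneg_left h hn0)).trans_eq (mul_left_comm _ _ _)
  have hpow : ∀ {p x : ℕ}, p ≠ 0 → D ^ p ≤ C * x →
      (D : ℝ) ≤ (C + 1) * (x : ℝ) ^ (1 / (p : ℝ)) := fun hp h =>
    DoubleBlocking.le_mul_rpow_of_pow_le hp hC1 (Nat.cast_nonneg _) (by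
      exact_mod_cast h.trans (Nat.mul_le_mul_right _ (Nat.le_succ C)))
  rcases hD with h | h | h | h
  · have h : (D : ℝ) ≤ (C + 1) * f := by
      exact_mod_cast h.trans (Nat.mul_le_mul_right _ (Nat.le_succ C))
    refine (hterm h).trans (mul_le_mul_of_nonneg_left ?_ (by positivity))
    rw [mul_comm]
    linarith
  · refine (hterm (hpow (by omega) h)).trans (mul_le_mul_of_nonneg_left ?_ (by positivity))
    rw [← hnpow hk0]
    linarith
  · refine (hterm (hpow (by omega) h)).trans (mul_le_mul_of_nonneg_left ?_ (by positivity))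
    push_cast
    rw [Real.mul_rpow hn0 (by positivity), ← mul_assoc, ← hnpow (by positivity),
      ← Real.rpow_natCast_mul (by positivity)]
    have : ((M + 1 : ℕ) : ℝ) * (1 / ((k : ℝ) + 1)) = 1 / 2 := by
      rw [hM]
      push_cast
      field_simp
      ring
    rw [this]
    linarith
  · refine (hterm (hpow (by omega) h)).trans (mul_le_mul_of_nonneg_left ?_ (by positivity))
    push_cast
    rw [Real.mul_rpow hn0 (by positivity), ← mul_assoc, ← hnpow (by positivity),
      ← Real.rpow_natCast_mul (by positivity), mul_one_div]
    linarith
end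

section
/- Let H be a graph on n vertices with a linear order on its edges, and let d = 2|E(H)|/n be its average degree. For an edge e of H, let H_e be the graph obtained from the subgraph of H consisting of e and all edges preceding e in the order by iteratively deleting vertices of degree at most d/4 (until no such vertex remains); call e a core edge if e survives in H_e. Then at least half of the edges of H are core edges. -/
open SimpleGraph
open scoped ENNReal

/-- Among the edges inside `S` ranked below `m`, at most `|S| * (d / 4)` are not core edges. -/
lemma ncard_not_isCoreEdge_le {V : Type} [Finite V] (H : SimpleGraph V) (π : Sym2 V → ℕ)
    {d : ℝ} (hd : 0 ≤ d) (S : Finset V) (m : ℕ) :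
    ({e ∈ H.edgeSet | ¬ IsCoreEdge H π d e ∧ (∀ x ∈ e, x ∈ S) ∧ π e < m}.ncard : ℝ) ≤
      S.card * (d / 4) := by
  classical
  induction hN : S.card + m using Nat.strong_induction_on generalizing S m with
  | _ N ih =>
  subst hN
  by_cases hlow : ∃ v ∈ S, ({u ∈ (S : Set V) | H.Adj v u ∧ π s(v, u) < m}.ncard : ℝ) ≤ d / 4
  · obtain ⟨v, hv, hdeg⟩ := hlow
    have hcard : (S.erase v).card + 1 = S.card := Finset.card_erase_add_one hv
    have hrec := ih ((S.erase v).card + m) (by omega) (S.erase v) m rfl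
    have hsub : {e ∈ H.edgeSet | ¬ IsCoreEdge H π d e ∧ (∀ x ∈ e, x ∈ S) ∧ π e < m} ⊆
        {e ∈ H.edgeSet | ¬ IsCoreEdge H π d e ∧ (∀ x ∈ e, x ∈ S.erase v) ∧ π e < m} ∪
        (fun u => s(v, u)) '' {u ∈ (S : Set V) | H.Adj v u ∧ π s(v, u) < m} := by
      rintro e ⟨he, hnc, heS, hem⟩
      by_cases hve : v ∈ e
      · obtain ⟨u, rfl⟩ := hve
        exact Or.inr ⟨u, ⟨heS u (Sym2.mem_mk_right v u), he, hem⟩, rfl⟩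
      · refine Or.inl ⟨he, hnc, fun x hx => Finset.mem_erase.2 ⟨?_, heS x hx⟩, hem⟩
        rintro rfl
        exact hve hx
    have hle := (Set.ncard_le_ncard hsub (Set.toFinite _)).trans (Set.ncard_union_le _ _)
    have himage := Set.ncard_image_le (f := fun u => s(v, u))
      (Set.toFinite {u ∈ (S : Set V) | H.Adj v u ∧ π s(v, u) < m})
    have hle' := Nat.cast_le (α := ℝ).2 (hle.trans (Nat.add_le_add_left himage _))
    push_cast at hle'
    have hcard' : (S.card : ℝ) = (S.erase v).card + 1 := by exact_mod_cast hcard.symm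
    rw [hcard']
    linarith
  · push Not at hlow
    cases m with
    | zero => simp only [not_lt_zero, and_false, Set.ofPred_false, Set.ncard_empty, Nat.cast_zero]; positivity
    | succ m =>
      refine le_trans ?_ (ih (S.card + m) (by omega) S m rfl)
      refine Nat.cast_le.2 (Set.ncard_le_ncard ?_ (Set.toFinite _))
      rintro e ⟨he, hnc, heS, hem⟩
      refine ⟨he, hnc, heS, lt_of_le_of_ne (Nat.lt_succ_iff.1 hem) fun hπe => hnc ?_⟩
      refine ⟨he, S, heS, fun v hv => (hlow v hv).trans_le ?_⟩
      refine Nat.cast_le.2 (Set.ncard_le_ncard ?_ (Set.toFinite _))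
      rintro u ⟨hu, hadj, hlt⟩
      refine ⟨hu, ?_⟩
      rw [subEdges, SimpleGraph.fromEdgeSet_adj]
      exact ⟨⟨hadj, hπe ▸ Nat.lt_succ_iff.1 hlt⟩, hadj.ne⟩

/-- Let `H` be a graph on `n` vertices with a linear order on its edges and
average degree `d = 2|E(H)|/n`. For an edge `e`, `e` is a core edge if it survives
iterated deletion of vertices of degree at most `d/4` from the subgraph of edges up to
`e` in the order. Then at least half of the edges of `H` are core edges. -/
theorem statement_9 {V : Type} [Fintype V] (H : SimpleGraph V) (π : Sym2 V → ℕ)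
    (hπ : Set.InjOn π H.edgeSet) :
    (H.edgeSet.ncard : ℝ) ≤
      2 * ({e ∈ H.edgeSet | IsCoreEdge H π (avgDeg H) e}.ncard : ℝ) := by
  have hd : 0 ≤ avgDeg H := by unfold avgDeg; positivity
  obtain ⟨m, hm⟩ := (Set.finite_range π).bddAbove
  have hnon := ncard_not_isCoreEdge_le H π hd Finset.univ (m + 1)
  have hset : {e ∈ H.edgeSet | ¬ IsCoreEdge H π (avgDeg H) e ∧
      (∀ x ∈ e, x ∈ (Finset.univ : Finset V)) ∧ π e < m + 1} =
      H.edgeSet \ {e ∈ H.edgeSet | IsCoreEdge H π (avgDeg H) e} := by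
    ext e
    have := hm ⟨e, rfl⟩
    simp only [Set.mem_ofPred_eq, Set.mem_sdiff, Finset.mem_univ, implies_true, true_and,
      Nat.lt_succ_iff.2 this, and_true]
    tauto
  have hsplit := Set.ncard_sdiff_add_ncard_of_subset
    (Set.sep_subset H.edgeSet (IsCoreEdge H π (avgDeg H))) (Set.toFinite _)
  have hhalf : (Fintype.card V : ℝ) * (avgDeg H / 4) = H.edgeSet.ncard / 2 := by
    rcases isEmpty_or_nonempty V with hV | hV
    · simp [Set.eq_empty_of_isEmpty H.edgeSet]
    · have : (Fintype.card V : ℝ) ≠ 0 := by positivity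
      unfold avgDeg
      field_simp
      ring
  rw [hset, Finset.card_univ, hhalf] at hnon
  have hsplit' := congrArg (Nat.cast (R := ℝ)) hsplit
  push_cast at hsplit'
  change _ + ({e ∈ H.edgeSet | IsCoreEdge H π (avgDeg H) e}.ncard : ℝ) = _ at hsplit'
  linarith
end
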